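/- Extend k-head graph-walking automata with nested pebbles by jump instructions ⟨p, jump_i(x), q⟩ that move head i to the node currently holding pebble x. Then for every k-searchable family of graphs over an alphabet Σ and every k ≥ 1, the family of graph languages accepted by deterministic k-head graph-walking automata with nested pebbles (with jump instructions) equals the family definable in first-order logic with k-ary deterministic transitive closure: DPTWA^k = FO+DTC^k. -/

import Mathlib

namespace NestedPebblesGraphs

/-- A nonempty finite weakly connected directed graph with node and edge labels
from `Sig`, such that no node has two outgoing edges with the same label, nor two
incoming edges with the same label. -/
structure LGraph (Sig : Type) : Type 1 where
  V : Type
  finV : Fintype V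
  neV : Nonempty V
  nlab : V → Sig
  edge : Sig → V → V → Prop
  out_unique : ∀ a u v v', edge a u v → edge a u v' → v = v'
  in_unique : ∀ a u u' v, edge a u v → edge a u' v → u = u'
  conn : ∀ u v : V,
    Relation.ReflTransGen (fun x y => (∃ a, edge a x y) ∨ (∃ a, edge a y x)) u v

variable {Sig : Type}

/-!  ### First-order logic with k-ary transitive closure, on graphs  -/

/-- First-order formulas on graphs over `Sig`, with a `k`-ary transitive closure
operator.  `lab a x` means node `x` has label `a`; `edg a x y` means there is an
`a`-labelled edge from `x` to `y`; `tc xs ys φ us vs` is the transitive closure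
`φ*` of `φ` with respect to the tuples of variables `xs`, `ys` (which it binds),
applied to the tuples of variables `us`, `vs`. -/
inductive GForm (Sig : Type) (k : ℕ) : Type
  | lab (a : Sig) (x : ℕ)
  | edg (a : Sig) (x y : ℕ)
  | eq (x y : ℕ)
  | not (φ : GForm Sig k)
  | and (φ ψ : GForm Sig k)
  | or (φ ψ : GForm Sig k)
  | ex (x : ℕ) (φ : GForm Sig k)
  | all (x : ℕ) (φ : GForm Sig k)
  | tc (xs ys : Fin k → ℕ) (φ : GForm Sig k) (us vs : Fin k → ℕ)

/-- Update a valuation on a tuple of variables simultaneously. -/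
noncomputable def updVec {α : Type} {k : ℕ} (ν : ℕ → α) (xs : Fin k → ℕ) (a : Fin k → α) :
    ℕ → α :=
  fun n => if h : ∃ i, xs i = n then a h.choose else ν n

/-- Satisfaction of a formula in a graph `g` under a valuation of the variables. -/
def GSat {k : ℕ} (g : LGraph Sig) : GForm Sig k → (ℕ → g.V) → Prop
  | .lab a x, ν => g.nlab (ν x) = a
  | .edg a x y, ν => g.edge a (ν x) (ν y)
  | .eq x y, ν => ν x = ν y
  | .not φ, ν => ¬ GSat g φ ν
  | .and φ ψ, ν => GSat g φ ν ∧ GSat g ψ ν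
  | .or φ ψ, ν => GSat g φ ν ∨ GSat g ψ ν
  | .ex x φ, ν => ∃ u : g.V, GSat g φ (Function.update ν x u)
  | .all x φ, ν => ∀ u : g.V, GSat g φ (Function.update ν x u)
  | .tc xs ys φ us vs, ν =>
      Relation.ReflTransGen
        (fun a b : Fin k → g.V => GSat g φ (updVec (updVec ν xs a) ys b))
        (fun i => ν (us i)) (fun i => ν (vs i))

/-- The free variables of a formula. -/
def gfree {k : ℕ} : GForm Sig k → Set ℕ
  | .lab _ x => {x}
  | .edg _ x y => {x, y}
  | .eq x y => {x, y}
  | .not φ => gfree φ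
  | .and φ ψ => gfree φ ∪ gfree ψ
  | .or φ ψ => gfree φ ∪ gfree ψ
  | .ex x φ => gfree φ \ {x}
  | .all x φ => gfree φ \ {x}
  | .tc xs ys φ us vs =>
      (gfree φ \ (Set.range xs ∪ Set.range ys)) ∪ Set.range us ∪ Set.range vs

/-- Two `k`-tuples of variables consist of `2k` pairwise distinct variables. -/
def Distinct2 {k : ℕ} (xs ys : Fin k → ℕ) : Prop :=
  Function.Injective xs ∧ Function.Injective ys ∧ ∀ i j, xs i ≠ ys j

/-- `φ` is functional in the tuples of variables `xs`, `ys`. -/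
def GFunctionalIn {k : ℕ} (φ : GForm Sig k) (xs ys : Fin k → ℕ) : Prop :=
  ∀ (g : LGraph Sig) (ν : ℕ → g.V) (a b b' : Fin k → g.V),
    GSat g φ (updVec (updVec ν xs a) ys b) →
    GSat g φ (updVec (updVec ν xs a) ys b') → b = b'

/-- Well-formedness: in each transitive closure the `2k` bound variables are
pairwise distinct and occur free in the body. -/
def GWF {k : ℕ} : GForm Sig k → Prop
  | .not φ => GWF φ
  | .and φ ψ => GWF φ ∧ GWF ψ
  | .or φ ψ => GWF φ ∧ GWF ψ
  | .ex _ φ => GWF φ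
  | .all _ φ => GWF φ
  | .tc xs ys φ _ _ =>
      Distinct2 xs ys ∧ (Set.range xs ∪ Set.range ys) ⊆ gfree φ ∧ GWF φ
  | _ => True

/-- All transitive closures occurring in the formula are deterministic. -/
def GDetTC {k : ℕ} : GForm Sig k → Prop
  | .not φ => GDetTC φ
  | .and φ ψ => GDetTC φ ∧ GDetTC ψ
  | .or φ ψ => GDetTC φ ∧ GDetTC ψ
  | .ex _ φ => GDetTC φ
  | .all _ φ => GDetTC φ
  | .tc xs ys φ _ _ => GFunctionalIn φ xs ys ∧ GDetTC φ
  | _ => True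

/-- All occurrences of transitive closure are positive. -/
def GPosTC {k : ℕ} : Bool → GForm Sig k → Prop
  | b, .not φ => GPosTC (!b) φ
  | b, .and φ ψ => GPosTC b φ ∧ GPosTC b ψ
  | b, .or φ ψ => GPosTC b φ ∧ GPosTC b ψ
  | b, .ex _ φ => GPosTC b φ
  | b, .all _ φ => GPosTC b φ
  | b, .tc _ _ φ _ _ => b = true ∧ GPosTC b φ
  | _, _ => True

/-- The formula contains no transitive closure operator (pure first-order). -/
def GTCFree {k : ℕ} : GForm Sig k → Prop
  | .not φ => GTCFree φ
  | .and φ ψ => GTCFree φ ∧ GTCFree ψ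
  | .or φ ψ => GTCFree φ ∧ GTCFree ψ
  | .ex _ φ => GTCFree φ
  | .all _ φ => GTCFree φ
  | .tc _ _ _ _ _ => False
  | _ => True

/-- `FO+DTC^k` graph languages within the family `F`: those defined by closed
formulas with deterministic `k`-ary transitive closure. -/
def FODTCg (Sig : Type) (F : Set (LGraph Sig)) (k : ℕ) : Set (Set (LGraph Sig)) :=
  {L | ∃ φ : GForm Sig k, GWF φ ∧ GDetTC φ ∧ gfree φ = ∅ ∧
        L = {g | g ∈ F ∧ ∀ ν : ℕ → g.V, GSat g φ ν}}

/-- `FO+posTC^k` graph languages within the family `F`. -/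
def FOposTCg (Sig : Type) (F : Set (LGraph Sig)) (k : ℕ) : Set (Set (LGraph Sig)) :=
  {L | ∃ φ : GForm Sig k, GWF φ ∧ GPosTC true φ ∧ gfree φ = ∅ ∧
        L = {g | g ∈ F ∧ ∀ ν : ℕ → g.V, GSat g φ ν}}

/-!  ### k-head graph-walking automata with nested pebbles  -/

/-- Tests of a `k`-head graph-walking automaton with pebble set `X`. -/
inductive GTest (Sig : Type) (k : ℕ) (X : Type) : Type
  | lab (i : Fin k) (a : Sig)
  | inedge (i : Fin k) (a : Sig)
  | outedge (i : Fin k) (a : Sig)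
  | peb (i : Fin k) (x : X)

/-- Instructions: move head `i` along an incoming or outgoing `a`-labelled edge,
drop a pebble at head `i`, retrieve the most recently dropped pebble (from a
distance), jump head `i` to the node holding pebble `x`, or perform a positive
(`b = true`) or negated (`b = false`) test. -/
inductive GInstr (Sig : Type) (k : ℕ) (X : Type) : Type
  | inmove (i : Fin k) (a : Sig)
  | outmove (i : Fin k) (a : Sig)
  | dropPeb (i : Fin k) (x : X)
  | retrieve (x : X)
  | jump (i : Fin k) (x : X)
  | test (b : Bool) (τ : GTest Sig k X)

/-- A `k`-head graph-walking automaton with nested pebbles. -/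
structure GWA (Sig : Type) (k : ℕ) : Type 1 where
  Q : Type
  finQ : Fintype Q
  X : Type
  finX : Fintype X
  q0 : Q
  acc : Set Q
  instr : Set (Q × GInstr Sig k X × Q)
  instrFin : instr.Finite

/-- Configurations: a state, the positions of the `k` heads, and the stack of
dropped pebbles with their positions (most recent first). -/
abbrev GConf {k : ℕ} (A : GWA Sig k) (g : LGraph Sig) : Type :=
  A.Q × (Fin k → g.V) × List (A.X × g.V)

/-- Semantics of tests. -/
def gTestHolds {k : ℕ} (g : LGraph Sig) {X : Type} (τ : GTest Sig k X)
    (hs : Fin k → g.V) (π : List (X × g.V)) : Prop :=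
  match τ with
  | .lab i a => g.nlab (hs i) = a
  | .inedge i a => ∃ u, g.edge a u (hs i)
  | .outedge i a => ∃ v, g.edge a (hs i) v
  | .peb i x => (x, hs i) ∈ π

/-- Semantics of a single instruction. -/
def gInstrStep {k : ℕ} (g : LGraph Sig) {X : Type} (ins : GInstr Sig k X)
    (hs : Fin k → g.V) (π : List (X × g.V))
    (hs' : Fin k → g.V) (π' : List (X × g.V)) : Prop :=
  match ins with
  | .inmove i a => π' = π ∧ g.edge a (hs' i) (hs i) ∧ ∀ h, h ≠ i → hs' h = hs h
  | .outmove i a => π' = π ∧ g.edge a (hs i) (hs' i) ∧ ∀ h, h ≠ i → hs' h = hs h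
  | .dropPeb i x => hs' = hs ∧ π' = (x, hs i) :: π ∧ ∀ w, (x, w) ∉ π
  | .retrieve x => hs' = hs ∧ ∃ w, π = (x, w) :: π'
  | .jump i x => π' = π ∧ (x, hs' i) ∈ π ∧ ∀ h, h ≠ i → hs' h = hs h
  | .test b τ => hs' = hs ∧ π' = π ∧ (gTestHolds g τ hs π ↔ b = true)

/-- The step relation of automaton `A` on graph `g`. -/
def GStep {k : ℕ} (A : GWA Sig k) (g : LGraph Sig) : GConf A g → GConf A g → Prop :=
  fun c c' => ∃ ins : GInstr Sig k A.X,
    (c.1, ins, c'.1) ∈ A.instr ∧ gInstrStep g ins c.2.1 c.2.2 c'.2.1 c'.2.2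

/-- `χ'` is the negation of the test `χ`. -/
def gNegOf {k : ℕ} {X : Type} (χ χ' : GInstr Sig k X) : Prop :=
  ∃ b τ, χ = GInstr.test b τ ∧ χ' = GInstr.test (!b) τ

/-- Determinism: any two distinct instructions with the same source state consist
of a test and its negation. -/
def GDeterministic {k : ℕ} (A : GWA Sig k) : Prop :=
  ∀ p χ₁ q₁ χ₂ q₂, (p, χ₁, q₁) ∈ A.instr → (p, χ₂, q₂) ∈ A.instr →
    (χ₁, q₁) ≠ (χ₂, q₂) → gNegOf χ₁ χ₂ ∨ gNegOf χ₂ χ₁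

/-- A configuration is halting if no step is possible from it. -/
def GHaltingConf {k : ℕ} (A : GWA Sig k) (g : LGraph Sig) (c : GConf A g) : Prop :=
  ∀ c', ¬ GStep A g c c'

/-- There is an accepting computation started with all heads on node `u`:
it starts in the initial state with no pebbles, and halts in an accepting state
with no pebbles on the graph. -/
def AccFrom {k : ℕ} (A : GWA Sig k) (g : LGraph Sig) (u : g.V) : Prop :=
  ∃ (q : A.Q) (hs : Fin k → g.V), q ∈ A.acc ∧
    Relation.ReflTransGen (GStep A g) (A.q0, fun _ => u, []) (q, hs, []) ∧
    GHaltingConf A g (q, hs, [])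

/-- `A` accepts `g`: for every choice of initial node there is an accepting
computation. -/
def GAccepts {k : ℕ} (A : GWA Sig k) (g : LGraph Sig) : Prop :=
  ∀ u : g.V, AccFrom A g u

/-- The restriction on automata: acceptance is independent of the initial node. -/
def NodeIndependent {k : ℕ} (A : GWA Sig k) : Prop :=
  ∀ (g : LGraph Sig) (u₁ u₂ : g.V), AccFrom A g u₁ → AccFrom A g u₂

/-- The automaton uses no jump instructions (the basic model). -/
def NoJump {k : ℕ} (A : GWA Sig k) : Prop :=
  ∀ p χ q, (p, χ, q) ∈ A.instr → ∀ i x, χ ≠ GInstr.jump i x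

/-- `DPTWA^k` within the family `F`: graph languages accepted by deterministic
`k`-head graph-walking automata with nested pebbles (no jump instructions). -/
def DPTWAg (Sig : Type) (F : Set (LGraph Sig)) (k : ℕ) : Set (Set (LGraph Sig)) :=
  {L | ∃ A : GWA Sig k, GDeterministic A ∧ NoJump A ∧ NodeIndependent A ∧
        L = {g | g ∈ F ∧ GAccepts A g}}

/-- `DPTWA^k` within the family `F`, for the model extended with jump
instructions. -/
def DPTWAgJ (Sig : Type) (F : Set (LGraph Sig)) (k : ℕ) : Set (Set (LGraph Sig)) :=
  {L | ∃ A : GWA Sig k, GDeterministic A ∧ NodeIndependent A ∧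
        L = {g | g ∈ F ∧ GAccepts A g}}

/-- `NPTWA^k` within the family `F`: graph languages accepted by nondeterministic
`k`-head graph-walking automata with nested pebbles (no jump instructions). -/
def NPTWAg (Sig : Type) (F : Set (LGraph Sig)) (k : ℕ) : Set (Set (LGraph Sig)) :=
  {L | ∃ A : GWA Sig k, NoJump A ∧ NodeIndependent A ∧
        L = {g | g ∈ F ∧ GAccepts A g}}

/-- Started with all heads on node `u` of `g`, the (deterministic) automaton `A`
performs a walk that halts and during which every node of `g` is visited by some
head at least once. -/
def SearchesFrom {k : ℕ} (A : GWA Sig k) (g : LGraph Sig) (u : g.V) : Prop :=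
  ∃ (n : ℕ) (cs : Fin (n + 1) → GConf A g),
    cs 0 = (A.q0, fun _ => u, []) ∧
    (∀ i : Fin n, GStep A g (cs i.castSucc) (cs i.succ)) ∧
    GHaltingConf A g (cs (Fin.last n)) ∧
    ∀ v : g.V, ∃ (i : Fin (n + 1)) (h : Fin k), (cs i).2.1 h = v

/-- A family of graphs is `k`-searchable if some fixed deterministic `k`-head
graph-walking automaton with nested pebbles (a guide) traverses every graph of the
family from every initial node, visiting all nodes and halting. -/
def kSearchable (Sig : Type) (F : Set (LGraph Sig)) (k : ℕ) : Prop :=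
  ∃ A : GWA Sig k, GDeterministic A ∧ NoJump A ∧
    ∀ g ∈ F, ∀ u : g.V, SearchesFrom A g u

/-- A family of graphs is searchable if it is `1`-searchable, i.e., some fixed
single-head deterministic graph-walking automaton with nested pebbles traverses
every graph of the family. -/
def Searchable (Sig : Type) (F : Set (LGraph Sig)) : Prop :=
  kSearchable Sig F 1

/-- Replacing the node labels of a graph. -/
def relabel (g : LGraph Sig) (f : g.V → Sig) : LGraph Sig :=
  { g with nlab := f }

/-- Membership in the family does not depend on the node labels. -/
def NodeLabelInsensitive (F : Set (LGraph Sig)) : Prop :=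
  ∀ g ∈ F, ∀ f : g.V → Sig, relabel g f ∈ F

end NestedPebblesGraphs

namespace NestedPebblesGraphs
variable {Sig : Type}

/-! ### Part 1: definable relations -/

lemma updVec_inj {α : Type} {k : ℕ} (ν : ℕ → α) (xs : Fin k → ℕ) (h : Function.Injective xs)
    (a : Fin k → α) (i : Fin k) : updVec ν xs a (xs i) = a i := by
  unfold updVec
  have hh : ∃ j, xs j = xs i := ⟨i, rfl⟩
  rw [dif_pos hh]
  congr 1
  exact h hh.choose_spec

lemma updVec_not {α : Type} {k : ℕ} (ν : ℕ → α) (xs : Fin k → ℕ)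
    (a : Fin k → α) (n : ℕ) (h : ∀ i, xs i ≠ n) : updVec ν xs a n = ν n := by
  unfold updVec
  rw [dif_neg]
  rintro ⟨i, hi⟩
  exact h i hi

/-- A relation is definable (for every naming of its arguments by variables). -/
def Defn (k : ℕ) (ι : Type) (R : ∀ g : LGraph Sig, (ι → g.V) → Prop) : Prop :=
  ∀ e : ι → ℕ, ∃ φ : GForm Sig k, GWF φ ∧ GDetTC φ ∧
    ∀ (g : LGraph Sig) (ν : ℕ → g.V), GSat g φ ν ↔ R g (fun i => ν (e i))

namespace Defn
variable {k : ℕ} {ι κ : Type}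

lemma congr {R S : ∀ g : LGraph Sig, (ι → g.V) → Prop} (hR : Defn k ι R)
    (h : ∀ g w, S g w ↔ R g w) : Defn k ι S := by
  intro e
  obtain ⟨φ, h1, h2, h3⟩ := hR e
  exact ⟨φ, h1, h2, fun g ν => (h3 g ν).trans (h _ _).symm⟩

lemma rename {R : ∀ g : LGraph Sig, (ι → g.V) → Prop} (hR : Defn k ι R) (f : ι → κ) :
    Defn k κ (fun g w => R g (fun i => w (f i))) := fun e => hR (fun i => e (f i))

lemma not {R : ∀ g : LGraph Sig, (ι → g.V) → Prop} (hR : Defn k ι R) :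
    Defn k ι (fun g w => ¬ R g w) := by
  intro e
  obtain ⟨φ, h1, h2, h3⟩ := hR e
  exact ⟨.not φ, h1, h2, fun g ν => by simp only [GSat, h3]⟩

lemma and {R S : ∀ g : LGraph Sig, (ι → g.V) → Prop} (hR : Defn k ι R) (hS : Defn k ι S) :
    Defn k ι (fun g w => R g w ∧ S g w) := by
  intro e
  obtain ⟨φ, h1, h2, h3⟩ := hR e
  obtain ⟨ψ, h4, h5, h6⟩ := hS e
  exact ⟨.and φ ψ, ⟨h1, h4⟩, ⟨h2, h5⟩, fun g ν => by simp only [GSat, h3, h6]⟩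

lemma or {R S : ∀ g : LGraph Sig, (ι → g.V) → Prop} (hR : Defn k ι R) (hS : Defn k ι S) :
    Defn k ι (fun g w => R g w ∨ S g w) := by
  intro e
  obtain ⟨φ, h1, h2, h3⟩ := hR e
  obtain ⟨ψ, h4, h5, h6⟩ := hS e
  exact ⟨.or φ ψ, ⟨h1, h4⟩, ⟨h2, h5⟩, fun g ν => by simp only [GSat, h3, h6]⟩

lemma const (P : Prop) : Defn (Sig := Sig) k ι (fun _ _ => P) := by
  intro e
  by_cases hP : P
  · exact ⟨.eq 0 0, trivial, trivial, fun g ν => by simp [GSat, hP]⟩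
  · exact ⟨.not (.eq 0 0), trivial, trivial, fun g ν => by simp [GSat, hP]⟩

lemma eq (i j : ι) : Defn (Sig := Sig) k ι (fun _ w => w i = w j) := fun e =>
  ⟨.eq (e i) (e j), trivial, trivial, fun g ν => by simp [GSat]⟩

lemma lab (a : Sig) (i : ι) : Defn (Sig := Sig) k ι (fun g w => g.nlab (w i) = a) := fun e =>
  ⟨.lab a (e i), trivial, trivial, fun g ν => by simp [GSat]⟩

lemma edg (a : Sig) (i j : ι) : Defn (Sig := Sig) k ι (fun g w => g.edge a (w i) (w j)) := fun e =>
  ⟨.edg a (e i) (e j), trivial, trivial, fun g ν => by simp [GSat]⟩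

lemma exFinite {T : Type} [Finite T] {R : T → ∀ g : LGraph Sig, (ι → g.V) → Prop}
    (hR : ∀ t, Defn k ι (R t)) : Defn k ι (fun g w => ∃ t, R t g w) := by
  have key : ∀ l : List T, Defn k ι (fun g w => ∃ t ∈ l, R t g w) := by
    intro l
    induction l with
    | nil => exact (const False).congr (by simp)
    | cons t l ih => exact ((hR t).or ih).congr (by simp)
  obtain ⟨l, hl⟩ := Finite.exists_univ_list T
  exact (key l).congr (by simp [hl.2])

lemma allFinite {T : Type} [Finite T] {R : T → ∀ g : LGraph Sig, (ι → g.V) → Prop}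
    (hR : ∀ t, Defn k ι (R t)) : Defn k ι (fun g w => ∀ t, R t g w) :=
  (exFinite (fun t => (hR t).not)).not.congr (by simp)

lemma exists_bound [Finite ι] (e : ι → ℕ) : ∃ B, ∀ i, e i < B := by
  obtain ⟨B, hB⟩ := (Set.finite_range e).bddAbove
  exact ⟨B + 1, fun i => Nat.lt_succ_of_le (hB ⟨i, rfl⟩)⟩

lemma ex [Finite ι] {R : ∀ g : LGraph Sig, (Option ι → g.V) → Prop} (hR : Defn k (Option ι) R) :
    Defn k ι (fun g w => ∃ u : g.V, R g (fun o => o.elim u w)) := by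
  intro e
  obtain ⟨B, hB⟩ := exists_bound e
  obtain ⟨φ, h1, h2, h3⟩ := hR (fun o => o.elim B e)
  refine ⟨.ex B φ, h1, h2, fun g ν => ?_⟩
  simp only [GSat, h3]
  refine exists_congr fun u => ?_
  apply iff_of_eq
  congr 1
  funext o
  cases o with
  | none => simp
  | some i => simp [Function.update, (hB i).ne]

lemma exVec {n : ℕ} : ∀ {ι : Type} [Finite ι] {R : ∀ g : LGraph Sig, (ι ⊕ Fin n → g.V) → Prop},
    Defn k (ι ⊕ Fin n) R →
    Defn k ι (fun g w => ∃ z : Fin n → g.V, R g (Sum.elim w z)) := by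
  induction n with
  | zero =>
    intro ι _ R hR e
    obtain ⟨φ, h1, h2, h3⟩ := hR (Sum.elim e Fin.elim0)
    refine ⟨φ, h1, h2, fun g ν => (h3 g ν).trans ?_⟩
    have : ∀ z : Fin 0 → g.V, (Sum.elim (fun i => ν (e i)) z) =
        (fun i => ν (Sum.elim e Fin.elim0 i)) := by
      intro z; funext i
      rcases i with i | i
      · rfl
      · exact i.elim0
    simp [this]
  | succ n ih =>
    intro ι _ R hR
    have h1 := ih (ι := Option ι) (hR.rename (fun x : ι ⊕ Fin (n+1) =>
      Sum.elim (fun i => Sum.inl (some i)) (fun j => Fin.cases (Sum.inl none) Sum.inr j) x :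
        ι ⊕ Fin (n+1) → Option ι ⊕ Fin n))
    refine h1.ex.congr fun g w => ?_
    rw [Fin.exists_fin_succ_pi]
    refine exists_congr fun u => exists_congr fun z => ?_
    apply iff_of_eq
    congr 1
    funext o
    rcases o with o | o
    · rfl
    · cases o using Fin.cases <;> rfl

lemma tc [Finite ι] {R : ∀ g : LGraph Sig, (ι ⊕ (Fin k ⊕ Fin k) → g.V) → Prop}
    (hR : Defn k (ι ⊕ (Fin k ⊕ Fin k)) R)
    (hf : ∀ g w a b b', R g (Sum.elim w (Sum.elim a b)) → R g (Sum.elim w (Sum.elim a b')) → b = b') :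
    Defn k (ι ⊕ (Fin k ⊕ Fin k)) (fun g w => Relation.ReflTransGen
      (fun a b => R g (Sum.elim (fun i => w (.inl i)) (Sum.elim a b)))
      (fun i => w (.inr (.inl i))) (fun i => w (.inr (.inr i)))) := by
  intro e
  obtain ⟨B, hB⟩ := exists_bound e
  set xs : Fin k → ℕ := fun i => B + i with hxs
  set ys : Fin k → ℕ := fun i => B + k + i with hys
  have hix : Function.Injective xs := fun i j h => by ext; simp [hxs] at h; exact h
  have hiy : Function.Injective ys := fun i j h => by ext; simp [hys] at h; exact h
  have hxy : ∀ i j, xs i ≠ ys j := fun i j => by simp only [hxs, hys]; omega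
  obtain ⟨φ, h1, h2, h3⟩ := hR (Sum.elim (fun i => e (.inl i)) (Sum.elim xs ys))
  obtain ⟨tt, ht1, ht2, ht3, ht4⟩ : ∃ tt : GForm Sig k, GWF tt ∧ GDetTC tt ∧
      (∀ (g : LGraph Sig) ν, GSat g tt ν) ∧ (Set.range xs ∪ Set.range ys) ⊆ gfree tt := by
    have key : ∀ l : List ℕ, ∃ tt : GForm Sig k, GWF tt ∧ GDetTC tt ∧
      (∀ (g : LGraph Sig) ν, GSat g tt ν) ∧ ∀ n ∈ l, n ∈ gfree tt := by
      intro l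
      induction l with
      | nil => exact ⟨.eq 0 0, trivial, trivial, fun g ν => by simp [GSat], by simp⟩
      | cons n l ih =>
        obtain ⟨t, a1, a2, a3, a4⟩ := ih
        refine ⟨.and (.eq n n) t, ⟨trivial, a1⟩, ⟨trivial, a2⟩, fun g ν => by simp [GSat, a3], ?_⟩
        intro m hm
        simp only [gfree]
        rcases List.mem_cons.1 hm with rfl | hm
        · left; simp
        · right; exact a4 m hm
    obtain ⟨tt, a1, a2, a3, a4⟩ := key (List.range (B + k + k))
    refine ⟨tt, a1, a2, a3, ?_⟩
    rintro n (⟨i, rfl⟩ | ⟨i, rfl⟩) <;> apply a4 <;> simp [hxs, hys] <;> omega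
  have key : ∀ (g : LGraph Sig) (ν : ℕ → g.V) a b,
      GSat g (.and tt φ) (updVec (updVec ν xs a) ys b) ↔
        R g (Sum.elim (fun i => ν (e (.inl i))) (Sum.elim a b)) := by
    intro g ν a b
    simp only [GSat, ht3, true_and, h3]
    apply iff_of_eq
    congr 1
    funext i
    rcases i with i | i | i
    · have := hB (.inl i)
      simp only [Sum.elim_inl]
      rw [updVec_not _ _ _ _ (fun j => by simp only [hys]; omega),
        updVec_not _ _ _ _ (fun j => by simp only [hxs]; omega)]
    · simp only [Sum.elim_inl, Sum.elim_inr]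
      rw [updVec_not _ _ _ _ (fun j => (hxy i j).symm), updVec_inj _ _ hix]
    · simp only [Sum.elim_inr]
      rw [updVec_inj _ _ hiy]
  refine ⟨.tc xs ys (.and tt φ) (fun i => e (.inr (.inl i))) (fun i => e (.inr (.inr i))),
    ⟨⟨hix, hiy, hxy⟩, ht4.trans (by simp [gfree]), ht1, h1⟩, ⟨?_, ht2, h2⟩, ?_⟩
  · intro g ν a b b' hb hb'
    rw [key] at hb hb'
    exact hf _ _ _ _ _ hb hb'
  · intro g ν
    simp only [GSat]
    have : (fun a b : Fin k → g.V => GSat g (.and tt φ) (updVec (updVec ν xs a) ys b)) =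
      (fun a b => R g (Sum.elim (fun i => ν (e (.inl i))) (Sum.elim a b))) := by
      funext a b; exact propext (key g ν a b)
    rw [← this]; simp only [GSat]

end Defn

lemma gfree_finite {k : ℕ} (φ : GForm Sig k) : (gfree φ).Finite := by
  induction φ with
  | lab a x => simp [gfree]
  | edg a x y => simp [gfree]
  | eq x y => simp [gfree]
  | not φ ih => simpa [gfree] using ih
  | and φ ψ h1 h2 => simp [gfree, h1, h2]
  | or φ ψ h1 h2 => simp [gfree, h1, h2]
  | ex x φ ih => exact ih.subset Set.sdiff_subset
  | all x φ ih => exact ih.subset Set.sdiff_subset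
  | tc xs ys φ us vs ih =>
    simp only [gfree]
    exact ((ih.subset Set.sdiff_subset).union (Set.finite_range _)).union (Set.finite_range _)

/-- Universal closure. -/
lemma exists_closure {k : ℕ} (φ : GForm Sig k) (h1 : GWF φ) (h2 : GDetTC φ) :
    ∃ ψ : GForm Sig k, GWF ψ ∧ GDetTC ψ ∧ gfree ψ = ∅ ∧
      ∀ g : LGraph Sig, (∀ ν, GSat g ψ ν) ↔ ∀ ν, GSat g φ ν := by
  have key : ∀ s : Finset ℕ, ∃ ψ : GForm Sig k, GWF ψ ∧ GDetTC ψ ∧ gfree ψ = gfree φ \ s ∧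
      ∀ g : LGraph Sig, (∀ ν, GSat g ψ ν) ↔ ∀ ν, GSat g φ ν := by
    intro s
    induction s using Finset.induction_on with
    | empty => exact ⟨φ, h1, h2, by simp, fun g => Iff.rfl⟩
    | insert x s _ ih =>
      obtain ⟨ψ, a1, a2, a3, a4⟩ := ih
      refine ⟨.all x ψ, a1, a2, ?_, fun g => ?_⟩
      · simp only [gfree, a3]
        ext n; simp; tauto
      · rw [← a4]
        simp only [GSat]
        constructor
        · intro h ν
          simpa using h ν (ν x)
        · intro h ν u
          exact h _
  obtain ⟨ψ, a1, a2, a3, a4⟩ := key (gfree_finite φ).toFinset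
  exact ⟨ψ, a1, a2, by simp [a3], a4⟩

end NestedPebblesGraphs

namespace NestedPebblesGraphs
variable {Sig : Type}
open Relation

/-! ### Part 2: Kleene's construction for functional relations -/

lemma rtg_mono {α : Type*} {r s : α → α → Prop} {a b : α} (h : ReflTransGen r a b)
    (hrs : ∀ a b, r a b → s a b) : ReflTransGen s a b := by
  induction h with
  | refl => exact .refl
  | tail _ h ih => exact ih.tail (hrs _ _ h)

section Kleene
variable {Q D : Type}

/-- Paths of length at least one whose intermediate points have states in `S`. -/
def Via (M : Q × D → Q × D → Prop) (S : Set Q) (x y : Q × D) : Prop :=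
  ∃ z, ReflTransGen (fun u v => M u v ∧ v.1 ∈ S) x z ∧ M z y

lemma via_step {M : Q × D → Q × D → Prop} {S : Set Q} {x y : Q × D} (h : M x y) : Via M S x y :=
  ⟨x, .refl, h⟩

lemma via_head {M : Q × D → Q × D → Prop} {S : Set Q} {x x' y : Q × D} (h : M x x')
    (hs : x'.1 ∈ S) (h' : Via M S x' y) : Via M S x y := by
  obtain ⟨z, h1, h2⟩ := h'
  exact ⟨z, .head ⟨h, hs⟩ h1, h2⟩

lemma via_empty (M : Q × D → Q × D → Prop) (x y : Q × D) : Via M ∅ x y ↔ M x y := by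
  constructor
  · rintro ⟨z, h1, h2⟩
    have : x = z := by
      induction h1 with
      | refl => rfl
      | tail _ h _ => exact absurd h.2 (by simp)
    rwa [this]
  · exact via_step

lemma via_insert (M : Q × D → Q × D → Prop) (S : Set Q) (r : Q) (x y : Q × D) :
    Via M (insert r S) x y ↔ Via M S x y ∨
      ∃ c d, Via M S x (r, c) ∧ ReflTransGen (fun c d => Via M S (r, c) (r, d)) c d ∧
        Via M S (r, d) y := by
  constructor
  · rintro ⟨z, h1, h2⟩
    induction h1 using ReflTransGen.head_induction_on with
    | refl => exact .inl (via_step h2)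
    | @head x x' hx _ ih =>
      obtain ⟨hm, hs⟩ := hx
      rcases hs with hs | hs
      · obtain ⟨p, c⟩ := x'
        obtain rfl : p = r := hs
        right
        rcases ih with ih | ⟨c', d, h3, h4, h5⟩
        · exact ⟨c, c, via_step hm, .refl, ih⟩
        · exact ⟨c, d, via_step hm, .head h3 h4, h5⟩
      · rcases ih with ih | ⟨c', d, h3, h4, h5⟩
        · exact .inl (via_head hm hs ih)
        · exact .inr ⟨c', d, via_head hm hs h3, h4, h5⟩
  · have mono : ∀ {x y}, Via M S x y → Via M (insert r S) x y := by
      rintro x y ⟨z, h1, h2⟩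
      exact ⟨z, rtg_mono h1 (fun _ _ h => ⟨h.1, Or.inr h.2⟩), h2⟩
    have comp : ∀ {x y c}, Via M S x (r, c) → Via M (insert r S) (r, c) y →
        Via M (insert r S) x y := by
      rintro x y c ⟨z, h1, h2⟩ ⟨z', h3, h4⟩
      refine ⟨z', ?_, h4⟩
      exact ((rtg_mono h1 (fun _ _ h => ⟨h.1, Or.inr h.2⟩)).tail ⟨h2, Or.inl rfl⟩).trans h3
    rintro (h | ⟨c, d, h1, h2, h3⟩)
    · exact mono h
    · refine comp h1 ?_
      clear h1
      induction h2 using ReflTransGen.head_induction_on with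
      | refl => exact mono h3
      | head h _ ih => exact comp h ih

lemma via_univ (M : Q × D → Q × D → Prop) (x y : Q × D) :
    ReflTransGen M x y ↔ x = y ∨ Via M Set.univ x y := by
  constructor
  · intro h
    induction h with
    | refl => exact .inl rfl
    | tail h1 h2 _ => exact .inr ⟨_, rtg_mono h1 (fun _ _ h => ⟨h, trivial⟩), h2⟩
  · rintro (rfl | ⟨z, h1, h2⟩)
    · exact .refl
    · exact (rtg_mono h1 (fun _ _ h => h.1)).tail h2

lemma via_functional {M : Q × D → Q × D → Prop} {S : Set Q}
    (hM : ∀ x y y', M x y → M x y' → y = y') {x y y' : Q × D}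
    (hy : y.1 ∉ S) (hy' : y'.1 ∉ S) (h : Via M S x y) (h' : Via M S x y') : y = y' := by
  obtain ⟨z, h1, h2⟩ := h
  obtain ⟨z', h3, h4⟩ := h'
  induction h1 using ReflTransGen.head_induction_on with
  | refl =>
    rcases h3.cases_head with rfl | ⟨t, ht, _⟩
    · exact hM _ _ _ h2 h4
    · exact absurd ht.2 (hM _ _ _ ht.1 h2 ▸ hy)
  | head h _ ih =>
    rcases h3.cases_head with rfl | ⟨t, ht, h5⟩
    · exact absurd h.2 (hM _ _ _ h.1 h4 ▸ hy')
    · exact ih (hM _ _ _ h.1 ht.1 ▸ h5)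

end Kleene

/-- Kleene's theorem for definable functional relations with finitely many states. -/
lemma defn_kleene {k : ℕ} {ι Q : Type} [Finite ι] [Finite Q]
    (M : ∀ g : LGraph Sig, (ι → g.V) → Q × (Fin k → g.V) → Q × (Fin k → g.V) → Prop)
    (hM : ∀ p q, Defn k (ι ⊕ (Fin k ⊕ Fin k)) (fun g w => M g (fun i => w (.inl i))
      (p, fun i => w (.inr (.inl i))) (q, fun i => w (.inr (.inr i)))))
    (hf : ∀ g w x y y', M g w x y → M g w x y' → y = y') (p q : Q) :
    Defn k (ι ⊕ (Fin k ⊕ Fin k)) (fun g w => ReflTransGen (M g (fun i => w (.inl i)))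
      (p, fun i => w (.inr (.inl i))) (q, fun i => w (.inr (.inr i)))) := by
  have key : ∀ l : List Q, l.Nodup → ∀ p q, Defn k (ι ⊕ (Fin k ⊕ Fin k))
      (fun g w => Via (M g (fun i => w (.inl i))) {s | s ∈ l}
        (p, fun i => w (.inr (.inl i))) (q, fun i => w (.inr (.inr i)))) := by
    intro l
    induction l with
    | nil =>
      intro _ p q
      refine (hM p q).congr fun g w => ?_
      simp only [List.not_mem_nil, Set.ofPred_false]
      exact via_empty _ _ _
    | cons r l ih =>
      intro hl p q
      obtain ⟨hr, hl⟩ := List.nodup_cons.1 hl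
      have ih := ih hl
      -- the loop
      have hloop := (ih r r).tc (by
        intro g w a b b' h h'
        simp only [Sum.elim_inl, Sum.elim_inr] at h h'
        have := via_functional (hf g w) (y := (r, b)) (y' := (r, b')) hr hr h h'
        exact (Prod.mk.inj this).2)
      simp only [Sum.elim_inl, Sum.elim_inr] at hloop
      -- index set: (params ⊕ (x ⊕ y)) ⊕ c ⊕ d
      have h1 := (ih p r).rename (κ := ((ι ⊕ (Fin k ⊕ Fin k)) ⊕ Fin k) ⊕ Fin k)
        (Sum.elim (fun i => .inl (.inl (.inl i)))
          (Sum.elim (fun i => .inl (.inl (.inr (.inl i)))) (fun i => .inl (.inr i))))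
      have h2 := hloop.rename (κ := ((ι ⊕ (Fin k ⊕ Fin k)) ⊕ Fin k) ⊕ Fin k)
        (Sum.elim (fun i => .inl (.inl (.inl i)))
          (Sum.elim (fun i => .inl (.inr i)) (fun i => .inr i)))
      have h3 := (ih r q).rename (κ := ((ι ⊕ (Fin k ⊕ Fin k)) ⊕ Fin k) ⊕ Fin k)
        (Sum.elim (fun i => .inl (.inl (.inl i)))
          (Sum.elim (fun i => .inr i) (fun i => .inl (.inl (.inr (.inr i))))))
      refine ((ih p q).or (h1.and (h2.and h3)).exVec.exVec).congr fun g w => ?_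
      have : {s | s ∈ r :: l} = insert r {s | s ∈ l} := by ext; simp
      rw [this, via_insert]
      simp only [Sum.elim_inl, Sum.elim_inr]
  obtain ⟨l, hl⟩ := Finite.exists_univ_list Q
  have h0 : Defn (Sig := Sig) k (ι ⊕ (Fin k ⊕ Fin k)) (fun g w =>
      p = q ∧ ∀ i : Fin k, w (.inr (.inl i)) = w (.inr (.inr i))) :=
    (Defn.const _).and (Defn.allFinite fun i => Defn.eq _ _)
  refine (h0.or (key l hl.1 p q)).congr fun g w => ?_
  have : {s | s ∈ l} = Set.univ := by ext; simp [hl.2]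
  rw [this, via_univ, Prod.mk.injEq, funext_iff]

end NestedPebblesGraphs

namespace NestedPebblesGraphs
variable {Sig : Type}
open Relation

/-! ### Part 3: from automata to formulas -/

/-- Instructions that leave the pebble stack alone. -/
def GInstr.NS {k : ℕ} {X : Type} : GInstr Sig k X → Prop
  | .dropPeb _ _ => False
  | .retrieve _ => False
  | _ => True

section
variable {k : ℕ} (A : GWA Sig k) (g : LGraph Sig)

/-- Macro steps on top of the fixed stack `π`, with fuel `n`. -/
def MS : ℕ → List (A.X × g.V) → A.Q × (Fin k → g.V) → A.Q × (Fin k → g.V) → Prop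
  | 0, π, x, y => ∃ ins, ins.NS ∧ (x.1, ins, y.1) ∈ A.instr ∧ gInstrStep g ins x.2 π y.2 π
  | n + 1, π, x, y => (∃ ins, ins.NS ∧ (x.1, ins, y.1) ∈ A.instr ∧ gInstrStep g ins x.2 π y.2 π) ∨
      ∃ i z p' q', (∀ w, (z, w) ∉ π) ∧ (x.1, .dropPeb i z, p') ∈ A.instr ∧
        (q', .retrieve z, y.1) ∈ A.instr ∧
        ReflTransGen (MS n ((z, x.2 i) :: π)) (p', x.2) (q', y.2)

variable {A g}

lemma MS_basic {n : ℕ} {π : List (A.X × g.V)} {x y} {ins : GInstr Sig k A.X} (h1 : ins.NS)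
    (h2 : (x.1, ins, y.1) ∈ A.instr) (h3 : gInstrStep g ins x.2 π y.2 π) : MS A g n π x y := by
  cases n with
  | zero => exact ⟨ins, h1, h2, h3⟩
  | succ n => exact .inl ⟨ins, h1, h2, h3⟩

lemma MS_sound : ∀ {n : ℕ} {π : List (A.X × g.V)} {x y}, MS A g n π x y →
    ReflTransGen (GStep A g) (x.1, x.2, π) (y.1, y.2, π) := by
  intro n
  induction n with
  | zero =>
    rintro π x y ⟨ins, _, h2, h3⟩
    exact .single ⟨ins, h2, h3⟩
  | succ n ih =>
    rintro π x y (⟨ins, _, h2, h3⟩ | ⟨i, z, p', q', h1, h2, h3, h4⟩)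
    · exact .single ⟨ins, h2, h3⟩
    · have h5 : ReflTransGen (GStep A g) (p', x.2, (z, x.2 i) :: π) (q', y.2, (z, x.2 i) :: π) := by
        have : ∀ u v, ReflTransGen (MS A g n ((z, x.2 i) :: π)) u v →
            ReflTransGen (GStep A g) (u.1, u.2, (z, x.2 i) :: π) (v.1, v.2, (z, x.2 i) :: π) := by
          intro u v h
          induction h with
          | refl => exact .refl
          | tail _ h ih' => exact ih'.trans (ih h)
        exact this _ _ h4
      refine .head (b := (p', x.2, (z, x.2 i) :: π)) ⟨_, h2, rfl, rfl, h1⟩ (h5.tail ⟨_, h3, rfl, ?_⟩)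
      exact ⟨x.2 i, rfl⟩

lemma det_cases (hA : GDeterministic A) {p q₁ q₂ : A.Q} {χ₁ χ₂ : GInstr Sig k A.X}
    (h1 : (p, χ₁, q₁) ∈ A.instr) (h2 : (p, χ₂, q₂) ∈ A.instr) :
    (χ₁ = χ₂ ∧ q₁ = q₂) ∨ ∃ b τ, χ₁ = .test b τ ∧ χ₂ = .test (!b) τ := by
  by_cases h : (χ₁, q₁) = (χ₂, q₂)
  · left; simpa using h
  · right
    rcases hA _ _ _ _ _ h1 h2 h with ⟨b, τ, h3, h4⟩ | ⟨b, τ, h3, h4⟩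
    · exact ⟨b, τ, h3, h4⟩
    · exact ⟨!b, τ, h4, by simpa using h3⟩

lemma nodup_val {X V : Type} {π : List (X × V)} (h : (π.map Prod.fst).Nodup) {x : X} {v v' : V}
    (h1 : (x, v) ∈ π) (h2 : (x, v') ∈ π) : v = v' := by
  have := List.inj_on_of_nodup_map h h1 h2 rfl
  simpa using this

lemma head_eq {α : Type} {i : Fin k} {a b b' : Fin k → α} (h : ∀ j, j ≠ i → b j = a j)
    (h' : ∀ j, j ≠ i → b' j = a j) (hi : b i = b' i) : b = b' := by
  funext j
  by_cases hj : j = i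
  · rw [hj, hi]
  · rw [h j hj, h' j hj]

/-- Determinism of one step, when pebble names on the stack are distinct. -/
lemma gInstrStep_det (hA : GDeterministic A) {π π₁ π₂ : List (A.X × g.V)}
    (hπ : (π.map Prod.fst).Nodup)
    {p q₁ q₂ : A.Q} {χ₁ χ₂ : GInstr Sig k A.X} {a b₁ b₂ : Fin k → g.V}
    (h1 : (p, χ₁, q₁) ∈ A.instr) (h2 : (p, χ₂, q₂) ∈ A.instr)
    (s1 : gInstrStep g χ₁ a π b₁ π₁) (s2 : gInstrStep g χ₂ a π b₂ π₂) :
    q₁ = q₂ ∧ b₁ = b₂ ∧ π₁ = π₂ := by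
  rcases det_cases hA h1 h2 with ⟨rfl, rfl⟩ | ⟨b, τ, rfl, rfl⟩
  · refine ⟨rfl, ?_⟩
    cases χ₁ with
    | inmove i s =>
      exact ⟨head_eq s1.2.2 s2.2.2 (g.in_unique _ _ _ _ s1.2.1 s2.2.1), s1.1.trans s2.1.symm⟩
    | outmove i s =>
      exact ⟨head_eq s1.2.2 s2.2.2 (g.out_unique _ _ _ _ s1.2.1 s2.2.1), s1.1.trans s2.1.symm⟩
    | dropPeb i x => exact ⟨s1.1.trans s2.1.symm, s1.2.1.trans s2.2.1.symm⟩
    | retrieve x =>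
      obtain ⟨rfl, w, h⟩ := s1
      obtain ⟨rfl, w', h'⟩ := s2
      rw [h] at h'
      simp at h'
      exact ⟨rfl, h'.2⟩
    | jump i x =>
      exact ⟨head_eq s1.2.2 s2.2.2 (nodup_val hπ s1.2.1 s2.2.1), s1.1.trans s2.1.symm⟩
    | test b τ => exact ⟨s1.1.trans s2.1.symm, s1.2.1.trans s2.2.1.symm⟩
  · have e1 := s1.2.2
    have e2 := s2.2.2
    rw [e1] at e2
    cases b <;> simp at e2

lemma rtg_terminal_unique {α : Type*} {r : α → α → Prop} (hr : ∀ x y y', r x y → r x y' → y = y')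
    {x y y' : α} (h : ReflTransGen r x y) (h' : ReflTransGen r x y') (hy : ∀ z, ¬ r y z)
    (hy' : ∀ z, ¬ r y' z) : y = y' := by
  induction h using ReflTransGen.head_induction_on with
  | refl =>
    rcases h'.cases_head with rfl | ⟨t, ht, _⟩
    · rfl
    · exact absurd ht (hy _)
  | head h _ ih =>
    rcases h'.cases_head with rfl | ⟨t, ht, h5⟩
    · exact absurd h (hy' _)
    · exact ih (hr _ _ _ h ht ▸ h5)

lemma MS_retrieve (hA : GDeterministic A) {n : ℕ} {π : List (A.X × g.V)} {x y} {z : A.X} {q : A.Q}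
    (h : (x.1, .retrieve z, q) ∈ A.instr) : ¬ MS A g n π x y := by
  intro hm
  have : ∃ ins q', (x.1, ins, q') ∈ A.instr ∧ ∀ z, ins ≠ .retrieve z := by
    cases n with
    | zero =>
      obtain ⟨ins, h1, h2, _⟩ := hm
      exact ⟨ins, _, h2, by rintro z rfl; exact h1⟩
    | succ n =>
      rcases hm with ⟨ins, h1, h2, _⟩ | ⟨i, z, p', q', h1, h2, h3, h4⟩
      · exact ⟨ins, _, h2, by rintro z rfl; exact h1⟩
      · exact ⟨_, _, h2, by simp⟩
  obtain ⟨ins, q', h2, h3⟩ := this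
  rcases det_cases hA h h2 with ⟨rfl, _⟩ | ⟨b, τ, h4, _⟩
  · exact h3 _ rfl
  · cases h4

lemma MS_functional (hA : GDeterministic A) : ∀ {n : ℕ} {π : List (A.X × g.V)} {x y y'},
    (π.map Prod.fst).Nodup → MS A g n π x y → MS A g n π x y' → y = y' := by
  have basic : ∀ {π : List (A.X × g.V)} {x y y' : A.Q × (Fin k → g.V)}, (π.map Prod.fst).Nodup →
    (∃ ins : GInstr Sig k A.X, ins.NS ∧ (x.1, ins, y.1) ∈ A.instr ∧ gInstrStep g ins x.2 π y.2 π) →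
    (∃ ins : GInstr Sig k A.X, ins.NS ∧ (x.1, ins, y'.1) ∈ A.instr ∧
      gInstrStep g ins x.2 π y'.2 π) → y = y' := by
    rintro π x y y' hπ ⟨ins, h1, h2, h3⟩ ⟨ins', h1', h2', h3'⟩
    have := gInstrStep_det hA hπ h2 h2' h3 h3'
    exact Prod.ext this.1 this.2.1
  have mixed : ∀ {p q q' : A.Q} {ins : GInstr Sig k A.X} {i : Fin k} {z : A.X}, ins.NS →
      (p, ins, q) ∈ A.instr → (p, .dropPeb i z, q') ∈ A.instr → False := by
    intro p q q' ins i z h1 h2 h3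
    rcases det_cases hA h3 h2 with ⟨rfl, _⟩ | ⟨b, τ, h4, _⟩
    · exact h1
    · cases h4
  intro n
  induction n with
  | zero => exact basic
  | succ n ih =>
    rintro π x y y' hπ (h | ⟨i, z, p, q, h1, h2, h3, h4⟩) (h' | ⟨i', z', p', q', h1', h2', h3', h4'⟩)
    · exact basic hπ h h'
    · obtain ⟨ins, a1, a2, a3⟩ := h
      exact (mixed a1 a2 h2').elim
    · obtain ⟨ins, a1, a2, a3⟩ := h'
      exact (mixed a1 a2 h2).elim
    · rcases det_cases hA h2 h2' with ⟨e, rfl⟩ | ⟨b, τ, h4, _⟩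
      · simp only [GInstr.dropPeb.injEq] at e
        obtain ⟨rfl, rfl⟩ := e
        have hn : (((z, x.2 i) :: π).map Prod.fst).Nodup := by
          simp only [List.map_cons, List.nodup_cons, hπ, and_true, List.mem_map, not_exists, not_and]
          rintro ⟨z', w⟩ hm rfl
          exact h1 w hm
        have := rtg_terminal_unique (r := MS A g n ((z, x.2 i) :: π)) (fun x y y' => ih hn) h4 h4'
          (fun t => MS_retrieve (x := (q, y.2)) hA h3)
          (by intro t; exact MS_retrieve (x := (q', y'.2)) hA h3')
        obtain ⟨rfl, e2⟩ := Prod.mk.inj this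
        rcases det_cases hA h3 h3' with ⟨_, e3⟩ | ⟨b, τ, h4, _⟩
        · exact Prod.ext e3 e2
        · cases h4
      · cases h4

/-- Remaining computation, decomposed along the stack. -/
def Rem (A : GWA Sig k) (g : LGraph Sig) (f : A.Q × (Fin k → g.V)) :
    ℕ → List (A.X × g.V) → A.Q × (Fin k → g.V) → Prop
  | n, [], x => ReflTransGen (MS A g n []) x f
  | n, (z, v) :: π, x => ∃ q' b q, ReflTransGen (MS A g n ((z, v) :: π)) x (q', b) ∧
      (q', .retrieve z, q) ∈ A.instr ∧ Rem A g f (n + 1) π (q, b)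

lemma Rem_head {f : A.Q × (Fin k → g.V)} {n : ℕ} {π : List (A.X × g.V)} {x y}
    (h : MS A g n π x y) (h' : Rem A g f n π y) : Rem A g f n π x := by
  cases π with
  | nil => exact ReflTransGen.head h h'
  | cons zv π =>
    obtain ⟨q', b, q, h1, h2, h3⟩ := h'
    exact ⟨q', b, q, .head h h1, h2, h3⟩

lemma Rem_of_run {c : GConf A g} {f : A.Q × (Fin k → g.V)}
    (h : ReflTransGen (GStep A g) c (f.1, f.2, [])) :
    ∀ n, (c.2.2.map Prod.fst).Nodup → n + c.2.2.length = @Fintype.card A.X A.finX →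
      Rem A g f n c.2.2 (c.1, c.2.1) := by
  induction h using ReflTransGen.head_induction_on with
  | refl => intro n _ _; exact ReflTransGen.refl
  | @head c d hcd _ ih =>
    obtain ⟨p, a, π⟩ := c
    obtain ⟨q, b, π'⟩ := d
    obtain ⟨ins, h1, h2⟩ := hcd
    intro n hn hc
    simp only at h1 h2 ih hn hc ⊢
    have hns : ins.NS → π' = π → Rem A g f n π (p, a) := by
      rintro hi rfl
      exact Rem_head (y := (q, b)) (MS_basic (ins := ins) hi h1 h2) (ih n hn hc)
    cases ins with
    | inmove i s => exact hns trivial h2.1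
    | outmove i s => exact hns trivial h2.1
    | jump i s => exact hns trivial h2.1
    | test i s => exact hns trivial h2.2.1
    | retrieve z =>
      obtain ⟨rfl, w, rfl⟩ := h2
      simp only [List.map_cons, List.nodup_cons, List.length_cons] at hn hc
      exact ⟨p, b, q, .refl, h1, ih (n + 1) hn.2 (by omega)⟩
    | dropPeb i z =>
      obtain ⟨rfl, rfl, hz⟩ := h2
      have hn' : (((z, b i) :: π).map Prod.fst).Nodup := by
        simp only [List.map_cons, List.nodup_cons, hn, and_true, List.mem_map, not_exists, not_and]
        rintro ⟨z', w⟩ hm rfl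
        exact hz w hm
      cases n with
      | zero =>
        exfalso
        let := A.finX
        have := List.Nodup.length_le_card hn'
        simp at this hc
        omega
      | succ n =>
        obtain ⟨q', b', q'', h3, h4, h5⟩ := ih n hn' (by simp at hc ⊢; omega)
        exact Rem_head (y := (q'', b')) (.inr ⟨i, z, q, q', hz, h1, h4, h3⟩) h5

lemma accFrom_iff (u : g.V) : AccFrom A g u ↔ ∃ q, q ∈ A.acc ∧ ∃ hs : Fin k → g.V,
    ReflTransGen (MS A g (@Fintype.card A.X A.finX) []) (A.q0, fun _ => u) (q, hs) ∧
    GHaltingConf A g (q, hs, []) := by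
  constructor
  · rintro ⟨q, hs, h1, h2, h3⟩
    exact ⟨q, h1, hs, Rem_of_run (f := (q, hs)) h2 _ (by simp) (by simp), h3⟩
  · rintro ⟨q, h1, hs, h2, h3⟩
    refine ⟨q, hs, h1, ?_, h3⟩
    have : ∀ x y, ReflTransGen (MS A g (@Fintype.card A.X A.finX) []) x y →
        ReflTransGen (GStep A g) (x.1, x.2, []) (y.1, y.2, []) := by
      intro x y h
      induction h with
      | refl => exact .refl
      | tail _ h ih => exact ih.trans (MS_sound h)
    exact this _ _ h2

end

/-- Stack with names `L` and positions given by `w`. -/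
def stk {X V : Type} (L : List X) (w : X → V) : List (X × V) := L.map (fun x => (x, w x))

lemma mem_stk {X V : Type} {L : List X} {w : X → V} {x : X} {v : V} :
    (x, v) ∈ stk L w ↔ x ∈ L ∧ v = w x := by
  simp only [stk, List.mem_map, Prod.mk.injEq]
  constructor
  · rintro ⟨y, h1, rfl, rfl⟩; exact ⟨h1, rfl⟩
  · rintro ⟨h1, rfl⟩; exact ⟨x, h1, rfl, rfl⟩

lemma stk_names {X V : Type} (L : List X) (w : X → V) : (stk L w).map Prod.fst = L := by
  simp [stk, Function.comp_def]

open Classical in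
lemma stk_update {X V : Type} {L : List X} {w : X → V} {z : X} {v : V} (hz : z ∉ L) :
    stk (z :: L) (fun x => if x = z then v else w x) = (z, v) :: stk L w := by
  simp only [stk, List.map_cons, if_true, List.cons.injEq, true_and]
  apply List.map_congr_left
  intro x hx
  rw [if_neg (by rintro rfl; exact hz hx)]

section
variable {k : ℕ} (A : GWA Sig k)

lemma defn_test {X : Type} [Finite X] (L : List X) (τ : GTest Sig k X) :
    Defn (Sig := Sig) k (X ⊕ Fin k)
      (fun g w => gTestHolds g τ (fun i => w (.inr i)) (stk L (fun x => w (.inl x)))) := by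
  cases τ with
  | lab i a => exact Defn.lab a _
  | inedge i a =>
    exact (Defn.edg (Sig := Sig) (k := k) (ι := Option (X ⊕ Fin k)) a none (some (.inr i))).ex
  | outedge i a =>
    exact (Defn.edg (Sig := Sig) (k := k) (ι := Option (X ⊕ Fin k)) a (some (.inr i)) none).ex
  | peb i x =>
    refine ((Defn.const (x ∈ L)).and (Defn.eq (.inr i) (.inl x))).congr fun g w => ?_
    exact mem_stk

lemma defn_instr {X : Type} [Finite X] (L : List X) (ins : GInstr Sig k X) (hn : ins.NS) :
    Defn (Sig := Sig) k (X ⊕ (Fin k ⊕ Fin k))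
      (fun g w => gInstrStep g ins (fun i => w (.inr (.inl i))) (stk L (fun x => w (.inl x)))
        (fun i => w (.inr (.inr i))) (stk L (fun x => w (.inl x)))) := by
  have hrest : ∀ i : Fin k, Defn (Sig := Sig) k (X ⊕ (Fin k ⊕ Fin k))
      (fun g w => ∀ h : Fin k, h ≠ i → w (.inr (.inr h)) = w (.inr (.inl h))) := by
    intro i
    apply Defn.allFinite
    intro h
    refine ((Defn.const (h = i)).or (Defn.eq (.inr (.inr h)) (.inr (.inl h)))).congr fun g w => ?_
    tauto
  have hall : Defn (Sig := Sig) k (X ⊕ (Fin k ⊕ Fin k))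
      (fun g w => ∀ h : Fin k, w (.inr (.inr h)) = w (.inr (.inl h))) :=
    Defn.allFinite fun h => Defn.eq _ _
  cases ins with
  | inmove i a =>
    refine ((Defn.edg a (.inr (.inr i)) (.inr (.inl i))).and (hrest i)).congr fun g w => ?_
    simp [gInstrStep]
  | outmove i a =>
    refine ((Defn.edg a (.inr (.inl i)) (.inr (.inr i))).and (hrest i)).congr fun g w => ?_
    simp [gInstrStep]
  | dropPeb i x => exact hn.elim
  | retrieve x => exact hn.elim
  | jump i x =>
    refine (((Defn.const (x ∈ L)).and (Defn.eq (.inr (.inr i)) (.inl x))).and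
      (hrest i)).congr fun g w => ?_
    simp [gInstrStep, mem_stk]
  | test b τ =>
    have h1 := (defn_test L τ).rename (κ := X ⊕ (Fin k ⊕ Fin k))
      (Sum.elim (fun x => .inl x) (fun i => .inr (.inl i)))
    simp only [Sum.elim_inl, Sum.elim_inr] at h1
    cases b with
    | true =>
      refine (hall.and h1).congr fun g w => ?_
      simp [gInstrStep, funext_iff]
    | false =>
      refine (hall.and h1.not).congr fun g w => ?_
      simp [gInstrStep, funext_iff]

lemma defn_MS (hA : GDeterministic A) (n : ℕ) : ∀ (L : List A.X), L.Nodup → ∀ p q : A.Q,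
    Defn (Sig := Sig) k (A.X ⊕ (Fin k ⊕ Fin k))
      (fun g w => MS A g n (stk L (fun x => w (.inl x))) (p, fun i => w (.inr (.inl i)))
        (q, fun i => w (.inr (.inr i)))) := by
  classical
  have := A.finX
  have := A.finQ
  have : Finite A.instr := A.instrFin.to_subtype
  have basic : ∀ (L : List A.X) (p q : A.Q), Defn (Sig := Sig) k (A.X ⊕ (Fin k ⊕ Fin k))
      (fun g w => ∃ ins : GInstr Sig k A.X, ins.NS ∧ (p, ins, q) ∈ A.instr ∧
        gInstrStep g ins (fun i => w (.inr (.inl i))) (stk L (fun x => w (.inl x)))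
          (fun i => w (.inr (.inr i))) (stk L (fun x => w (.inl x)))) := by
    intro L p q
    have h1 : ∀ t : A.instr, Defn (Sig := Sig) k (A.X ⊕ (Fin k ⊕ Fin k))
      (fun g w => (t.1.2.1.NS ∧ t.1.1 = p ∧ t.1.2.2 = q) ∧
        gInstrStep g t.1.2.1 (fun i => w (.inr (.inl i))) (stk L (fun x => w (.inl x)))
          (fun i => w (.inr (.inr i))) (stk L (fun x => w (.inl x)))) := by
      intro t
      by_cases hn : t.1.2.1.NS
      · exact (Defn.const _).and (defn_instr L _ hn)
      · exact (Defn.const False).congr (by simp [hn])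
    refine (Defn.exFinite h1).congr fun g w => ?_
    constructor
    · rintro ⟨ins, a1, a2, a3⟩
      exact ⟨⟨(p, ins, q), a2⟩, ⟨a1, rfl, rfl⟩, a3⟩
    · rintro ⟨⟨⟨p', ins, q'⟩, a2⟩, ⟨a1, rfl, rfl⟩, a3⟩
      exact ⟨ins, a1, a2, a3⟩
  induction n with
  | zero => exact fun L _ p q => basic L p q
  | succ n ih =>
    intro L hL p q
    have h2 : ∀ t : Fin k × A.X × A.Q × A.Q, Defn (Sig := Sig) k (A.X ⊕ (Fin k ⊕ Fin k))
        (fun g w => (t.2.1 ∉ L ∧ (p, .dropPeb t.1 t.2.1, t.2.2.1) ∈ A.instr ∧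
          (t.2.2.2, .retrieve t.2.1, q) ∈ A.instr) ∧
          ReflTransGen (MS A g n ((t.2.1, w (.inr (.inl t.1))) :: stk L (fun x => w (.inl x))))
            (t.2.2.1, fun i => w (.inr (.inl i))) (t.2.2.2, fun i => w (.inr (.inr i)))) := by
      rintro ⟨i, z, p', q'⟩
      by_cases hz : z ∈ L
      · exact (Defn.const False).congr (by simp [hz])
      refine (Defn.const _).and ?_
      have hzL : (z :: L).Nodup := List.nodup_cons.2 ⟨hz, hL⟩
      have h3 := defn_kleene (ι := A.X) (fun g w => MS A g n (stk (z :: L) w))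
        (fun p q => ih (z :: L) hzL p q)
        (fun g w x y y' => MS_functional hA (by rw [stk_names]; exact hzL)) p' q'
      refine (h3.rename (κ := A.X ⊕ (Fin k ⊕ Fin k)) (Sum.elim
        (fun x => if x = z then .inr (.inl i) else .inl x) Sum.inr)).congr fun g w => ?_
      simp only [Sum.elim_inl, Sum.elim_inr]
      rw [← stk_update hz]
      simp only [apply_ite w]
    refine ((basic L p q).or (Defn.exFinite h2)).congr fun g w => ?_
    simp only [MS]
    apply or_congr Iff.rfl
    constructor
    · rintro ⟨i, z, p', q', h3, h4, h5, h6⟩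
      exact ⟨(i, z, p', q'), ⟨fun h => h3 _ (mem_stk.2 ⟨h, rfl⟩), h4, h5⟩, h6⟩
    · rintro ⟨⟨i, z, p', q'⟩, ⟨h3, h4, h5⟩, h6⟩
      exact ⟨i, z, p', q', fun v hv => h3 (mem_stk.1 hv).1, h4, h5, h6⟩

lemma defn_halting (q : A.Q) : Defn (Sig := Sig) k (A.X ⊕ Fin k)
    (fun g w => GHaltingConf A g (q, fun i => w (.inr i), [])) := by
  have : Finite A.instr := A.instrFin.to_subtype
  have := A.finX
  have hns : ∀ ins : GInstr Sig k A.X, Defn (Sig := Sig) k (A.X ⊕ Fin k)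
      (fun g w => ∃ b π', gInstrStep g ins (fun i => w (.inr i)) [] b π') := by
    intro ins
    cases ins with
    | inmove i a =>
      refine (Defn.edg (Sig := Sig) (k := k) (ι := Option (A.X ⊕ Fin k)) a none
        (some (.inr i))).ex.congr fun g w => ?_
      constructor
      · rintro ⟨b, π', h1, h2, h3⟩; exact ⟨_, h2⟩
      · rintro ⟨u, h2⟩
        exact ⟨Function.update _ i u, [], rfl, by simpa using h2,
          fun h hh => Function.update_of_ne hh _ _⟩
    | outmove i a =>
      refine (Defn.edg (Sig := Sig) (k := k) (ι := Option (A.X ⊕ Fin k)) a (some (.inr i))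
        none).ex.congr fun g w => ?_
      constructor
      · rintro ⟨b, π', h1, h2, h3⟩; exact ⟨_, h2⟩
      · rintro ⟨u, h2⟩
        exact ⟨Function.update _ i u, [], rfl, by simpa using h2,
          fun h hh => Function.update_of_ne hh _ _⟩
    | dropPeb i x =>
      refine (Defn.const True).congr fun g w => iff_true_intro ?_
      exact ⟨_, _, rfl, rfl, by simp⟩
    | retrieve x =>
      refine (Defn.const False).congr fun g w => iff_of_false ?_ id
      rintro ⟨b, π', _, _, h⟩; simp at h
    | jump i x =>
      refine (Defn.const False).congr fun g w => iff_of_false ?_ id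
      rintro ⟨b, π', _, h, _⟩; simp at h
    | test b τ =>
      have h1 := defn_test (Sig := Sig) ([] : List A.X) τ
      simp only [stk, List.map_nil] at h1
      cases b with
      | true =>
        refine h1.congr fun g w => ?_
        simp [gInstrStep]
      | false =>
        refine h1.not.congr fun g w => ?_
        simp [gInstrStep]
  refine (Defn.exFinite (T := A.instr) (fun t => (Defn.const (t.1.1 = q)).and
    (hns t.1.2.1))).not.congr fun g w => ?_
  rw [GHaltingConf]
  rw [← not_exists]
  apply not_congr
  constructor
  · rintro ⟨⟨q', b, π'⟩, ins, h1, h2⟩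
    exact ⟨⟨(q, ins, q'), h1⟩, rfl, b, π', h2⟩
  · rintro ⟨⟨⟨p, ins, q'⟩, h1⟩, rfl, b, π', h2⟩
    exact ⟨⟨q', b, π'⟩, ins, h1, h2⟩

lemma defn_acc (hA : GDeterministic A) : Defn (Sig := Sig) k (A.X ⊕ Unit)
    (fun g w => AccFrom A g (w (.inr ()))) := by
  have := A.finX
  have := A.finQ
  have h1 : ∀ q : A.Q, Defn (Sig := Sig) k ((A.X ⊕ Unit) ⊕ Fin k)
      (fun g w => q ∈ A.acc ∧ ReflTransGen (MS A g (@Fintype.card A.X A.finX) [])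
        (A.q0, fun _ => w (.inl (.inr ()))) (q, fun i => w (.inr i)) ∧
        GHaltingConf A g (q, fun i => w (.inr i), [])) := by
    intro q
    have h3 := defn_kleene (ι := A.X)
      (fun g w => MS A g (@Fintype.card A.X A.finX) (stk ([] : List A.X) w))
      (fun p q => defn_MS A hA _ [] List.nodup_nil p q)
      (fun g w x y y' => MS_functional hA (by rw [stk_names]; exact List.nodup_nil)) A.q0 q
    refine (Defn.const _).and (((h3.rename (κ := (A.X ⊕ Unit) ⊕ Fin k)
      (Sum.elim (fun x => .inl (.inl x)) (Sum.elim (fun _ => .inl (.inr ())) .inr)))).and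
      ((defn_halting A q).rename (κ := (A.X ⊕ Unit) ⊕ Fin k)
        (Sum.elim (fun x => Sum.inl (Sum.inl x)) Sum.inr)))
  refine (Defn.exFinite (fun q => (h1 q).exVec)).congr fun g w => ?_
  rw [accFrom_iff]
  simp only [Sum.elim_inl, Sum.elim_inr, exists_and_left]

theorem DPTWAgJ_subset (F : Set (LGraph Sig)) (k : ℕ) : DPTWAgJ Sig F k ⊆ FODTCg Sig F k := by
  rintro L ⟨A, hA, _, rfl⟩
  obtain ⟨φ, h1, h2, h3⟩ := defn_acc A hA (fun _ => 0)
  obtain ⟨ψ, h4, h5, h6, h7⟩ := exists_closure φ h1 h2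
  refine ⟨ψ, h4, h5, h6, ?_⟩
  ext g
  simp only [Set.mem_ofPred_eq, h7, h3]
  apply and_congr_right
  intro _
  exact ⟨fun h ν => h _, fun h u => h (fun _ => u)⟩

end
end NestedPebblesGraphs

open Relation

namespace NestedPebblesGraphs
section Machines
variable {Sig : Type} {k : ℕ}

/-- Primitive actions of abstract machines with an anonymous pebble stack. -/
inductive Prim (Sig : Type) (k : ℕ) : Type
  | inm (i : Fin k) (a : Sig)
  | outm (i : Fin k) (a : Sig)
  | push (i : Fin k)
  | pop
  | jmp (i : Fin k) (j : ℕ)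

inductive Node (Sig : Type) (k : ℕ) (T : Type) : Type
  | act (ι : Prim Sig k) (t : T)
  | tst (τ : GTest Sig k ℕ) (f : Bool → T)
  | nop (t : T)

def Node.map {T T' : Type} (r : T → T') : Node Sig k T → Node Sig k T'
  | .act ι t => .act ι (r t)
  | .tst τ f => .tst τ (fun b => r (f b))
  | .nop t => .nop (r t)

/-- Abstract machines with exits in `E`. -/
structure Mach (Sig : Type) (k : ℕ) (E : Type) : Type 1 where
  Q : Type
  fin : Finite Q
  start : Q
  δ : Q → Node Sig k (Q ⊕ E)

abbrev St (k : ℕ) (g : LGraph Sig) : Type := (Fin k → g.V) × List g.V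

def pstep (N : ℕ) (g : LGraph Sig) : Prim Sig k → St k g → St k g → Prop
  | .inm i a, s, s' => s'.2 = s.2 ∧ g.edge a (s'.1 i) (s.1 i) ∧ ∀ h, h ≠ i → s'.1 h = s.1 h
  | .outm i a, s, s' => s'.2 = s.2 ∧ g.edge a (s.1 i) (s'.1 i) ∧ ∀ h, h ≠ i → s'.1 h = s.1 h
  | .push i, s, s' => s'.1 = s.1 ∧ s'.2 = s.1 i :: s.2 ∧ s.2.length < N
  | .pop, s, s' => s'.1 = s.1 ∧ ∃ w, s.2 = w :: s'.2
  | .jmp i j, s, s' => s'.2 = s.2 ∧ s.2[j]? = some (s'.1 i) ∧ ∀ h, h ≠ i → s'.1 h = s.1 h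

def tholds (g : LGraph Sig) : GTest Sig k ℕ → St k g → Prop
  | .lab i a, s => g.nlab (s.1 i) = a
  | .inedge i a, s => ∃ u, g.edge a u (s.1 i)
  | .outedge i a, s => ∃ v, g.edge a (s.1 i) v
  | .peb i j, s => s.2[j]? = some (s.1 i)

def nstep (N : ℕ) (g : LGraph Sig) {T : Type} : Node Sig k T → St k g → T × St k g → Prop
  | .act ι t, s, c => c.1 = t ∧ pstep N g ι s c.2
  | .tst τ f, s, c => c.2 = s ∧ ∃ b, (tholds g τ s ↔ b = true) ∧ c.1 = f b
  | .nop t, s, c => c = (t, s)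

variable {E A : Type}

def mstep (M : Mach Sig k E) (N : ℕ) (g : LGraph Sig) (c c' : (M.Q ⊕ E) × St k g) : Prop :=
  ∃ q, c.1 = .inl q ∧ nstep N g (M.δ q) c.2 c'

def den (M : Mach Sig k E) (N : ℕ) (g : LGraph Sig) (s : St k g) (e : E) (s' : St k g) : Prop :=
  ReflTransGen (mstep M N g) (.inl M.start, s) (.inr e, s')

variable {N : ℕ} {g : LGraph Sig}

lemma heads_ext {V : Type} {f f' f0 : Fin k → V} {i : Fin k} (h : f i = f' i)
    (h1 : ∀ j, j ≠ i → f j = f0 j) (h2 : ∀ j, j ≠ i → f' j = f0 j) : f = f' := by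
  funext j
  by_cases hj : j = i
  · rw [hj, h]
  · rw [h1 j hj, h2 j hj]

lemma pstep_det {ι : Prim Sig k} {s t t' : St k g} (h : pstep N g ι s t) (h' : pstep N g ι s t') :
    t = t' := by
  cases ι with
  | inm i a =>
    exact Prod.ext (heads_ext (g.in_unique _ _ _ _ h.2.1 h'.2.1) h.2.2 h'.2.2) (h.1.trans h'.1.symm)
  | outm i a =>
    exact Prod.ext (heads_ext (g.out_unique _ _ _ _ h.2.1 h'.2.1) h.2.2 h'.2.2)
      (h.1.trans h'.1.symm)
  | push i => exact Prod.ext (h.1.trans h'.1.symm) (h.2.1.trans h'.2.1.symm)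
  | pop =>
    obtain ⟨h1, w, h2⟩ := h
    obtain ⟨h1', w', h2'⟩ := h'
    refine Prod.ext (h1.trans h1'.symm) ?_
    rw [h2] at h2'
    exact (List.cons.inj h2').2
  | jmp i j =>
    refine Prod.ext (heads_ext ?_ h.2.2 h'.2.2) (h.1.trans h'.1.symm)
    have := h.2.1.symm.trans h'.2.1
    exact Option.some.inj this

lemma nstep_det {T : Type} {n : Node Sig k T} {s : St k g} {c c' : T × St k g}
    (h : nstep N g n s c) (h' : nstep N g n s c') : c = c' := by
  cases n with
  | act ι t => exact Prod.ext (h.1.trans h'.1.symm) (pstep_det h.2 h'.2)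
  | tst τ f =>
    obtain ⟨h1, b, h2, h3⟩ := h
    obtain ⟨h1', b', h2', h3'⟩ := h'
    have : b = b' := by
      rw [h2] at h2'
      cases b <;> cases b' <;> simp_all
    subst this
    exact Prod.ext (h3.trans h3'.symm) (h1.trans h1'.symm)
  | nop t => exact Eq.trans h (Eq.symm h')

lemma den_det {M : Mach Sig k E} {s t t' : St k g} {e e' : E} (h : den M N g s e t)
    (h' : den M N g s e' t') : e = e' ∧ t = t' := by
  have := rtg_terminal_unique (r := mstep M N g) (fun x y y' h1 h2 => by
    obtain ⟨q, h3, h4⟩ := h1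
    obtain ⟨q', h3', h4'⟩ := h2
    rw [h3] at h3'
    cases h3'
    exact nstep_det h4 h4') h h' (by rintro z ⟨q, h, _⟩; cases h) (by rintro z ⟨q, h, _⟩; cases h)
  simpa using this

/-- Single-node machine. -/
def Mach.one (n : Node Sig k E) : Mach Sig k E :=
  ⟨Unit, inferInstance, (), fun _ => n.map .inr⟩

lemma nstep_map {T T' : Type} (r : T → T') (n : Node Sig k T) (s : St k g) (c' : T' × St k g) :
    nstep N g (n.map r) s c' ↔ ∃ t, nstep N g n s (t, c'.2) ∧ r t = c'.1 := by
  rcases c' with ⟨c, t⟩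
  cases n with
  | act ι t => simp only [Node.map, nstep]; grind
  | tst τ f =>
    constructor
    · rintro ⟨h, b, h1, h2⟩
      exact ⟨f b, ⟨h, b, h1, rfl⟩, h2.symm⟩
    · rintro ⟨u, ⟨h, b, h1, rfl⟩, h2⟩
      exact ⟨h, b, h1, h2.symm⟩
  | nop t => simp only [Node.map, nstep, Prod.mk.injEq]; grind

lemma den_one {n : Node Sig k E} {s s' : St k g} {e : E} :
    den (Mach.one n) N g s e s' ↔ nstep N g n s (e, s') := by
  constructor
  · intro h
    rcases ReflTransGen.cases_head h with h | ⟨⟨x, t⟩, ⟨q, h1, h2⟩, h3⟩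
    · simp at h
    · obtain ⟨t', h2, h4⟩ := (nstep_map _ _ _ _).1 h2
      simp only at h4
      subst h4
      rcases ReflTransGen.cases_head h3 with h | ⟨_, ⟨q, h1, _⟩, _⟩
      · cases h
        exact h2
      · cases h1
  · intro h
    exact ReflTransGen.single ⟨(), rfl, (nstep_map _ _ _ _).2 ⟨e, h, rfl⟩⟩

def iroute (f : A → Mach Sig k (A ⊕ E)) (a : A) : (f a).Q ⊕ (A ⊕ E) → (Σ a, (f a).Q) ⊕ E
  | .inl q => .inl ⟨a, q⟩
  | .inr (.inl a') => .inl ⟨a', (f a').start⟩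
  | .inr (.inr e) => .inr e

/-- Iteration with finite control state. -/
def Mach.iter [Finite A] (f : A → Mach Sig k (A ⊕ E)) (a : A) : Mach Sig k E :=
  have := fun a => (f a).fin
  ⟨Σ a, (f a).Q, inferInstance, ⟨a, (f a).start⟩, fun x => ((f x.1).δ x.2).map (iroute f x.1)⟩

lemma iter_lifts [Finite A] (f : A → Mach Sig k (A ⊕ E)) (a b : A)
    {x y : ((f a).Q ⊕ (A ⊕ E)) × St k g} (h : ReflTransGen (mstep (f a) N g) x y) :
    ReflTransGen (mstep (Mach.iter f b) N g)
        (iroute f a x.1, x.2) (iroute f a y.1, y.2) := by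
  refine ReflTransGen.lift (r := mstep (f a) N g) (p := mstep (Mach.iter f b) N g)
    (fun x : ((f a).Q ⊕ (A ⊕ E)) × St k g => (iroute f a x.1, x.2)) ?_ _ _ h
  rintro ⟨x, s⟩ ⟨y, t⟩ ⟨q, h1, h2⟩
  simp only at h1
  subst h1
  exact ⟨⟨a, q⟩, rfl, (nstep_map _ _ _ _).2 ⟨y, h2, rfl⟩⟩

lemma den_iter_chain [Finite A] (f : A → Mach Sig k (A ⊕ E)) (a : A) {s s' : St k g} {e : E}
    (h : den (Mach.iter f a) N g s e s') :
    ∃ x : A × St k g, ReflTransGen (fun x y => den (f x.1) N g x.2 (.inl y.1) y.2) (a, s) x ∧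
      den (f x.1) N g x.2 (.inr e) s' := by
  have key : ∀ c : ((Mach.iter f a).Q ⊕ E) × St k g,
      ReflTransGen (mstep (Mach.iter f a) N g) c (.inr e, s') →
      ∀ a q, c.1 = .inl ⟨a, q⟩ →
        ReflTransGen (mstep (f a) N g) (.inl q, c.2) (.inr (.inr e), s') ∨
        ∃ a' t, ReflTransGen (mstep (f a) N g) (.inl q, c.2) (.inr (.inl a'), t) ∧
          ∃ x : A × St k g,
            ReflTransGen (fun x y => den (f x.1) N g x.2 (.inl y.1) y.2) (a', t) x ∧
            den (f x.1) N g x.2 (.inr e) s' := by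
    intro c h
    induction h using ReflTransGen.head_induction_on with
    | refl => intro a q h; cases h
    | @head c c' h1 h2 ih =>
      rintro a q hc
      obtain ⟨q', h3, h4⟩ := h1
      rw [hc] at h3
      cases h3
      obtain ⟨t, h5, h6⟩ := (nstep_map _ _ _ _).1 h4
      have hst : mstep (f a) N g (.inl q, c.2) (t, c'.2) := ⟨q, rfl, h5⟩
      rcases t with q1 | a1 | e1
      · rcases ih a q1 h6.symm with h7 | ⟨a', t, h7, h8⟩
        · exact .inl (.head hst h7)
        · exact .inr ⟨a', t, .head hst h7, h8⟩
      · refine .inr ⟨a1, c'.2, .single hst, ?_⟩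
        rcases ih a1 _ h6.symm with h7 | ⟨a', t, h7, x, h8, h9⟩
        · exact ⟨_, .refl, h7⟩
        · exact ⟨x, .head (b := (a', t)) h7 h8, h9⟩
      · left
        have : c' = (.inr e1, c'.2) := Prod.ext h6.symm rfl
        rw [this] at h2
        rcases ReflTransGen.cases_head h2 with h7 | ⟨_, ⟨_, h7, _⟩, _⟩
        · simp only [Prod.mk.injEq, Sum.inr.injEq] at h7
          obtain ⟨rfl, h7⟩ := h7
          rw [← h7]
          exact .single hst
        · cases h7
  rcases key _ h a (f a).start rfl with h1 | ⟨a', t, h1, x, h2, h3⟩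
  · exact ⟨_, .refl, h1⟩
  · exact ⟨x, .head (b := (a', t)) h1 h2, h3⟩

lemma den_iter_of [Finite A] (f : A → Mach Sig k (A ⊕ E)) (a : A) {s s' : St k g} {e : E}
    (h : den (f a) N g s (.inr e) s' ∨
      ∃ a' t, den (f a) N g s (.inl a') t ∧ den (Mach.iter f a') N g t e s') :
    den (Mach.iter f a) N g s e s' := by
  rcases h with (h | ⟨a', t, h1, h2⟩)
  · exact iter_lifts f a a h
  · exact ReflTransGen.trans (iter_lifts f a a h1) h2

/-- Change exits. -/
def Mach.map (r : A → E) (p : Mach Sig k A) : Mach Sig k E :=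
  ⟨p.Q, p.fin, p.start, fun q => (p.δ q).map (Sum.map id r)⟩

lemma den_map_of (r : A → E) (p : Mach Sig k A) {s s' : St k g} {a : A}
    (h : den p N g s a s') : den (p.map r) N g s (r a) s' := by
  refine ReflTransGen.lift (r := mstep p N g) (p := mstep (p.map r) N g)
    (fun x : (p.Q ⊕ A) × St k g => (Sum.map id r x.1, x.2)) ?_ _ _ h
  rintro ⟨x, s⟩ ⟨y, t⟩ ⟨q, h1, h2⟩
  simp only at h1
  subst h1
  exact ⟨q, rfl, (nstep_map _ _ _ _).2 ⟨y, h2, rfl⟩⟩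

lemma den_map (r : A → E) (p : Mach Sig k A) {s s' : St k g} {e : E} :
    den (p.map r) N g s e s' ↔ ∃ a, den p N g s a s' ∧ r a = e := by
  constructor
  · intro h
    have key : ∀ c : (p.Q ⊕ E) × St k g, ReflTransGen (mstep (p.map r) N g) c (.inr e, s') →
        ∀ q, c.1 = .inl q → ∃ a, ReflTransGen (mstep p N g) (.inl q, c.2) (.inr a, s') ∧ r a = e := by
      intro c h
      induction h using ReflTransGen.head_induction_on with
      | refl => intro q h; cases h
      | @head c c' h1 h2 ih =>
        intro q hc
        obtain ⟨q', h3, h4⟩ := h1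
        rw [hc] at h3
        cases h3
        obtain ⟨t, h5, h6⟩ := (nstep_map _ _ _ _).1 h4
        have hst : mstep p N g (.inl q, c.2) (t, c'.2) := ⟨q, rfl, h5⟩
        rcases t with q1 | a1
        · obtain ⟨a, h7, h8⟩ := ih q1 h6.symm
          exact ⟨a, .head hst h7, h8⟩
        · have : c' = (.inr (r a1), c'.2) := Prod.ext h6.symm rfl
          rw [this] at h2
          rcases ReflTransGen.cases_head h2 with h7 | ⟨_, ⟨_, h7, _⟩, _⟩
          · obtain ⟨h8, h7⟩ := Prod.mk.inj h7
            refine ⟨a1, ?_, Sum.inr.inj h8⟩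
            rw [← h7]
            exact .single hst
          · cases h7
    exact key _ h _ rfl
  · rintro ⟨a, h, rfl⟩
    exact den_map_of r p h

/-- Sequential composition. -/
def Mach.bind [Finite A] (p : Mach Sig k A) (f : A → Mach Sig k E) : Mach Sig k E :=
  Mach.iter (A := Option A) (fun o => match o with
    | none => p.map (fun a => .inl (some a))
    | some a => (f a).map .inr) none

lemma den_bind [Finite A] (p : Mach Sig k A) (f : A → Mach Sig k E) {s s' : St k g} {e : E} :
    den (p.bind f) N g s e s' ↔ ∃ a t, den p N g s a t ∧ den (f a) N g t e s' := by
  constructor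
  · intro h
    obtain ⟨⟨o, x⟩, h1, h2⟩ := den_iter_chain _ _ h
    rcases ReflTransGen.cases_head h1 with h3 | ⟨⟨o', t⟩, h3, h4⟩
    · obtain ⟨rfl, rfl⟩ := Prod.mk.inj h3
      obtain ⟨a, _, h⟩ := (den_map _ _).1 h2
      cases h
    · obtain ⟨a, h5, h6⟩ := (den_map _ _).1 h3
      cases h6
      rcases ReflTransGen.cases_head h4 with h3 | ⟨⟨o', t⟩, h3, h4⟩
      · obtain ⟨rfl, rfl⟩ := Prod.mk.inj h3
        obtain ⟨e', h7, h8⟩ := (den_map _ _).1 h2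
        cases h8
        exact ⟨a, _, h5, h7⟩
      · obtain ⟨_, _, h8⟩ := (den_map _ _).1 h3
        cases h8
  · rintro ⟨a, t, h1, h2⟩
    exact den_iter_of _ _ (.inr ⟨some a, t, den_map_of _ _ h1, den_iter_of _ _ (.inl (den_map_of _ _ h2))⟩)

lemma den_bind_of [Finite A] {p : Mach Sig k A} {f : A → Mach Sig k E} {s t s' : St k g} {a : A}
    {e : E} (h : den p N g s a t) :
    den (p.bind f) N g s e s' ↔ den (f a) N g t e s' := by
  rw [den_bind]
  constructor
  · rintro ⟨a', t', h1, h2⟩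
    obtain ⟨rfl, rfl⟩ := den_det h h1
    exact h2
  · intro h2
    exact ⟨a, t, h, h2⟩

def Mach.ret (e : E) : Mach Sig k E := .one (.nop e)
def Mach.act (ι : Prim Sig k) : Mach Sig k Unit := .one (.act ι ())
def Mach.tst (τ : GTest Sig k ℕ) : Mach Sig k Bool := .one (.tst τ id)

lemma den_ret {s s' : St k g} {e e' : E} : den (Mach.ret e) N g s e' s' ↔ e' = e ∧ s' = s := by
  simp [Mach.ret, den_one, nstep]

lemma den_act {ι : Prim Sig k} {s s' : St k g} {u : Unit} :
    den (Mach.act ι) N g s u s' ↔ pstep N g ι s s' := by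
  simp [Mach.act, den_one, nstep]

lemma den_tst {τ : GTest Sig k ℕ} {s s' : St k g} {b : Bool} :
    den (Mach.tst τ) N g s b s' ↔ s' = s ∧ (tholds g τ s ↔ b = true) := by
  simp [Mach.tst, den_one, nstep]

/-- Push all heads; head `i` ends up at index `i`. -/
def pushL : List (Fin k) → Mach Sig k Unit
  | [] => .ret ()
  | i :: l => (pushL l).bind fun _ => .act (.push i)

lemma den_pushL (l : List (Fin k)) (s : St k g) (h : s.2.length + l.length ≤ N) :
    den (pushL l) N g s () (s.1, l.map s.1 ++ s.2) := by
  induction l with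
  | nil => exact den_ret.2 ⟨rfl, rfl⟩
  | cons i l ih =>
    simp only [List.length_cons] at h
    rw [pushL, den_bind_of (ih (by lia)), den_act]
    refine ⟨rfl, rfl, ?_⟩
    simp
    lia

def popN : ℕ → Mach Sig k Unit
  | 0 => .ret ()
  | n + 1 => (Mach.act .pop).bind fun _ => popN n

lemma den_popN (hs : Fin k → g.V) (l π : List g.V) {n : ℕ} (h : l.length = n) :
    den (popN n) N g (hs, l ++ π) () (hs, π) := by
  induction l generalizing n with
  | nil =>
    simp only [List.length_nil] at h
    subst h
    exact den_ret.2 ⟨rfl, rfl⟩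
  | cons v l ih =>
    subst h
    have : den (Mach.act .pop) N g (hs, v :: l ++ π) () (hs, l ++ π) :=
      den_act.2 ⟨rfl, v, rfl⟩
    rw [List.length_cons, popN, den_bind_of this]
    exact ih rfl

def jumpL (f : Fin k → ℕ) : List (Fin k) → Mach Sig k Unit
  | [] => .ret ()
  | i :: l => (Mach.act (.jmp i (f i))).bind fun _ => jumpL f l

lemma den_jumpL (f : Fin k → ℕ) (w : Fin k → g.V) (π : List g.V) (hf : ∀ i, π[f i]? = some (w i))
    (l : List (Fin k)) (hs : Fin k → g.V) :
    den (jumpL f l) N g (hs, π) () (fun i => if i ∈ l then w i else hs i, π) := by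
  induction l generalizing hs with
  | nil => exact den_ret.2 ⟨rfl, by simp⟩
  | cons i l ih =>
    have : den (Mach.act (.jmp i (f i))) N g (hs, π) () (Function.update hs i (w i), π) := by
      refine den_act.2 ⟨rfl, by simpa using hf i, ?_⟩
      intro h hh
      simp [hh]
    rw [jumpL, den_bind_of this]
    convert ih (Function.update hs i (w i)) using 2
    funext j
    by_cases hj : j ∈ l
    · simp [hj]
    · by_cases hji : j = i
      · subst hji; simp
      · simp [hj, hji]

def pushAll : Mach Sig k Unit := pushL (List.finRange k)
def jumpAll (f : Fin k → ℕ) : Mach Sig k Unit := jumpL f (List.finRange k)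

lemma den_pushAll (hs : Fin k → g.V) (π : List g.V) (h : π.length + k ≤ N) :
    den pushAll N g (hs, π) () (hs, List.ofFn hs ++ π) := by
  have := den_pushL (List.finRange k) (hs, π) (N := N) (by simpa using h)
  rwa [← List.ofFn_eq_map] at this

lemma den_jumpAll (f : Fin k → ℕ) (w hs : Fin k → g.V) (π : List g.V)
    (hf : ∀ i, π[f i]? = some (w i)) : den (jumpAll f) N g (hs, π) () (w, π) := by
  have := den_jumpL (N := N) f w π hf (List.finRange k) hs
  simp only [List.mem_finRange, if_true] at this
  exact this

end Machines
end NestedPebblesGraphs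

open Relation

namespace NestedPebblesGraphs
section Compile
variable {Sig : Type} {k : ℕ} {N : ℕ} {g : LGraph Sig}

def nmOf (N h j : ℕ) : Fin (N + 1) := Fin.ofNat (N + 1) (if j < h then h - 1 - j else N)

def tmap (N h : ℕ) : GTest Sig k ℕ → GTest Sig k (Fin (N + 1))
  | .lab i a => .lab i a
  | .inedge i a => .inedge i a
  | .outedge i a => .outedge i a
  | .peb i j => .peb i (nmOf N h j)

/-- Instructions generated by a machine node at stack height `h`. -/
def comp (hk : 0 < k) (N : ℕ) {T : Type} (h : ℕ) :
    Node Sig k T → List (GInstr Sig k (Fin (N + 1)) × (T × Fin (N + 1)))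
  | .act (.inm i a) t => [(.inmove i a, t, Fin.ofNat _ h)]
  | .act (.outm i a) t => [(.outmove i a, t, Fin.ofNat _ h)]
  | .act (.push i) t => if h < N then [(.dropPeb i (Fin.ofNat _ h), t, Fin.ofNat _ (h + 1))] else []
  | .act .pop t => if 0 < h then [(.retrieve (Fin.ofNat _ (h - 1)), t, Fin.ofNat _ (h - 1))] else []
  | .act (.jmp i j) t => if j < h then [(.jump i (nmOf N h j), t, Fin.ofNat _ h)] else []
  | .tst τ f => [(.test true (tmap N h τ), f true, Fin.ofNat _ h),
      (.test false (tmap N h τ), f false, Fin.ofNat _ h)]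
  | .nop t => [(.test true (.peb ⟨0, hk⟩ (nmOf N h 0)), t, Fin.ofNat _ h),
      (.test false (.peb ⟨0, hk⟩ (nmOf N h 0)), t, Fin.ofNat _ h)]

lemma comp_det (hk : 0 < k) {T : Type} (h : ℕ) (n : Node Sig k T) {x y}
    (hx : x ∈ comp hk N h n) (hy : y ∈ comp hk N h n) (hne : x ≠ y) :
    gNegOf x.1 y.1 ∨ gNegOf y.1 x.1 := by
  rcases n with ⟨ι, t⟩ | ⟨τ, f⟩ | t
  · exfalso
    cases ι <;> simp only [comp] at hx hy <;> grind
  · simp only [comp, List.mem_cons, List.not_mem_nil, or_false] at hx hy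
    rcases hx with rfl | rfl <;> rcases hy with rfl | rfl
    · exact (hne rfl).elim
    · exact .inl ⟨_, _, rfl, rfl⟩
    · exact .inl ⟨_, _, rfl, rfl⟩
    · exact (hne rfl).elim
  · simp only [comp, List.mem_cons, List.not_mem_nil, or_false] at hx hy
    rcases hx with rfl | rfl <;> rcases hy with rfl | rfl
    · exact (hne rfl).elim
    · exact .inl ⟨_, _, rfl, rfl⟩
    · exact .inl ⟨_, _, rfl, rfl⟩
    · exact (hne rfl).elim

def enc (N : ℕ) {V : Type} : List V → List (Fin (N + 1) × V)
  | [] => []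
  | v :: π => (Fin.ofNat _ π.length, v) :: enc N π

lemma ofNat_inj {m n : ℕ} (hm : m ≤ N) (hn : n ≤ N) (h : Fin.ofNat (N + 1) m = Fin.ofNat (N + 1) n) :
    m = n := by
  have := congrArg Fin.val h
  simp only [Fin.ofNat] at this
  rwa [Nat.mod_eq_of_lt (by lia), Nat.mod_eq_of_lt (by lia)] at this

lemma mem_enc {V : Type} {π : List V} (hπ : π.length ≤ N) {m : ℕ} (hm : m ≤ N) (v : V) :
    (Fin.ofNat (N + 1) m, v) ∈ enc N π ↔ π.reverse[m]? = some v := by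
  induction π with
  | nil => simp [enc]
  | cons u π ih =>
    simp only [List.length_cons] at hπ
    rw [enc, List.mem_cons, ih (by lia), List.reverse_cons, List.getElem?_append, Prod.mk.injEq]
    have h1 : Fin.ofNat (N + 1) m = Fin.ofNat (N + 1) π.length ↔ m = π.length :=
      ⟨ofNat_inj hm (by lia), fun h => by rw [h]⟩
    rw [h1]
    simp only [List.length_reverse]
    split
    · have : m ≠ π.length := by lia
      simp [this]
    · have h2 : π.reverse[m]? = none := by simp; lia
      rw [h2]
      by_cases h3 : m = π.length
      · subst h3; simp [eq_comm]
      · have : m - π.length ≠ 0 := by lia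
        obtain ⟨c, hc⟩ := Nat.exists_eq_succ_of_ne_zero this
        simp [hc, h3]

lemma mem_enc_nm {V : Type} {π : List V} (hπ : π.length ≤ N) (j : ℕ) (v : V) :
    (nmOf N π.length j, v) ∈ enc N π ↔ π[j]? = some v := by
  rw [nmOf, mem_enc hπ (by split <;> lia)]
  split
  · rename_i h
    rw [List.getElem?_reverse (by lia)]
    congr! 2
    lia
  · have h1 : π.reverse[N]? = none := by simp; lia
    have h2 : π[j]? = none := by simp; lia
    rw [h1, h2]

lemma tmap_holds {π : List g.V} (hπ : π.length ≤ N) (τ : GTest Sig k ℕ) (hs : Fin k → g.V) :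
    gTestHolds g (tmap N π.length τ) hs (enc N π) ↔ tholds g τ (hs, π) := by
  cases τ with
  | peb i j => exact mem_enc_nm hπ j (hs i)
  | _ => rfl

lemma comp_step (hk : 0 < k) {T : Type} {π : List g.V} (hπ : π.length ≤ N) (n : Node Sig k T)
    (hs hs' : Fin k → g.V) (t : T) (h' : Fin (N + 1)) (P' : List (Fin (N + 1) × g.V)) :
    (∃ ins, (ins, t, h') ∈ comp hk N π.length n ∧ gInstrStep g ins hs (enc N π) hs' P') ↔
    ∃ π' : List g.V, π'.length ≤ N ∧ h' = Fin.ofNat _ π'.length ∧ P' = enc N π' ∧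
      nstep N g n (hs, π) (t, hs', π') := by
  rcases n with ⟨ι, t0⟩ | ⟨τ, f⟩ | t0
  · cases ι with
    | inm i a =>
      simp only [comp, List.mem_singleton, nstep, pstep, Prod.mk.injEq]
      constructor
      · rintro ⟨ins, ⟨rfl, rfl, rfl⟩, h1, h2⟩
        exact ⟨π, hπ, rfl, h1, rfl, rfl, h2⟩
      · rintro ⟨π', h1, rfl, rfl, rfl, rfl, h2⟩
        exact ⟨_, ⟨rfl, rfl, rfl⟩, rfl, h2⟩
    | outm i a =>
      simp only [comp, List.mem_singleton, nstep, pstep, Prod.mk.injEq]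
      constructor
      · rintro ⟨ins, ⟨rfl, rfl, rfl⟩, h1, h2⟩
        exact ⟨π, hπ, rfl, h1, rfl, rfl, h2⟩
      · rintro ⟨π', h1, rfl, rfl, rfl, rfl, h2⟩
        exact ⟨_, ⟨rfl, rfl, rfl⟩, rfl, h2⟩
    | push i =>
      simp only [comp, nstep, pstep]
      constructor
      · rintro ⟨ins, h0, h1⟩
        split at h0
        · simp only [List.mem_singleton, Prod.mk.injEq] at h0
          obtain ⟨rfl, rfl, rfl⟩ := h0
          obtain ⟨rfl, rfl, _⟩ := h1
          exact ⟨hs' i :: π, by simp; lia, rfl, rfl, rfl, rfl, rfl, by assumption⟩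
        · simp at h0
      · rintro ⟨π', h1, rfl, rfl, rfl, rfl, rfl, h2⟩
        refine ⟨.dropPeb i (Fin.ofNat _ π.length), by rw [if_pos h2]; exact List.mem_singleton.2 rfl,
          rfl, rfl, ?_⟩
        intro w hw
        rw [mem_enc hπ hπ] at hw
        have : π.reverse[π.length]? = none := by simp
        rw [this] at hw
        cases hw
    | pop =>
      simp only [comp, nstep, pstep]
      constructor
      · rintro ⟨ins, h0, h1⟩
        split at h0
        · simp only [List.mem_singleton, Prod.mk.injEq] at h0
          obtain ⟨rfl, rfl, rfl⟩ := h0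
          obtain ⟨rfl, w, h2⟩ := h1
          cases π with
          | nil => cases h2
          | cons v π =>
            simp only [enc, List.cons.injEq, Prod.mk.injEq] at h2
            simp only [List.length_cons] at hπ
            exact ⟨π, by lia, rfl, h2.2.symm, rfl, rfl, v, rfl⟩
        · simp at h0
      · rintro ⟨π', h1, rfl, rfl, rfl, rfl, v, rfl⟩
        exact ⟨.retrieve (Fin.ofNat _ π'.length), by rw [if_pos (by simp)]; exact List.mem_singleton.2 rfl, rfl, v, rfl⟩
    | jmp i j =>
      simp only [comp, nstep, pstep]
      constructor
      · rintro ⟨ins, h0, h1⟩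
        split at h0
        · simp only [List.mem_singleton, Prod.mk.injEq] at h0
          obtain ⟨rfl, rfl, rfl⟩ := h0
          obtain ⟨rfl, h2, h3⟩ := h1
          exact ⟨π, hπ, rfl, rfl, rfl, rfl, (mem_enc_nm hπ _ _).1 h2, h3⟩
        · simp at h0
      · rintro ⟨π', h1, rfl, rfl, rfl, rfl, h2, h3⟩
        have : j < π'.length := (List.getElem?_eq_some_iff.1 h2).1
        exact ⟨.jump i (nmOf N π'.length j), by rw [if_pos this]; exact List.mem_singleton.2 rfl, rfl,
          (mem_enc_nm hπ _ _).2 h2, h3⟩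
  · simp only [comp, nstep, List.mem_cons, List.not_mem_nil, or_false, Prod.mk.injEq]
    constructor
    · rintro ⟨ins, ⟨rfl, rfl, rfl⟩ | ⟨rfl, rfl, rfl⟩, rfl, rfl, h3⟩ <;>
      · rw [tmap_holds hπ] at h3
        exact ⟨π, hπ, rfl, rfl, ⟨rfl, rfl⟩, _, h3, rfl⟩
    · rintro ⟨π', h1, rfl, rfl, ⟨rfl, rfl⟩, b, h2, rfl⟩
      cases b
      · exact ⟨_, .inr ⟨rfl, rfl, rfl⟩, rfl, rfl, by rw [tmap_holds hπ]; exact h2⟩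
      · exact ⟨_, .inl ⟨rfl, rfl, rfl⟩, rfl, rfl, by rw [tmap_holds hπ]; exact h2⟩
  · simp only [comp, nstep, List.mem_cons, List.not_mem_nil, or_false, Prod.mk.injEq]
    constructor
    · rintro ⟨ins, ⟨rfl, rfl, rfl⟩ | ⟨rfl, rfl, rfl⟩, rfl, rfl, h3⟩ <;>
        exact ⟨π, hπ, rfl, rfl, rfl, rfl, rfl⟩
    · rintro ⟨π', h1, rfl, rfl, rfl, rfl, rfl⟩
      by_cases h : gTestHolds g (GTest.peb ⟨0, hk⟩ (nmOf N π'.length 0)) hs' (enc N π')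
      · exact ⟨_, .inl ⟨rfl, rfl, rfl⟩, rfl, rfl, by simpa using h⟩
      · exact ⟨_, .inr ⟨rfl, rfl, rfl⟩, rfl, rfl, by simpa using h⟩

/-- The automaton compiled from a machine. -/
noncomputable def toGWA (hk : 0 < k) (N : ℕ) (M : Mach Sig k Bool) : GWA Sig k :=
  have := M.fin
  { Q := (M.Q ⊕ Bool) × Fin (N + 1)
    finQ := Fintype.ofFinite _
    X := Fin (N + 1)
    finX := inferInstance
    q0 := (.inl M.start, Fin.ofNat _ 0)
    acc := {x | x.1 = .inr true}
    instr := {t | ∃ q, t.1.1 = .inl q ∧ (t.2.1, t.2.2) ∈ comp hk N t.1.2.val (M.δ q)}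
    instrFin := by
      have : {t : ((M.Q ⊕ Bool) × Fin (N + 1)) × GInstr Sig k (Fin (N + 1)) ×
          ((M.Q ⊕ Bool) × Fin (N + 1)) |
          ∃ q, t.1.1 = .inl q ∧ (t.2.1, t.2.2) ∈ comp hk N t.1.2.val (M.δ q)} =
          ⋃ x : M.Q × Fin (N + 1), (fun y => ((Sum.inl x.1, x.2), y)) ''
            {y | y ∈ comp hk N x.2.val (M.δ x.1)} := by
        ext ⟨⟨q, h⟩, y⟩
        simp only [Set.mem_ofPred_eq, Set.mem_iUnion, Set.mem_image, Prod.mk.injEq]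
        constructor
        · rintro ⟨q', rfl, h2⟩
          exact ⟨(q', h), y, h2, ⟨rfl, rfl⟩, rfl⟩
        · rintro ⟨⟨q', h'⟩, y', h2, ⟨rfl, rfl⟩, rfl⟩
          exact ⟨q', rfl, h2⟩
      rw [this]
      exact Set.finite_iUnion fun x => (List.finite_toSet _).image _ }

lemma toGWA_det (hk : 0 < k) (N : ℕ) (M : Mach Sig k Bool) : GDeterministic (toGWA hk N M) := by
  rintro p χ₁ q₁ χ₂ q₂ ⟨q, h1, h2⟩ ⟨q', h1', h2'⟩ hne
  rw [h1] at h1'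
  cases h1'
  exact comp_det hk _ _ h2 h2' hne

def ecode (hk : 0 < k) (N : ℕ) (M : Mach Sig k Bool) (g : LGraph Sig)
    (c : (M.Q ⊕ Bool) × St k g) : GConf (toGWA hk N M) g :=
  ((c.1, Fin.ofNat _ c.2.2.length), c.2.1, enc N c.2.2)

lemma gstep_ecode (hk : 0 < k) (M : Mach Sig k Bool) (c : (M.Q ⊕ Bool) × St k g)
    (hc : c.2.2.length ≤ N) (d : GConf (toGWA hk N M) g) :
    GStep (toGWA hk N M) g (ecode hk N M g c) d ↔
      ∃ c', c'.2.2.length ≤ N ∧ mstep M N g c c' ∧ d = ecode hk N M g c' := by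
  obtain ⟨q, hs, π⟩ := c
  obtain ⟨⟨t, h'⟩, hs', P'⟩ := d
  have hv : (Fin.ofNat (N + 1) π.length).val = π.length := Nat.mod_eq_of_lt (by simp at hc; lia)
  constructor
  · rintro ⟨ins, ⟨q', h1, h2⟩, h3⟩
    simp only [ecode] at h1 h2 h3
    subst h1
    rw [hv] at h2
    obtain ⟨π', h4, h5, h6, h7⟩ := (comp_step hk hc (M.δ q') hs hs' t h' P').1 ⟨ins, h2, h3⟩
    exact ⟨(t, hs', π'), h4, ⟨q', rfl, h7⟩, by rw [h5, h6]; rfl⟩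
  · rintro ⟨⟨t', hs1, π'⟩, h4, ⟨q', h1, h7⟩, h8⟩
    simp only at h1
    subst h1
    obtain ⟨h9, h10⟩ := Prod.mk.inj h8
    obtain ⟨rfl, rfl⟩ := Prod.mk.inj h9
    obtain ⟨rfl, rfl⟩ := Prod.mk.inj h10
    obtain ⟨ins, h2, h3⟩ := (comp_step hk hc (M.δ q') hs hs' t (Fin.ofNat _ π'.length)
      (enc N π')).2 ⟨π', h4, rfl, rfl, h7⟩
    refine ⟨ins, ⟨q', rfl, ?_⟩, h3⟩
    simp only [ecode]
    rw [hv]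
    exact h2

lemma toGWA_accFrom (hk : 0 < k) (N : ℕ) (M : Mach Sig k Bool) (g : LGraph Sig) (u : g.V) :
    AccFrom (toGWA hk N M) g u ↔ ∃ hs', den M N g (fun _ => u, []) true (hs', []) := by
  have fwd : ∀ c : (M.Q ⊕ Bool) × St k g, c.2.2.length ≤ N → ∀ d,
      ReflTransGen (GStep (toGWA hk N M) g) (ecode hk N M g c) d →
      ∃ c', c'.2.2.length ≤ N ∧ ReflTransGen (mstep M N g) c c' ∧ d = ecode hk N M g c' := by
    intro c hc d h
    induction h with
    | refl => exact ⟨c, hc, .refl, rfl⟩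
    | tail _ h1 ih =>
      obtain ⟨c1, h2, h3, rfl⟩ := ih
      obtain ⟨c2, h4, h5, rfl⟩ := (gstep_ecode hk M c1 h2 _).1 h1
      exact ⟨c2, h4, h3.tail h5, rfl⟩
  have len : ∀ c c' : (M.Q ⊕ Bool) × St k g, c.2.2.length ≤ N → mstep M N g c c' →
      c'.2.2.length ≤ N := by
    rintro ⟨x, hs, π⟩ ⟨y, hs', π'⟩ h ⟨q, _, h1⟩
    simp only at h h1 ⊢
    rcases hn : M.δ q with ⟨ι, t⟩ | ⟨τ, f⟩ | t <;> rw [hn] at h1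
    · cases ι <;> simp only [nstep, pstep] at h1 
      · rw [h1.2.1]; exact h
      · rw [h1.2.1]; exact h
      · rw [h1.2.2.1]; simp; lia
      · obtain ⟨_, _, w, rfl⟩ := h1; simp at h; lia
      · rw [h1.2.1]; exact h
    · obtain ⟨h1, _⟩ := h1
      cases h1; exact h
    · cases h1; exact h
  have bwd : ∀ c c' : (M.Q ⊕ Bool) × St k g, c.2.2.length ≤ N → ReflTransGen (mstep M N g) c c' →
      c'.2.2.length ≤ N ∧ ReflTransGen (GStep (toGWA hk N M) g) (ecode hk N M g c) (ecode hk N M g c') := by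
    intro c c' hc h
    induction h with
    | refl => exact ⟨hc, .refl⟩
    | tail _ h1 ih =>
      have := len _ _ ih.1 h1
      exact ⟨this, ih.2.tail ((gstep_ecode hk M _ ih.1 _).2 ⟨_, this, h1, rfl⟩)⟩
  constructor
  · rintro ⟨⟨x, h⟩, hs, h1, h2, h3⟩
    obtain ⟨⟨x', hs', π'⟩, h4, h5, h6⟩ := fwd (.inl M.start, fun _ => u, []) (by simp) _ h2
    obtain ⟨h9, h10⟩ := Prod.mk.inj h6
    obtain ⟨rfl, rfl⟩ := Prod.mk.inj h9
    obtain ⟨rfl, h11⟩ := Prod.mk.inj h10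
    have h1' : x = .inr true := h1
    subst h1'
    cases π' with
    | nil => exact ⟨_, h5⟩
    | cons v π => cases h11
  · rintro ⟨hs', h⟩
    refine ⟨(.inr true, Fin.ofNat _ 0), hs', rfl, (bwd _ _ (by simp) h).2, ?_⟩
    rintro c' ⟨ins, ⟨q, h1, _⟩, _⟩
    cases h1

end Compile
end NestedPebblesGraphs

open Relation

namespace NestedPebblesGraphs
section Specs
variable {Sig : Type} {k : ℕ}

/-- Realizability of a specification by a machine reading its parameters from pebbles. -/
def RzH (Sig : Type) (k : ℕ) (ι E : Type) (T : ∀ g : LGraph Sig, (ι → g.V) → Prop)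
    (S : ∀ g : LGraph Sig, (ι → g.V) → E → (Fin k → g.V) → Prop) : Prop :=
  ∃ d : ℕ, ∀ e : ι → ℕ, ∃ p : Mach Sig k E, ∀ (N : ℕ) (g : LGraph Sig) (hs : Fin k → g.V)
    (π : List g.V) (w : ι → g.V), (∀ i, π[e i]? = some (w i)) → π.length + d ≤ N →
    (∀ o s', den p N g (hs, π) o s' → s'.2 = π ∧ S g w o s'.1) ∧
    (T g w → ∃ o s', den p N g (hs, π) o s')

variable {ι κ E A : Type} {T T' : ∀ g : LGraph Sig, (ι → g.V) → Prop}
  {S S' : ∀ g : LGraph Sig, (ι → g.V) → E → (Fin k → g.V) → Prop}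

lemma RzH.mono (h : RzH Sig k ι E T S) (hT : ∀ g w, T' g w → T g w)
    (hS : ∀ g w o hs, S g w o hs → S' g w o hs) : RzH Sig k ι E T' S' := by
  obtain ⟨d, h⟩ := h
  refine ⟨d, fun e => ?_⟩
  obtain ⟨p, hp⟩ := h e
  refine ⟨p, fun N g hs π w h1 h2 => ⟨fun o s' h3 => ?_, fun h3 => ?_⟩⟩
  · have := (hp N g hs π w h1 h2).1 o s' h3
    exact ⟨this.1, hS _ _ _ _ this.2⟩
  · exact (hp N g hs π w h1 h2).2 (hT _ _ h3)

lemma RzH.rename (h : RzH Sig k ι E T S) (r : ι → κ) :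
    RzH Sig k κ E (fun g w => T g (fun i => w (r i))) (fun g w => S g (fun i => w (r i))) := by
  obtain ⟨d, h⟩ := h
  refine ⟨d, fun e => ?_⟩
  obtain ⟨p, hp⟩ := h (fun i => e (r i))
  exact ⟨p, fun N g hs π w h1 h2 => hp N g hs π _ (fun i => h1 (r i)) h2⟩

lemma RzH.map {F : Type} (h : RzH Sig k ι E T S) (r : E → F) :
    RzH Sig k ι F T (fun g w o hs => ∃ a, r a = o ∧ S g w a hs) := by
  obtain ⟨d, h⟩ := h
  refine ⟨d, fun e => ?_⟩
  obtain ⟨p, hp⟩ := h e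
  refine ⟨p.map r, fun N g hs π w h1 h2 => ⟨fun o s' h3 => ?_, fun h3 => ?_⟩⟩
  · obtain ⟨a, h4, h5⟩ := (den_map _ _).1 h3
    have := (hp N g hs π w h1 h2).1 a s' h4
    exact ⟨this.1, a, h5, this.2⟩
  · obtain ⟨o, s', h4⟩ := (hp N g hs π w h1 h2).2 h3
    exact ⟨_, _, den_map_of r _ h4⟩

lemma RzH.ret (a : E) : RzH Sig k ι E (fun _ _ => True) (fun _ _ o _ => o = a) := by
  refine ⟨0, fun e => ⟨.ret a, fun N g hs π w h1 h2 => ⟨fun o s' h3 => ?_, fun h3 => ?_⟩⟩⟩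
  · obtain ⟨h4, h5⟩ := den_ret.1 h3
    subst h5
    exact ⟨rfl, h4⟩
  · exact ⟨_, _, den_ret.2 ⟨rfl, rfl⟩⟩

lemma RzH.jump (f : Fin k → ι) :
    RzH Sig k ι Unit (fun _ _ => True) (fun _ w _ hs => hs = fun i => w (f i)) := by
  refine ⟨0, fun e => ⟨jumpAll (fun i => e (f i)), fun N g hs π w h1 h2 => ?_⟩⟩
  have := den_jumpAll (N := N) (fun i => e (f i)) (fun i => w (f i)) hs π (fun i => h1 (f i))
  refine ⟨fun o s' h3 => ?_, fun h3 => ⟨_, _, this⟩⟩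
  obtain ⟨_, rfl⟩ := den_det this h3
  exact ⟨rfl, rfl⟩

/-- Run `m` with the current heads pushed as pebbles. -/
def withHeads [Finite E] (m : Mach Sig k E) : Mach Sig k E :=
  pushAll.bind fun _ => m.bind fun o => (popN k).map fun _ => o

lemma ofFn_getElem {V : Type} (hs : Fin k → V) (π : List V) (j : Fin k) :
    (List.ofFn hs ++ π)[j.val]? = some (hs j) := by
  rw [List.getElem?_append_left (by simp)]
  simp

lemma ofFn_getElem' {V : Type} (hs : Fin k → V) (π : List V) (j : ℕ) :
    (List.ofFn hs ++ π)[k + j]? = π[j]? := by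
  rw [List.getElem?_append_right (by simp)]
  simp

lemma den_withHeads [Finite E] {N : ℕ} {g : LGraph Sig} (m : Mach Sig k E) (hs : Fin k → g.V)
    (π : List g.V) (hN : π.length + k ≤ N)
    (hm : ∀ o t, den m N g (hs, List.ofFn hs ++ π) o t → t.2 = List.ofFn hs ++ π)
    (o : E) (s' : St k g) :
    den (withHeads m) N g (hs, π) o s' ↔
      den m N g (hs, List.ofFn hs ++ π) o (s'.1, List.ofFn hs ++ π) ∧ s'.2 = π := by
  rw [withHeads, den_bind_of (den_pushAll hs π hN), den_bind]
  constructor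
  · rintro ⟨a, ⟨t1, t2⟩, h1, h2⟩
    have h3 := hm a _ h1
    simp only at h3
    subst h3
    obtain ⟨u, h4, rfl⟩ := (den_map _ _).1 h2
    obtain ⟨_, rfl⟩ := den_det (den_popN t1 (List.ofFn hs) π (by simp)) h4
    exact ⟨h1, rfl⟩
  · rcases s' with ⟨s1, s2⟩
    rintro ⟨h1, h2⟩
    simp only at h1 h2
    subst h2
    exact ⟨o, _, h1, den_map_of _ _ (den_popN s1 (List.ofFn hs) s2 (by simp))⟩

lemma RzH.iterH [Finite A] [Finite E] {T0 : ∀ g : LGraph Sig, (ι → g.V) → Prop}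
    {S0 : ∀ g : LGraph Sig, (ι → g.V) → A → (Fin k → g.V) → Prop}
    {T : A → ∀ g : LGraph Sig, (ι ⊕ Fin k → g.V) → Prop}
    {S : A → ∀ g : LGraph Sig, (ι ⊕ Fin k → g.V) → A ⊕ E → (Fin k → g.V) → Prop}
    (h0 : RzH Sig k ι A T0 S0) (hf : ∀ a, RzH Sig k (ι ⊕ Fin k) (A ⊕ E) (T a) (S a)) :
    RzH Sig k ι E
      (fun g w => T0 g w ∧ ∀ a h, S0 g w a h →
        Acc (fun y x : A × (Fin k → g.V) => S x.1 g (Sum.elim w x.2) (.inl y.1) y.2) (a, h) ∧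
        ∀ x, ReflTransGen (fun x y : A × (Fin k → g.V) =>
          S x.1 g (Sum.elim w x.2) (.inl y.1) y.2) (a, h) x → T x.1 g (Sum.elim w x.2))
      (fun g w o hs => ∃ a h, S0 g w a h ∧ ∃ x, ReflTransGen (fun x y : A × (Fin k → g.V) =>
          S x.1 g (Sum.elim w x.2) (.inl y.1) y.2) (a, h) x ∧
          S x.1 g (Sum.elim w x.2) (.inr o) hs) := by
  obtain ⟨d0, h0⟩ := h0
  choose d hd using hf
  obtain ⟨D, hD⟩ : ∃ D, ∀ a, d a ≤ D := by
    obtain ⟨D, hD⟩ := (Set.finite_range d).bddAbove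
    exact ⟨D, fun a => hD ⟨a, rfl⟩⟩
  refine ⟨d0 + k + D, fun e => ?_⟩
  obtain ⟨p, hp⟩ := h0 e
  choose m hm using fun a => hd a (Sum.elim (fun i => k + e i) (fun j => j.val))
  refine ⟨p.bind fun a => Mach.iter (fun a => withHeads (m a)) a, fun N g hs π w h1 h2 => ?_⟩
  have hbody : ∀ a hs, _ := fun a hs => hm a N g hs (List.ofFn hs ++ π) (Sum.elim w hs)
    (by rintro (i | j)
        · simp only [Sum.elim_inl]; rw [ofFn_getElem', h1]
        · simp only [Sum.elim_inr]; rw [ofFn_getElem])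
    (by have := hD a; simp; lia)
  have hwh : ∀ a hs, _ := fun a hs => den_withHeads (m a) hs π (N := N) (by lia)
    (fun o t h => ((hbody a hs).1 o t h).1)
  constructor
  · intro o s' h3
    obtain ⟨a, ⟨t1, t2⟩, h4, h5⟩ := (den_bind _ _).1 h3
    obtain ⟨h6, h7⟩ := (hp N g hs π w h1 (by lia)).1 _ _ h4
    simp only at h6 h7
    subst h6
    obtain ⟨⟨a', ⟨t1', t2'⟩⟩, h8, h9⟩ := den_iter_chain _ _ h5
    have key : ∀ x : A × St k g, ReflTransGen (fun x y : A × St k g =>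
        den (withHeads (m x.1)) N g x.2 (.inl y.1) y.2) (a, t1, t2) x → x.2.2 = t2 ∧
        ReflTransGen (fun x y : A × (Fin k → g.V) =>
          S x.1 g (Sum.elim w x.2) (.inl y.1) y.2) (a, t1) (x.1, x.2.1) := by
      intro x hx
      induction hx with
      | refl => exact ⟨rfl, .refl⟩
      | @tail y z _ h10 ih =>
        obtain ⟨y1, y2, y3⟩ := y
        obtain ⟨rfl, ih⟩ := ih
        obtain ⟨h11, h12⟩ := (hwh y1 y2 _ _).1 h10
        exact ⟨h12, ih.tail ((hbody y1 y2).1 _ _ h11).2⟩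
    obtain ⟨rfl, h10⟩ := key _ h8
    obtain ⟨h11, h12⟩ := (hwh a' t1' _ _).1 h9
    exact ⟨h12, a, t1, h7, _, h10, ((hbody a' t1').1 _ _ h11).2⟩
  · rintro ⟨h3, h4⟩
    obtain ⟨a, ⟨t1, t2⟩, h5⟩ := (hp N g hs π w h1 (by lia)).2 h3
    obtain ⟨h6, h7⟩ := (hp N g hs π w h1 (by lia)).1 _ _ h5
    simp only at h6 h7
    subst h6
    obtain ⟨h8, h9⟩ := h4 a t1 h7
    have key : ∀ x : A × (Fin k → g.V),
        Acc (fun y x : A × (Fin k → g.V) => S x.1 g (Sum.elim w x.2) (.inl y.1) y.2) x →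
        ReflTransGen (fun x y : A × (Fin k → g.V) =>
          S x.1 g (Sum.elim w x.2) (.inl y.1) y.2) (a, t1) x →
        ∃ o s', den (Mach.iter (fun a => withHeads (m a)) x.1) N g (x.2, t2) o s' := by
      intro x hx
      induction hx with
      | intro x _ ih =>
        intro hr
        obtain ⟨o, ⟨s1, s2⟩, h10⟩ := (hbody x.1 x.2).2 (h9 x hr)
        obtain ⟨h11, h12⟩ := (hbody x.1 x.2).1 _ _ h10
        simp only at h11
        subst h11
        have h13 := (hwh x.1 x.2 o (s1, t2)).2 ⟨h10, rfl⟩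
        rcases o with a' | o
        · obtain ⟨o, s', h14⟩ := ih (a', s1) h12 (hr.tail h12)
          exact ⟨o, s', den_iter_of _ _ (.inr ⟨a', _, h13, h14⟩)⟩
        · exact ⟨o, _, den_iter_of _ _ (.inl h13)⟩
    obtain ⟨o, s', h10⟩ := key _ h8 .refl
    exact ⟨o, s', (den_bind _ _).2 ⟨a, _, h5, h10⟩⟩

lemma RzH.bindH [Finite A] [Finite E] {T0 : ∀ g : LGraph Sig, (ι → g.V) → Prop}
    {S0 : ∀ g : LGraph Sig, (ι → g.V) → A → (Fin k → g.V) → Prop}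
    {T : A → ∀ g : LGraph Sig, (ι ⊕ Fin k → g.V) → Prop}
    {S : A → ∀ g : LGraph Sig, (ι ⊕ Fin k → g.V) → E → (Fin k → g.V) → Prop}
    (h0 : RzH Sig k ι A T0 S0) (hf : ∀ a, RzH Sig k (ι ⊕ Fin k) E (T a) (S a)) :
    RzH Sig k ι E
      (fun g w => T0 g w ∧ ∀ a h, S0 g w a h → T a g (Sum.elim w h))
      (fun g w o hs => ∃ a h, S0 g w a h ∧ S a g (Sum.elim w h) o hs) := by
  have hno : ∀ (g : LGraph Sig) (w : ι → g.V) (x y : A × (Fin k → g.V)),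
      ¬ ∃ a, (Sum.inr a : A ⊕ E) = .inl y.1 ∧ S x.1 g (Sum.elim w x.2) a y.2 := by
    rintro g w x y ⟨a, h, _⟩
    cases h
  refine (RzH.iterH h0 (fun a => (hf a).map (Sum.inr (α := A)))).mono ?_ ?_
  · rintro g w ⟨h1, h2⟩
    refine ⟨h1, fun a h h3 => ⟨⟨_, fun y hy => (hno _ _ _ _ hy).elim⟩, fun x hx => ?_⟩⟩
    rcases ReflTransGen.cases_head hx with rfl | ⟨y, hy, _⟩
    · exact h2 a h h3
    · exact (hno _ _ _ _ hy).elim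
  · rintro g w o hs ⟨a, h, h1, x, hx, a', h2, h3⟩
    cases h2
    rcases ReflTransGen.cases_head hx with rfl | ⟨y, hy, _⟩
    · exact ⟨a, h, h1, h3⟩
    · exact (hno _ _ _ _ hy).elim

lemma RzH.bind [Finite A] [Finite E] {T0 : ∀ g : LGraph Sig, (ι → g.V) → Prop}
    {S0 : ∀ g : LGraph Sig, (ι → g.V) → A → (Fin k → g.V) → Prop}
    {T : A → ∀ g : LGraph Sig, (ι → g.V) → Prop}
    {S : A → ∀ g : LGraph Sig, (ι → g.V) → E → (Fin k → g.V) → Prop}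
    (h0 : RzH Sig k ι A T0 S0) (hf : ∀ a, RzH Sig k ι E (T a) (S a)) :
    RzH Sig k ι E
      (fun g w => T0 g w ∧ ∀ a h, S0 g w a h → T a g w)
      (fun g w o hs => ∃ a h, S0 g w a h ∧ S a g w o hs) :=
  RzH.bindH h0 (fun a => (hf a).rename Sum.inl)

lemma exists_bool_iff (P : Prop) : ∃ b : Bool, P ↔ b = true := by
  by_cases h : P
  · exact ⟨true, by simpa using h⟩
  · exact ⟨false, by simpa using h⟩

/-- Boolean atoms. -/
lemma RzH.eq (hk : 0 < k) (x y : ι) : RzH Sig k ι Bool (fun _ _ => True)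
    (fun _ w o _ => (o = true ↔ w x = w y)) := by
  refine ⟨0, fun e => ⟨(Mach.act (.jmp ⟨0, hk⟩ (e x))).bind fun _ => .tst (.peb ⟨0, hk⟩ (e y)),
    fun N g hs π w h1 h2 => ?_⟩⟩
  have h3 : den (Mach.act (.jmp ⟨0, hk⟩ (e x))) N g (hs, π) ()
      (Function.update hs ⟨0, hk⟩ (w x), π) := by
    refine den_act.2 ⟨rfl, by simpa using h1 x, ?_⟩
    intro h hh
    simp [hh]
  constructor
  · intro o s' h4
    rw [den_bind_of h3, den_tst] at h4
    obtain ⟨rfl, h5⟩ := h4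
    refine ⟨rfl, h5.symm.trans ?_⟩
    simp [tholds, h1, eq_comm]
  · intro _
    obtain ⟨b, hb⟩ := exists_bool_iff (tholds g (.peb ⟨0, hk⟩ (e y)) (Function.update hs ⟨0, hk⟩ (w x), π))
    refine ⟨b, (Function.update hs ⟨0, hk⟩ (w x), π), ?_⟩
    rw [den_bind_of h3, den_tst]
    exact ⟨rfl, hb⟩

lemma RzH.test1 (hk : 0 < k) (x : ι) (τ : GTest Sig k ℕ) (P : ∀ g : LGraph Sig, g.V → Prop)
    (hτ : ∀ g s, tholds g τ s ↔ P g (s.1 ⟨0, hk⟩)) : RzH Sig k ι Bool (fun _ _ => True)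
    (fun g w o _ => (o = true ↔ P g (w x))) := by
  refine ⟨0, fun e => ⟨(Mach.act (.jmp ⟨0, hk⟩ (e x))).bind fun _ => .tst τ,
    fun N g hs π w h1 h2 => ?_⟩⟩
  have h3 : den (Mach.act (.jmp ⟨0, hk⟩ (e x))) N g (hs, π) ()
      (Function.update hs ⟨0, hk⟩ (w x), π) := by
    refine den_act.2 ⟨rfl, by simpa using h1 x, ?_⟩
    intro h hh
    simp [hh]
  constructor
  · intro o s' h4
    rw [den_bind_of h3, den_tst] at h4
    obtain ⟨rfl, h5⟩ := h4
    refine ⟨rfl, h5.symm.trans ?_⟩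
    simp [hτ]
  · intro _
    obtain ⟨b, hb⟩ := exists_bool_iff (tholds g τ (Function.update hs ⟨0, hk⟩ (w x), π))
    refine ⟨b, (Function.update hs ⟨0, hk⟩ (w x), π), ?_⟩
    rw [den_bind_of h3, den_tst]
    exact ⟨rfl, hb⟩

lemma RzH.lab (hk : 0 < k) (a : Sig) (x : ι) : RzH Sig k ι Bool (fun _ _ => True)
    (fun g w o _ => (o = true ↔ g.nlab (w x) = a)) :=
  RzH.test1 hk x (.lab ⟨0, hk⟩ a) (fun g v => g.nlab v = a) (fun _ _ => Iff.rfl)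

lemma RzH.hasIn (hk : 0 < k) (a : Sig) (x : ι) : RzH Sig k ι Bool (fun _ _ => True)
    (fun g w o _ => (o = true ↔ ∃ u, g.edge a u (w x))) :=
  RzH.test1 hk x (.inedge ⟨0, hk⟩ a) (fun g v => ∃ u, g.edge a u v) (fun _ _ => Iff.rfl)

lemma RzH.hasOut (hk : 0 < k) (a : Sig) (x : ι) : RzH Sig k ι Bool (fun _ _ => True)
    (fun g w o _ => (o = true ↔ ∃ u, g.edge a (w x) u)) :=
  RzH.test1 hk x (.outedge ⟨0, hk⟩ a) (fun g v => ∃ u, g.edge a v u) (fun _ _ => Iff.rfl)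

lemma RzH.edg (hk : 0 < k) (a : Sig) (x y : ι) : RzH Sig k ι Bool (fun _ _ => True)
    (fun g w o _ => (o = true ↔ g.edge a (w x) (w y))) := by
  refine ⟨0, fun e => ⟨(Mach.act (.jmp ⟨0, hk⟩ (e x))).bind fun _ =>
    (Mach.tst (.outedge ⟨0, hk⟩ a)).bind fun b => bif b then
      (Mach.act (.outm ⟨0, hk⟩ a)).bind fun _ => .tst (.peb ⟨0, hk⟩ (e y)) else .ret false,
    fun N g hs π w h1 h2 => ?_⟩⟩
  have h3 : den (Mach.act (.jmp ⟨0, hk⟩ (e x))) N g (hs, π) ()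
      (Function.update hs ⟨0, hk⟩ (w x), π) := by
    refine den_act.2 ⟨rfl, by simpa using h1 x, ?_⟩
    intro h hh
    simp [hh]
  by_cases hv : ∃ v, g.edge a (w x) v
  · have h4 : den (Mach.tst (.outedge ⟨0, hk⟩ a)) N g (Function.update hs ⟨0, hk⟩ (w x), π) true
        (Function.update hs ⟨0, hk⟩ (w x), π) := den_tst.2 ⟨rfl, by simpa [tholds] using hv⟩
    obtain ⟨v, hv⟩ := hv
    have h5 : den (Mach.act (.outm ⟨0, hk⟩ a)) N g (Function.update hs ⟨0, hk⟩ (w x), π) ()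
        (Function.update hs ⟨0, hk⟩ v, π) := by
      refine den_act.2 ⟨rfl, by simpa using hv, ?_⟩
      intro h hh
      simp [hh]
    have h6 : v = w y ↔ g.edge a (w x) (w y) :=
      ⟨fun h => h ▸ hv, fun h => g.out_unique _ _ _ _ hv h⟩
    simp only [den_bind_of h3, den_bind_of h4, cond_true, den_bind_of h5, den_tst]
    constructor
    · rintro o s' ⟨rfl, h7⟩
      refine ⟨rfl, h7.symm.trans ?_⟩
      simp [tholds, h1, ← h6, eq_comm]
    · intro _
      obtain ⟨b, hb⟩ := exists_bool_iff (tholds g (.peb ⟨0, hk⟩ (e y))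
        (Function.update hs ⟨0, hk⟩ v, π))
      exact ⟨b, _, rfl, hb⟩
  · have h4 : den (Mach.tst (.outedge ⟨0, hk⟩ a)) N g (Function.update hs ⟨0, hk⟩ (w x), π) false
        (Function.update hs ⟨0, hk⟩ (w x), π) := den_tst.2 ⟨rfl, by simpa [tholds] using hv⟩
    simp only [den_bind_of h3, den_bind_of h4, cond_false, den_ret]
    constructor
    · rintro o s' ⟨rfl, rfl⟩
      exact ⟨rfl, by simpa using fun h => hv ⟨_, h⟩⟩
    · intro _
      exact ⟨_, _, rfl, rfl⟩

end Specs
end NestedPebblesGraphs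

open Relation

namespace NestedPebblesGraphs
section Guide
variable {Sig : Type} {k : ℕ} (hk : 0 < k) (G : GWA Sig k)

/-- One step of the walk, scanning the heads one by one in each configuration. -/
def Nx (g : LGraph Sig) (z z' : GConf G g × Fin k) : Prop :=
  (z'.1 = z.1 ∧ z'.2.val = z.2.val + 1) ∨
    (z.2.val + 1 = k ∧ GStep G g z.1 z'.1 ∧ z'.2.val = 0)

inductive At (g : LGraph Sig) (b : g.V) : ℕ → GConf G g × Fin k → Prop
  | zero : At g b 0 ((G.q0, fun _ => b, []), ⟨0, hk⟩)
  | succ {n z z'} : At g b n z → Nx G g z z' → At g b (n + 1) z'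

def VstAt (g : LGraph Sig) (b : g.V) (n : ℕ) (x : g.V) : Prop :=
  ∃ z, At hk G g b n z ∧ z.1.2.1 z.2 = x

def Hlt (g : LGraph Sig) (b : g.V) : Prop :=
  ∃ n z, At hk G g b n z ∧ ∀ z', ¬ Nx G g z z'

def Good (g : LGraph Sig) : Prop :=
  ∀ b : g.V, Hlt hk G g b ∧ ∀ x, ∃ n, VstAt hk G g b n x

variable {g : LGraph Sig} {hk G}

lemma gstep_nodup {c c' : GConf G g} (hc : (c.2.2.map Prod.fst).Nodup) (h : GStep G g c c') :
    (c'.2.2.map Prod.fst).Nodup := by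
  obtain ⟨ins, _, h⟩ := h
  cases ins with
  | inmove i a => rw [h.1]; exact hc
  | outmove i a => rw [h.1]; exact hc
  | dropPeb i x =>
    rw [h.2.1, List.map_cons, List.nodup_cons]
    refine ⟨?_, hc⟩
    intro hx
    obtain ⟨⟨y, v⟩, h1, rfl⟩ := List.mem_map.1 hx
    exact h.2.2 v h1
  | retrieve x =>
    obtain ⟨_, v, h2⟩ := h
    rw [h2, List.map_cons, List.nodup_cons] at hc
    exact hc.2
  | jump i x => rw [h.1]; exact hc
  | test b τ => rw [h.2.1]; exact hc

lemma At.nodup {b : g.V} {n z} (h : At hk G g b n z) : (z.1.2.2.map Prod.fst).Nodup := by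
  induction h with
  | zero => exact List.nodup_nil
  | succ _ h1 ih =>
    rcases h1 with ⟨h2, _⟩ | ⟨_, h2, _⟩
    · rw [h2]; exact ih
    · exact gstep_nodup ih h2

lemma Nx_functional (hG : GDeterministic G) {z z' z'' : GConf G g × Fin k}
    (hz : (z.1.2.2.map Prod.fst).Nodup) (h : Nx G g z z') (h' : Nx G g z z'') : z' = z'' := by
  have := z'.2.isLt
  have := z''.2.isLt
  rcases h with ⟨h1, h2⟩ | ⟨h1, h2, h3⟩ <;> rcases h' with ⟨h1', h2'⟩ | ⟨h1', h2', h3'⟩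
  · exact Prod.ext (h1.trans h1'.symm) (Fin.ext (by lia))
  · lia
  · lia
  · obtain ⟨ins, a1, a2⟩ := h2
    obtain ⟨ins', a1', a2'⟩ := h2'
    have := gInstrStep_det hG hz a1 a1' a2 a2'
    exact Prod.ext (Prod.ext this.1 (Prod.ext this.2.1 this.2.2)) (Fin.ext (by lia))

lemma At.functional (hG : GDeterministic G) {b : g.V} {n z z'} (h : At hk G g b n z)
    (h' : At hk G g b n z') : z = z' := by
  induction n generalizing z z' with
  | zero => cases h; cases h'; rfl
  | succ n ih =>
    cases h with
    | succ h1 h2 =>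
      cases h' with
      | succ h1' h2' =>
        obtain rfl := ih h1 h1'
        exact Nx_functional hG h1.nodup h2 h2'

lemma At.before {b : g.V} {n z} (h : At hk G g b n z) {m : ℕ} (hm : m < n) :
    ∃ z1 z2, At hk G g b m z1 ∧ Nx G g z1 z2 := by
  induction h with
  | zero => lia
  | @succ n z z' h1 h2 ih =>
    by_cases hmn : m = n
    · subst hmn; exact ⟨_, _, h1, h2⟩
    · exact ih (by lia)

lemma VstAt.functional (hG : GDeterministic G) {b : g.V} {n x y} (h : VstAt hk G g b n x)
    (h' : VstAt hk G g b n y) : x = y := by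
  obtain ⟨z, h1, rfl⟩ := h
  obtain ⟨z', h1', rfl⟩ := h'
  rw [h1.functional hG h1']

lemma At.le_of_terminal (hG : GDeterministic G) {b : g.V} {n m z z'} (h : At hk G g b n z)
    (ht : ∀ z', ¬ Nx G g z z') (h' : At hk G g b m z') : m ≤ n := by
  by_contra! hlt
  obtain ⟨z1, z2, h1, h2⟩ := h'.before hlt
  rw [← h.functional hG h1] at h2
  exact ht _ h2

lemma vstAt_zero (b : g.V) : VstAt hk G g b 0 b := ⟨_, .zero, rfl⟩

/-- Graphs searched by the guide are good. -/
lemma good_of_searches (h : ∀ u, SearchesFrom G g u) : Good hk G g := by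
  intro b
  obtain ⟨n, cs, h0, hs, hh, hv⟩ := h b
  have scan : ∀ (c : GConf G g) (m : ℕ), At hk G g b m (c, ⟨0, hk⟩) →
      ∀ (j : ℕ) (hj : j < k), ∃ m', At hk G g b m' (c, ⟨j, hj⟩) := by
    intro c m h j
    induction j with
    | zero => intro hj; exact ⟨m, h⟩
    | succ j ih =>
      intro hj
      obtain ⟨m', h'⟩ := ih (by lia)
      exact ⟨m' + 1, .succ h' (.inl ⟨rfl, rfl⟩)⟩
  have reach : ∀ (i : ℕ) (hi : i < n + 1), ∃ m, At hk G g b m (cs ⟨i, hi⟩, ⟨0, hk⟩) := by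
    intro i
    induction i with
    | zero => 
      intro hi
      refine ⟨0, ?_⟩
      have : cs ⟨0, hi⟩ = _ := h0
      rw [this]
      exact .zero
    | succ i ih =>
      intro hi
      obtain ⟨m, h1⟩ := ih (by lia)
      obtain ⟨m', h2⟩ := scan _ m h1 (k - 1) (by lia)
      have := hs ⟨i, by lia⟩
      exact ⟨m' + 1, .succ h2 (.inr ⟨by simp; lia, this, rfl⟩)⟩
  constructor
  · obtain ⟨m, h1⟩ := reach n (by lia)
    obtain ⟨m', h2⟩ := scan _ m h1 (k - 1) (by lia)
    refine ⟨m', _, h2, ?_⟩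
    rintro z' (⟨_, h3⟩ | ⟨_, h3, _⟩)
    · have := z'.2.isLt
      simp only at h3
      lia
    · exact hh _ h3
  · intro x
    obtain ⟨i, j, rfl⟩ := hv x
    obtain ⟨m, h1⟩ := reach i.val i.isLt
    obtain ⟨m', h2⟩ := scan _ m h1 j.val j.isLt
    exact ⟨m', _, h2, rfl⟩

abbrev NL (G : GWA Sig k) : Type := {L : List G.X // L.Nodup}

lemma finite_NL (G : GWA Sig k) : Finite (NL G) := by
  classical
  have := G.finX
  exact Finite.of_fintype _

lemma NL_length (L : NL G) : L.1.length ≤ @Fintype.card G.X G.finX :=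
  @List.Nodup.length_le_card _ G.finX _ L.2

open Classical in
/-- Try to perform one guide instruction. -/
noncomputable def attempt (L : NL G) : GInstr Sig k G.X → Mach Sig k (Option (NL G))
  | .inmove i a => (Mach.tst (.inedge i a)).bind fun b =>
      bif b then (Mach.act (.inm i a)).map (fun _ => some L) else .ret none
  | .outmove i a => (Mach.tst (.outedge i a)).bind fun b =>
      bif b then (Mach.act (.outm i a)).map (fun _ => some L) else .ret none
  | .dropPeb i x => if h : x ∈ L.1 then .ret none else
      (Mach.act (.push i)).map (fun _ => some ⟨x :: L.1, List.nodup_cons.2 ⟨h, L.2⟩⟩)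
  | .retrieve x => if h : ∃ L' : NL G, L.1 = x :: L'.1 then
      (Mach.act .pop).map (fun _ => some h.choose) else .ret none
  | .jump _ _ => .ret none
  | .test b (.lab i a) => (Mach.tst (.lab i a)).map (fun c => if c = b then some L else none)
  | .test b (.inedge i a) => (Mach.tst (.inedge i a)).map (fun c => if c = b then some L else none)
  | .test b (.outedge i a) => (Mach.tst (.outedge i a)).map (fun c => if c = b then some L else none)
  | .test b (.peb i x) => if x ∈ L.1 then
      (Mach.tst (.peb i (L.1.idxOf x))).map (fun c => if c = b then some L else none)
      else .ret (if b = false then some L else none)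

lemma attempt_spec {N : ℕ} (L : NL G) (ins : GInstr Sig k G.X) (hj : ∀ i x, ins ≠ .jump i x)
    (hs : Fin k → g.V) (πA : List (G.X × g.V)) (π : List g.V) (hL : πA.map Prod.fst = L.1)
    (hN : @Fintype.card G.X G.finX + π.length ≤ N) :
    (den (attempt L ins) N g (hs, πA.map Prod.snd ++ π) none (hs, πA.map Prod.snd ++ π) ∧
      ∀ hs' πA', ¬ gInstrStep g ins hs πA hs' πA') ∨
    ∃ L' hs' πA', den (attempt L ins) N g (hs, πA.map Prod.snd ++ π) (some L')
      (hs', πA'.map Prod.snd ++ π) ∧ gInstrStep g ins hs πA hs' πA' ∧ πA'.map Prod.fst = L'.1 := by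
  classical
  have tstcase : ∀ (τ : GTest Sig k ℕ) (τ' : GTest Sig k G.X) (b : Bool),
      (tholds g τ (hs, πA.map Prod.snd ++ π) ↔ gTestHolds g τ' hs πA) →
      let m : Mach Sig k (Option (NL G)) :=
        (Mach.tst τ).map (fun c => if c = b then some L else none)
      (den m N g (hs, πA.map Prod.snd ++ π) none (hs, πA.map Prod.snd ++ π) ∧
        ∀ hs' πA', ¬ gInstrStep g (.test b τ') hs πA hs' πA') ∨
      ∃ L' hs' πA', den m N g (hs, πA.map Prod.snd ++ π) (some L')
        (hs', πA'.map Prod.snd ++ π) ∧ gInstrStep g (.test b τ') hs πA hs' πA' ∧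
        πA'.map Prod.fst = L'.1 := by
    intro τ τ' b hτ m
    obtain ⟨c, hc⟩ := exists_bool_iff (tholds g τ (hs, πA.map Prod.snd ++ π))
    have h1 := den_map_of (fun c => if c = b then some L else none) _
      ((den_tst (N := N)).2 ⟨rfl, hc⟩)
    by_cases hcb : c = b
    · right
      rw [if_pos hcb] at h1
      exact ⟨L, hs, πA, h1, ⟨rfl, rfl, by rw [← hτ, hc, hcb]⟩, hL⟩
    · left
      rw [if_neg hcb] at h1
      refine ⟨h1, ?_⟩
      rintro hs' πA' ⟨_, _, h2⟩
      rw [← hτ, hc] at h2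
      apply hcb
      cases c <;> cases b <;> simp_all
  cases ins with
  | inmove i a =>
    by_cases h : ∃ u, g.edge a u (hs i)
    · right
      have h1 : den (Mach.tst (.inedge i a)) N g (hs, πA.map Prod.snd ++ π) true
        (hs, πA.map Prod.snd ++ π) := den_tst.2 ⟨rfl, by simpa [tholds] using h⟩
      obtain ⟨u, hu⟩ := h
      refine ⟨L, Function.update hs i u, πA, ?_, ?_, hL⟩
      · rw [attempt, den_bind_of h1, cond_true]
        refine den_map_of _ _ (a := ()) (den_act.2 ⟨rfl, by simpa using hu, ?_⟩)
        intro h hh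
        simp [hh]
      · refine ⟨rfl, by simpa using hu, ?_⟩
        intro h hh
        simp [hh]
    · left
      have h1 : den (Mach.tst (.inedge i a)) N g (hs, πA.map Prod.snd ++ π) false
        (hs, πA.map Prod.snd ++ π) := den_tst.2 ⟨rfl, by simpa [tholds] using h⟩
      constructor
      · rw [attempt, den_bind_of h1, cond_false, den_ret]
        exact ⟨rfl, rfl⟩
      · rintro hs' πA' ⟨_, h2, _⟩
        exact h ⟨_, h2⟩
  | outmove i a =>
    by_cases h : ∃ u, g.edge a (hs i) u
    · right
      have h1 : den (Mach.tst (.outedge i a)) N g (hs, πA.map Prod.snd ++ π) true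
        (hs, πA.map Prod.snd ++ π) := den_tst.2 ⟨rfl, by simpa [tholds] using h⟩
      obtain ⟨u, hu⟩ := h
      refine ⟨L, Function.update hs i u, πA, ?_, ?_, hL⟩
      · rw [attempt, den_bind_of h1, cond_true]
        refine den_map_of _ _ (a := ()) (den_act.2 ⟨rfl, by simpa using hu, ?_⟩)
        intro h hh
        simp [hh]
      · refine ⟨rfl, by simpa using hu, ?_⟩
        intro h hh
        simp [hh]
    · left
      have h1 : den (Mach.tst (.outedge i a)) N g (hs, πA.map Prod.snd ++ π) false
        (hs, πA.map Prod.snd ++ π) := den_tst.2 ⟨rfl, by simpa [tholds] using h⟩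
      constructor
      · rw [attempt, den_bind_of h1, cond_false, den_ret]
        exact ⟨rfl, rfl⟩
      · rintro hs' πA' ⟨_, h2, _⟩
        exact h ⟨_, h2⟩
  | dropPeb i x =>
    rw [attempt]
    split
    · rename_i h
      left
      refine ⟨den_ret.2 ⟨rfl, rfl⟩, ?_⟩
      rintro hs' πA' ⟨_, _, h2⟩
      rw [← hL] at h
      obtain ⟨⟨y, v⟩, h1, rfl⟩ := List.mem_map.1 h
      exact h2 v h1
    · rename_i h
      right
      refine ⟨⟨x :: L.1, List.nodup_cons.2 ⟨h, L.2⟩⟩, hs, (x, hs i) :: πA,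
        den_map_of _ _ (a := ()) (den_act.2 ⟨rfl, rfl, ?_⟩), ⟨rfl, rfl, ?_⟩, by simp [hL]⟩
      · have h1 := NL_length (G := G) ⟨x :: L.1, List.nodup_cons.2 ⟨h, L.2⟩⟩
        simp only [List.length_cons, ← hL, List.length_map] at h1
        simp only [List.length_append, List.length_map]
        lia
      · intro v hv
        apply h
        rw [← hL]
        exact List.mem_map.2 ⟨_, hv, rfl⟩
  | retrieve x =>
    rw [attempt]
    split
    · rename_i h
      right
      have h1 := hL.trans h.choose_spec
      generalize h.choose = L' at h1
      clear tstcase hL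
      cases πA with
      | nil => cases h1
      | cons y πA =>
        simp only [List.map_cons, List.cons.injEq] at h1
        refine ⟨L', hs, πA, den_map_of _ _ (a := ()) (den_act.2 ⟨rfl, y.2, rfl⟩),
          ⟨rfl, y.2, ?_⟩, h1.2⟩
        rw [← h1.1]
    · rename_i h
      left
      refine ⟨den_ret.2 ⟨rfl, rfl⟩, ?_⟩
      rintro hs' πA' ⟨_, v, h2⟩
      apply h
      have h3 := L.2
      rw [← hL, h2, List.map_cons, List.nodup_cons] at h3
      exact ⟨⟨_, h3.2⟩, by rw [← hL, h2, List.map_cons]⟩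
  | jump i x => exact (hj i x rfl).elim
  | test b τ =>
    cases τ with
    | lab i a => exact tstcase (.lab i a) (.lab i a) b Iff.rfl
    | inedge i a => exact tstcase (.inedge i a) (.inedge i a) b Iff.rfl
    | outedge i a => exact tstcase (.outedge i a) (.outedge i a) b Iff.rfl
    | peb i x =>
      rw [attempt]
      split
      · rename_i h
        refine tstcase (.peb i (L.1.idxOf x)) (.peb i x) b ?_
        simp only [tholds, gTestHolds]
        have h1 : L.1.idxOf x < πA.length := by
          have := List.idxOf_lt_length_iff.2 h
          rwa [← hL, List.length_map, hL] at this
        rw [List.getElem?_append_left (by simpa using h1), List.getElem?_map,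
          List.getElem?_eq_getElem h1]
        have h2 : (πA[L.1.idxOf x]).1 = x := by
          have h3 := List.getElem_idxOf (List.idxOf_lt_length_iff.2 h)
          have h4 : (πA.map Prod.fst)[L.1.idxOf x]? = some x := by
            rw [hL, List.getElem?_eq_getElem (List.idxOf_lt_length_iff.2 h), h3]
          rw [List.getElem?_map, List.getElem?_eq_getElem h1] at h4
          simpa using h4
        simp only [Option.map_some, Option.some.injEq]
        constructor
        · intro h3
          have : (x, hs i) = πA[L.1.idxOf x] := Prod.ext h2.symm h3.symm
          rw [this]
          exact List.getElem_mem h1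
        · intro h3
          have hn := L.2
          rw [← hL] at hn
          exact nodup_val hn (by
            have : (x, (πA[L.1.idxOf x]).2) = πA[L.1.idxOf x] := Prod.ext h2.symm rfl
            rw [this]
            exact List.getElem_mem h1) h3
      · rename_i h
        have h1 : ¬ (x, hs i) ∈ πA := fun h2 => h (by rw [← hL]; exact List.mem_map.2 ⟨_, h2, rfl⟩)
        cases b
        · right
          exact ⟨L, hs, πA, den_ret.2 ⟨by simp, rfl⟩, ⟨rfl, rfl, by simpa [gTestHolds] using h1⟩, hL⟩
        · left
          refine ⟨den_ret.2 ⟨by simp, rfl⟩, ?_⟩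
          rintro hs' πA' ⟨_, _, h2⟩
          exact h1 (h2.2 rfl)

end Guide
end NestedPebblesGraphs

open Relation

namespace NestedPebblesGraphs
section Find
variable {Sig : Type} {k : ℕ} {hk : 0 < k} {G : GWA Sig k} {g : LGraph Sig}

instance instFiniteNL : Finite (NL G) := finite_NL G
instance instFiniteQ : Finite G.Q := @Finite.of_fintype _ G.finQ

noncomputable def tryAll (L : NL G) :
    List (GInstr Sig k G.X × G.Q) → Mach Sig k (Option (G.Q × NL G))
  | [] => .ret none
  | x :: l => (attempt L x.1).bind fun o => match o with
    | some L' => .ret (some (x.2, L'))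
    | none => tryAll L l

lemma tryAll_spec {N : ℕ} (L : NL G) (l : List (GInstr Sig k G.X × G.Q))
    (hj : ∀ y ∈ l, ∀ i x, y.1 ≠ .jump i x)
    (hs : Fin k → g.V) (πA : List (G.X × g.V)) (π : List g.V) (hL : πA.map Prod.fst = L.1)
    (hN : @Fintype.card G.X G.finX + π.length ≤ N) :
    (den (tryAll L l) N g (hs, πA.map Prod.snd ++ π) none (hs, πA.map Prod.snd ++ π) ∧
      ∀ y ∈ l, ∀ hs' πA', ¬ gInstrStep g y.1 hs πA hs' πA') ∨
    ∃ y ∈ l, ∃ L' hs' πA', den (tryAll L l) N g (hs, πA.map Prod.snd ++ π) (some (y.2, L'))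
      (hs', πA'.map Prod.snd ++ π) ∧ gInstrStep g y.1 hs πA hs' πA' ∧
      πA'.map Prod.fst = L'.1 := by
  induction l with
  | nil => exact .inl ⟨den_ret.2 ⟨rfl, rfl⟩, by simp⟩
  | cons y l ih =>
    rcases attempt_spec L y.1 (hj y (by simp)) hs πA π hL hN with ⟨h1, h2⟩ | ⟨L', hs', πA', h1, h2, h3⟩
    · rcases ih (fun y hy => hj y (by simp [hy])) with ⟨h4, h5⟩ | ⟨y', hy', L', hs', πA', h4, h5⟩
      · left
        refine ⟨?_, ?_⟩
        · rw [tryAll, den_bind_of h1]; exact h4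
        · intro y' hy'
          rcases List.mem_cons.1 hy' with rfl | hy'
          · exact h2
          · exact h5 y' hy'
      · right
        refine ⟨y', by simp [hy'], L', hs', πA', ?_, h5⟩
        rw [tryAll, den_bind_of h1]; exact h4
    · right
      refine ⟨y, by simp, L', hs', πA', ?_, h2, h3⟩
      rw [tryAll, den_bind_of h1]
      exact den_ret.2 ⟨rfl, rfl⟩

lemma exists_ilist (G : GWA Sig k) (p : G.Q) :
    ∃ l : List (GInstr Sig k G.X × G.Q), ∀ x, x ∈ l ↔ (p, x) ∈ G.instr := by
  have h : {x : GInstr Sig k G.X × G.Q | (p, x) ∈ G.instr}.Finite :=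
    G.instrFin.preimage (f := fun x => (p, x)) (fun x _ y _ h => (Prod.mk.inj h).2)
  exact ⟨h.toFinset.toList, fun x => by simp⟩

noncomputable def gstepM (p : G.Q) (L : NL G) : Mach Sig k (Option (G.Q × NL G)) :=
  tryAll L (exists_ilist G p).choose

lemma gstepM_spec (hnj : NoJump G) {N : ℕ} (p : G.Q) (L : NL G)
    (hs : Fin k → g.V) (πA : List (G.X × g.V)) (π : List g.V) (hL : πA.map Prod.fst = L.1)
    (hN : @Fintype.card G.X G.finX + π.length ≤ N) :
    (den (gstepM p L) N g (hs, πA.map Prod.snd ++ π) none (hs, πA.map Prod.snd ++ π) ∧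
      ∀ c', ¬ GStep G g (p, hs, πA) c') ∨
    ∃ c' L', GStep G g (p, hs, πA) c' ∧ den (gstepM p L) N g (hs, πA.map Prod.snd ++ π)
      (some (c'.1, L')) (c'.2.1, c'.2.2.map Prod.snd ++ π) ∧
      c'.2.2.map Prod.fst = L'.1 := by
  have hl := (exists_ilist G p).choose_spec
  rcases tryAll_spec L (exists_ilist G p).choose (fun y hy => hnj p _ _ ((hl y).1 hy)) hs πA π hL hN
    with ⟨h1, h2⟩ | ⟨y, hy, L', hs', πA', h1, h2, h3⟩
  · left
    refine ⟨h1, ?_⟩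
    rintro c' ⟨ins, h3, h4⟩
    exact h2 (ins, c'.1) ((hl _).2 h3) _ _ h4
  · right
    exact ⟨(y.2, hs', πA'), L', ⟨y.1, (hl y).1 hy, h2⟩, h1, h3⟩

abbrev Zc (G : GWA Sig k) : Type := G.Q × NL G × Fin k

open Classical in
noncomputable def fbody (hk : 0 < k) (qm : NL G → Fin k → Mach Sig k Bool) (z : Zc G) :
    Mach Sig k (Zc G ⊕ Bool) :=
  pushAll.bind fun _ => (qm z.2.1 z.2.2).bind fun b => bif b then
    (Mach.act (.jmp ⟨0, hk⟩ z.2.2.val)).bind fun _ =>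
      (popN (k + z.2.1.1.length)).map fun _ => .inr true
  else (jumpAll Fin.val).bind fun _ => (popN k).bind fun _ =>
    if h : z.2.2.val + 1 < k then .ret (.inl (z.1, z.2.1, ⟨z.2.2.val + 1, h⟩))
    else (gstepM z.1 z.2.1).bind fun o => match o with
      | some (p', L') => .ret (.inl (p', L', ⟨0, hk⟩))
      | none => (popN z.2.1.1.length).map fun _ => .inr false

/-- code of a walk configuration -/
def zc (z : GConf G g × Fin k) (h : (z.1.2.2.map Prod.fst).Nodup) : Zc G :=
  (z.1.1, ⟨z.1.2.2.map Prod.fst, h⟩, z.2)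

def zst (z : GConf G g × Fin k) (π : List g.V) : St k g := (z.1.2.1, z.1.2.2.map Prod.snd ++ π)

def zq (z : GConf G g × Fin k) (π : List g.V) : St k g :=
  (z.1.2.1, List.ofFn z.1.2.1 ++ (z.1.2.2.map Prod.snd ++ π))

lemma zlen (z : GConf G g × Fin k) (h : (z.1.2.2.map Prod.fst).Nodup) :
    z.1.2.2.length ≤ @Fintype.card G.X G.finX := by
  have := NL_length (G := G) ⟨_, h⟩
  simpa using this

lemma fbody_true {N : ℕ} (qm : NL G → Fin k → Mach Sig k Bool) (z : GConf G g × Fin k)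
    (h : (z.1.2.2.map Prod.fst).Nodup) (π : List g.V)
    (hN : @Fintype.card G.X G.finX + k + π.length ≤ N) {t : St k g}
    (hq : den (qm (zc z h).2.1 z.2) N g (zq z π) true t) (ht : t.2 = (zq z π).2) :
    den (fbody hk qm (zc z h)) N g (zst z π) (.inr true)
      (Function.update t.1 ⟨0, hk⟩ (z.1.2.1 z.2), π) := by
  have hl := zlen z h
  have h1 := den_pushAll (N := N) z.1.2.1 (z.1.2.2.map Prod.snd ++ π) (by simp; lia)
  obtain ⟨t1, t2⟩ := t
  simp only at ht
  subst ht
  have h2 : den (Mach.act (.jmp ⟨0, hk⟩ z.2.val)) N g (t1, (zq z π).2) ()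
      (Function.update t1 ⟨0, hk⟩ (z.1.2.1 z.2), (zq z π).2) := by
    refine den_act.2 ⟨rfl, ?_, ?_⟩
    · simp only [zq, Function.update_self]
      rw [ofFn_getElem]
    · intro h hh
      simp [hh]
  refine (den_bind_of h1).2 ((den_bind_of hq).2 ((den_bind_of h2).2 ?_))
  refine den_map_of _ _ (a := ()) ?_
  have := den_popN (N := N) (Function.update t1 ⟨0, hk⟩ (z.1.2.1 z.2))
    (List.ofFn z.1.2.1 ++ z.1.2.2.map Prod.snd) π (n := k + (zc z h).2.1.1.length)
    (by simp [zc])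
  rw [List.append_assoc] at this
  exact this

lemma fbody_false (hnj : NoJump G) {N : ℕ} (qm : NL G → Fin k → Mach Sig k Bool)
    (z : GConf G g × Fin k)
    (h : (z.1.2.2.map Prod.fst).Nodup) (π : List g.V)
    (hN : @Fintype.card G.X G.finX + k + π.length ≤ N) {t : St k g}
    (hq : den (qm (zc z h).2.1 z.2) N g (zq z π) false t) (ht : t.2 = (zq z π).2) :
    ((∀ z', ¬ Nx G g z z') ∧ den (fbody hk qm (zc z h)) N g (zst z π) (.inr false)
      (z.1.2.1, π)) ∨
    ∃ z' h', Nx G g z z' ∧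
      den (fbody hk qm (zc z h)) N g (zst z π) (.inl (zc z' h')) (zst z' π) := by
  have hl := zlen z h
  have h1 := den_pushAll (N := N) z.1.2.1 (z.1.2.2.map Prod.snd ++ π) (by simp; lia)
  obtain ⟨t1, t2⟩ := t
  simp only at ht
  subst ht
  have h2 : den (jumpAll Fin.val) N g (t1, (zq z π).2) () (z.1.2.1, (zq z π).2) :=
    den_jumpAll _ _ _ _ (fun i => by rw [zq]; exact ofFn_getElem _ _ _)
  have h3 : den (popN k) N g (z.1.2.1, (zq z π).2) () (zst z π) :=
    den_popN (N := N) z.1.2.1 (List.ofFn z.1.2.1) (z.1.2.2.map Prod.snd ++ π) (by simp)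
  have key : ∀ {e s'}, den (if h' : z.2.val + 1 < k then
        .ret (.inl (z.1.1, (zc z h).2.1, ⟨z.2.val + 1, h'⟩))
      else (gstepM z.1.1 (zc z h).2.1).bind fun o => match o with
        | some (p', L') => .ret (.inl (p', L', ⟨0, hk⟩))
        | none => (popN (zc z h).2.1.1.length).map fun _ => .inr false) N g (zst z π) e s' →
      den (fbody hk qm (zc z h)) N g (zst z π) e s' := fun hh =>
    (den_bind_of h1).2 ((den_bind_of hq).2 ((den_bind_of h2).2 ((den_bind_of h3).2 hh)))
  by_cases hj : z.2.val + 1 < k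
  · right
    refine ⟨(z.1, ⟨z.2.val + 1, hj⟩), h, .inl ⟨rfl, rfl⟩, ?_⟩
    apply key
    rw [dif_pos hj, den_ret]
    exact ⟨rfl, rfl⟩
  · have hj' : z.2.val + 1 = k := by have := z.2.isLt; lia
    rcases gstepM_spec hnj z.1.1 (zc z h).2.1 z.1.2.1 z.1.2.2 π rfl (N := N) (by lia) with
      ⟨h4, h5⟩ | ⟨c', L', h4, h5, h6⟩
    · left
      refine ⟨?_, ?_⟩
      · rintro z' (⟨_, h6⟩ | ⟨_, h6, _⟩)
        · have := z'.2.isLt; lia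
        · exact h5 _ h6
      · apply key
        rw [dif_neg hj, zst]
        refine (den_bind_of h4).2 (den_map_of _ _ (a := ()) ?_)
        exact den_popN z.1.2.1 (z.1.2.2.map Prod.snd) π (by simp [zc])
    · right
      refine ⟨(c', ⟨0, hk⟩), by rw [h6]; exact L'.2, .inr ⟨hj', h4, rfl⟩, ?_⟩
      apply key
      rw [dif_neg hj, zst]
      refine (den_bind_of h5).2 (den_ret.2 ⟨?_, rfl⟩)
      simp [zc, h6]

lemma fbody_inv {N : ℕ} (qm : NL G → Fin k → Mach Sig k Bool) (z : GConf G g × Fin k)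
    (h : (z.1.2.2.map Prod.fst).Nodup) (π : List g.V)
    (hN : @Fintype.card G.X G.finX + k + π.length ≤ N) {e s'}
    (hd : den (fbody hk qm (zc z h)) N g (zst z π) e s') :
    ∃ b t, den (qm (zc z h).2.1 z.2) N g (zq z π) b t := by
  have hl := zlen z h
  have h1 := den_pushAll (N := N) z.1.2.1 (z.1.2.2.map Prod.snd ++ π) (by simp; lia)
  rw [zst, fbody, den_bind_of h1, den_bind] at hd
  obtain ⟨b, t, h2, _⟩ := hd
  exact ⟨b, t, h2⟩

theorem RzH.findG (hk : 0 < k) {ι : Type} (hG : GDeterministic G) (hnj : NoJump G) (b : ι)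
    {Tq : ∀ g : LGraph Sig, (Option ι → g.V) → Prop}
    {Sq : ∀ g : LGraph Sig, (Option ι → g.V) → Bool → Prop}
    (hq : RzH Sig k (Option ι) Bool Tq (fun g w o _ => Sq g w o)) :
    RzH Sig k ι Bool
      (fun g w => Hlt hk G g (w b) ∧ ∀ y, (∃ n, VstAt hk G g (w b) n y) →
        Tq g (fun o => o.elim y w))
      (fun g w o hs =>
        (o = true → ∃ n x, VstAt hk G g (w b) n x ∧ hs ⟨0, hk⟩ = x ∧
          Sq g (fun o => o.elim x w) true ∧
          ∀ m < n, ∀ y, VstAt hk G g (w b) m y → Sq g (fun o => o.elim y w) false) ∧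
        (o = false → Hlt hk G g (w b) ∧ ∀ y, (∃ n, VstAt hk G g (w b) n y) →
          Sq g (fun o => o.elim y w) false)) := by
  obtain ⟨d, hq⟩ := hq
  refine ⟨@Fintype.card G.X G.finX + k + d, fun e => ?_⟩
  choose qm hqm using fun (L : NL G) (j : Fin k) =>
    hq (fun o => o.elim j.val (fun i => k + (L.1.length + e i)))
  refine ⟨(jumpAll (fun _ => e b)).bind fun _ =>
    Mach.iter (fbody hk qm) (G.q0, ⟨[], List.nodup_nil⟩, ⟨0, hk⟩), fun N g hs π w h1 h2 => ?_⟩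
  have h3 := den_jumpAll (N := N) (fun _ => e b) (fun _ => w b) hs π (fun _ => h1 b)
  have hN : @Fintype.card G.X G.finX + k + π.length ≤ N := by lia
  have query : ∀ (z : GConf G g × Fin k) (h : (z.1.2.2.map Prod.fst).Nodup), _ := fun z h =>
    hqm (zc z h).2.1 z.2 N g z.1.2.1 (zq z π).2 (fun o => o.elim (z.1.2.1 z.2) w)
      (by
        rintro (_ | i)
        · simp only [Option.elim, zq]; exact ofFn_getElem _ _ _
        · simp only [Option.elim, zq]
          rw [ofFn_getElem', List.getElem?_append_right (by simp [zc])]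
          simpa [zc] using h1 i)
      (by have := zlen z h; simp [zq]; lia)
  simp only [den_bind_of h3]
  constructor
  · intro o s' h4
    obtain ⟨x, h5, h6⟩ := den_iter_chain _ _ h4
    have key : ∃ n z, At hk G g (w b) n z ∧ (∃ h, x = (zc z h, zst z π)) ∧
        ∀ m < n, ∀ y, VstAt hk G g (w b) m y → Sq g (fun o => o.elim y w) false := by
      clear h6 h4
      induction h5 with
      | refl => exact ⟨0, _, .zero, ⟨List.nodup_nil, rfl⟩, by simp⟩
      | @tail x x' _ h7 ih =>
        obtain ⟨n, z, h8, ⟨h, rfl⟩, h10⟩ := ih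
        obtain ⟨c, t, h11⟩ := fbody_inv qm z h π hN h7
        obtain ⟨h12, h13⟩ := (query z h).1 c t h11
        cases c with
        | true =>
          have := (den_det (fbody_true qm z h π hN h11 h12) h7).1
          cases this
        | false =>
          rcases fbody_false hnj qm z h π hN h11 h12 (hk := hk) with ⟨_, h14⟩ | ⟨z', h', h14, h15⟩
          · have := (den_det h14 h7).1
            cases this
          · obtain ⟨h16, h17⟩ := den_det h15 h7
            refine ⟨n + 1, z', .succ h8 h14, ⟨h', ?_⟩, ?_⟩
            · exact Prod.ext (Sum.inl.inj h16).symm h17.symm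
            · intro m hm y hy
              by_cases hmn : m = n
              · subst hmn
                have := hy.functional hG ⟨z, h8, rfl⟩
                rw [this]; exact h13
              · exact h10 m (by lia) y hy
    obtain ⟨n, z, h8, ⟨h, rfl⟩, h10⟩ := key
    obtain ⟨c, t, h11⟩ := fbody_inv qm z h π hN h6
    obtain ⟨h12, h13⟩ := (query z h).1 c t h11
    cases c with
    | true =>
      obtain ⟨h14, rfl⟩ := den_det (fbody_true qm z h π hN h11 h12) h6
      obtain rfl := Sum.inr.inj h14
      refine ⟨rfl, fun _ => ⟨n, z.1.2.1 z.2, ⟨z, h8, rfl⟩, by simp, h13, h10⟩, fun h => by cases h⟩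
    | false =>
      rcases fbody_false hnj qm z h π hN h11 h12 (hk := hk) with ⟨h15, h14⟩ | ⟨z', h', h14, h15⟩
      · obtain ⟨h14, rfl⟩ := den_det h14 h6
        obtain rfl := Sum.inr.inj h14
        refine ⟨rfl, fun h => (by cases h), fun _ => ⟨⟨n, z, h8, h15⟩, ?_⟩⟩
        rintro y ⟨m, hm⟩
        obtain ⟨z', hz', hy⟩ := id hm
        have := h8.le_of_terminal hG h15 hz'
        rcases lt_or_eq_of_le this with h16 | rfl
        · exact h10 m h16 y hm
        · rw [hm.functional hG ⟨z, h8, rfl⟩]; exact h13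
      · have := (den_det h15 h6).1
        cases this
  · rintro ⟨⟨n, zt, hzt, hterm⟩, hT⟩
    have key : ∀ i m z h, m + i = n → At hk G g (w b) m z →
        ∃ o s', den (Mach.iter (fbody hk qm) (zc z h)) N g (zst z π) o s' := by
      intro i
      induction i with
      | zero =>
        intro m z h hm hz
        obtain rfl : m = n := hm
        obtain rfl := hz.functional hG hzt
        obtain ⟨c, t, h5⟩ := (query z h).2 (hT _ ⟨_, _, hz, rfl⟩)
        obtain ⟨h12, h13⟩ := (query z h).1 c t h5
        cases c with
        | true => exact ⟨_, _, den_iter_of _ _ (.inl (fbody_true qm z h π hN h5 h12))⟩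
        | false =>
          rcases fbody_false hnj qm z h π hN h5 h12 (hk := hk) with ⟨h15, h14⟩ | ⟨z', h', h14, h15⟩
          · exact ⟨_, _, den_iter_of _ _ (.inl h14)⟩
          · exact (hterm _ h14).elim
      | succ i ih =>
        intro m z h hm hz
        obtain ⟨c, t, h5⟩ := (query z h).2 (hT _ ⟨_, _, hz, rfl⟩)
        obtain ⟨h12, h13⟩ := (query z h).1 c t h5
        cases c with
        | true => exact ⟨_, _, den_iter_of _ _ (.inl (fbody_true qm z h π hN h5 h12))⟩
        | false =>
          rcases fbody_false hnj qm z h π hN h5 h12 (hk := hk) with ⟨h15, h14⟩ | ⟨z', h', h14, h15⟩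
          · exact ⟨_, _, den_iter_of _ _ (.inl h14)⟩
          · obtain ⟨o, s', h16⟩ := ih (m + 1) z' h' (by lia) (.succ hz h14)
            exact ⟨o, s', den_iter_of _ _ (.inr ⟨_, _, h15, h16⟩)⟩
    exact key n 0 ((G.q0, fun _ => w b, []), ⟨0, hk⟩) List.nodup_nil (by lia) .zero

end Find
end NestedPebblesGraphs

open Relation

namespace NestedPebblesGraphs
section Verify
variable {Sig : Type} {k : ℕ} (hk : 0 < k) (G : GWA Sig k)

/-- Decision procedures that are total on good graphs. -/
def WD (ι : Type) (Rt Rf : ∀ g : LGraph Sig, (ι → g.V) → Prop) : Prop :=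
  RzH Sig k ι Bool (fun g _ => Good hk G g)
    (fun g w o _ => (o = true → Rt g w) ∧ (o = false → Rf g w))

variable {hk G} {ι κ : Type} {Rt Rf Rt' Rf' : ∀ g : LGraph Sig, (ι → g.V) → Prop}

lemma WD.mono (h : WD hk G ι Rt Rf) (ht : ∀ g w, Rt g w → Rt' g w) (hf : ∀ g w, Rf g w → Rf' g w) :
    WD hk G ι Rt' Rf' :=
  RzH.mono h (fun _ _ h => h) (fun g w _ _ h => ⟨fun e => ht g w (h.1 e), fun e => hf g w (h.2 e)⟩)

lemma WD.rename (h : WD hk G ι Rt Rf) (r : ι → κ) :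
    WD hk G κ (fun g w => Rt g (fun i => w (r i))) (fun g w => Rf g (fun i => w (r i))) :=
  RzH.rename h r

lemma WD.not (h : WD hk G ι Rt Rf) : WD hk G ι Rf Rt := by
  refine (RzH.map h (fun b => !b)).mono (fun _ _ h => h) ?_
  rintro g w o hs ⟨a, rfl, h1, h2⟩
  cases a <;> simp_all

lemma WD.ofIff {P : ∀ g : LGraph Sig, (ι → g.V) → Prop}
    (h : RzH Sig k ι Bool (fun _ _ => True) (fun g w o _ => (o = true ↔ P g w))) :
    WD hk G ι P (fun g w => ¬ P g w) := by
  refine RzH.mono h (fun _ _ _ => trivial) ?_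
  rintro g w o hs h1
  refine ⟨h1.1, fun h2 h3 => ?_⟩
  rw [h1.2 h3] at h2
  cases h2

lemma WD.true : WD hk G ι (fun _ _ => True) (fun _ _ => False) := by
  refine (RzH.ret Bool.true).mono (fun _ _ _ => trivial) ?_
  rintro g w o hs rfl
  simp

lemma WD.and (h : WD hk G ι Rt Rf) (h' : WD hk G ι Rt' Rf') :
    WD hk G ι (fun g w => Rt g w ∧ Rt' g w) (fun g w => Rf g w ∨ Rf' g w) := by
  refine (RzH.bind (A := Bool) h (T := fun _ g _ => Good hk G g)
    (S := fun a g w o _ => (a = Bool.false → o = Bool.false) ∧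
      (a = Bool.true → (o = Bool.true → Rt' g w) ∧ (o = Bool.false → Rf' g w))) ?_).mono ?_ ?_
  · intro a
    cases a
    · refine (RzH.ret Bool.false).mono (fun _ _ _ => trivial) ?_
      rintro g w o hs rfl
      simp
    · refine RzH.mono h' (fun _ _ h => h) ?_
      intro g w o hs h1
      simpa using h1
  · exact fun g w h => ⟨h, fun _ _ _ => h⟩
  · rintro g w o hs ⟨a, _, h1, h2⟩
    cases a <;> cases o <;> simp_all

lemma WD.or (h : WD hk G ι Rt Rf) (h' : WD hk G ι Rt' Rf') :
    WD hk G ι (fun g w => Rt g w ∨ Rt' g w) (fun g w => Rf g w ∧ Rf' g w) :=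
  (h.not.and h'.not).not

lemma WD.listAnd {α : Type} (l : List α) {Pt Pf : α → ∀ g : LGraph Sig, (ι → g.V) → Prop}
    (h : ∀ a, WD hk G ι (Pt a) (Pf a)) :
    WD hk G ι (fun g w => ∀ a ∈ l, Pt a g w) (fun g w => ∃ a ∈ l, Pf a g w) := by
  induction l with
  | nil => exact WD.true.mono (by simp) (by simp)
  | cons a l ih =>
    refine ((h a).and ih).mono ?_ ?_
    · rintro g w ⟨h1, h2⟩
      simpa using ⟨h1, h2⟩
    · rintro g w (h1 | ⟨b, h1, h2⟩)
      · exact ⟨a, by simp, h1⟩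
      · exact ⟨b, by simp [h1], h2⟩

/-- Search for a visited node. -/
lemma WD.find (hG : GDeterministic G) (hnj : NoJump G) (b : ι)
    {Qt Qf : ∀ g : LGraph Sig, (Option ι → g.V) → Prop} (h : WD hk G (Option ι) Qt Qf) :
    WD hk G ι (fun g w => ∃ x, (∃ n, VstAt hk G g (w b) n x) ∧ Qt g (fun o => o.elim x w))
      (fun g w => Hlt hk G g (w b) ∧
        ∀ y, (∃ n, VstAt hk G g (w b) n y) → Qf g (fun o => o.elim y w)) := by
  refine (RzH.findG hk hG hnj b (Sq := fun g w o =>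
    (o = Bool.true → Qt g w) ∧ (o = Bool.false → Qf g w)) h).mono ?_ ?_
  · exact fun g w h => ⟨(h _).1, fun _ _ => h⟩
  · rintro g w o hs ⟨h1, h2⟩
    refine ⟨fun e => ?_, fun e => ?_⟩
    · obtain ⟨n, x, h3, _, h4, _⟩ := h1 e
      exact ⟨x, ⟨n, h3⟩, h4.1 rfl⟩
    · obtain ⟨h3, h4⟩ := h2 e
      exact ⟨h3, fun y hy => (h4 y hy).2 rfl⟩

lemma WD.chkOut (hG : GDeterministic G) (hnj : NoJump G) (b x : ι) (a : Sig) :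
    WD hk G ι (fun g w => ∀ u, g.edge a (w x) u → ∃ n, VstAt hk G g (w b) n u)
      (fun g _ => ¬ Good hk G g) := by
  have h1 := WD.find hG hnj b (WD.ofIff (hk := hk) (G := G) (RzH.edg hk a (some x) none))
  refine ((WD.ofIff (hk := hk) (G := G) (RzH.hasOut hk a x)).not.or h1).mono ?_ ?_
  · rintro g w (h | ⟨y, h2, h3⟩) u hu
    · exact (h ⟨u, hu⟩).elim
    · rw [g.out_unique _ _ _ _ hu h3]; exact h2
  · rintro g w ⟨⟨u, hu⟩, _, h3⟩ h
    exact h3 u ((h _).2 u) hu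

lemma WD.chkIn (hG : GDeterministic G) (hnj : NoJump G) (b x : ι) (a : Sig) :
    WD hk G ι (fun g w => ∀ u, g.edge a u (w x) → ∃ n, VstAt hk G g (w b) n u)
      (fun g _ => ¬ Good hk G g) := by
  have h1 := WD.find hG hnj b (WD.ofIff (hk := hk) (G := G) (RzH.edg hk a none (some x)))
  refine ((WD.ofIff (hk := hk) (G := G) (RzH.hasIn hk a x)).not.or h1).mono ?_ ?_
  · rintro g w (h | ⟨y, h2, h3⟩) u hu
    · exact (h ⟨u, hu⟩).elim
    · rw [g.in_unique _ _ _ _ hu h3]; exact h2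
  · rintro g w ⟨⟨u, hu⟩, _, h3⟩ h
    exact h3 u ((h _).2 u) hu

lemma WD.chkAll [Fintype Sig] (hG : GDeterministic G) (hnj : NoJump G) (b x : ι) :
    WD hk G ι (fun g w => ∀ a u, (g.edge a (w x) u ∨ g.edge a u (w x)) →
        ∃ n, VstAt hk G g (w b) n u)
      (fun g _ => ¬ Good hk G g) := by
  refine (WD.listAnd (Finset.univ : Finset Sig).toList (fun a =>
    (WD.chkOut (hk := hk) hG hnj b x a).and (WD.chkIn hG hnj b x a))).mono ?_ ?_
  · intro g w h a u
    obtain ⟨h1, h2⟩ := h a (by simp)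
    rintro (h3 | h3)
    · exact h1 u h3
    · exact h2 u h3
  · rintro g w ⟨a, _, h⟩
    exact h.elim id id

lemma WD.chkBase [Fintype Sig] (hG : GDeterministic G) (hnj : NoJump G) (b : ι) :
    WD hk G ι (fun g w => Hlt hk G g (w b) ∧ ∀ x, ∃ n, VstAt hk G g (w b) n x)
      (fun g _ => ¬ Good hk G g) := by
  refine (WD.find hG hnj b (WD.chkAll (hk := hk) hG hnj (some b) none).not).not.mono ?_ ?_
  · rintro g w ⟨h1, h2⟩
    refine ⟨h1, fun x => ?_⟩
    have h3 := g.conn (w b) x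
    induction h3 with
    | refl => exact ⟨0, vstAt_zero _⟩
    | tail _ h4 ih =>
      rcases h4 with ⟨a, h4⟩ | ⟨a, h4⟩
      · exact h2 _ ih a _ (.inl h4)
      · exact h2 _ ih a _ (.inr h4)
  · rintro g w ⟨_, _, h⟩
    exact h

/-- Verification that the guide works on the given graph. -/
lemma WD.good [Fintype Sig] (hG : GDeterministic G) (hnj : NoJump G) (b : ι) :
    WD hk G ι (fun g _ => Good hk G g) (fun g _ => ¬ Good hk G g) := by
  refine (WD.find hG hnj b (WD.chkBase (hk := hk) hG hnj none).not).not.mono ?_ ?_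
  · rintro g w ⟨h1, h2⟩ x
    have := (h2 (w b) ⟨0, vstAt_zero _⟩).2 x
    exact h2 x this
  · rintro g w ⟨_, _, h⟩
    exact h

/-! Deciding relations on good graphs -/

variable (hk G) in
def Dec (ι : Type) (R : ∀ g : LGraph Sig, (ι → g.V) → Prop) : Prop :=
  WD hk G ι (fun g w => Good hk G g → R g w) (fun g w => Good hk G g → ¬ R g w)

variable {R R' : ∀ g : LGraph Sig, (ι → g.V) → Prop}

lemma Dec.congr (h : Dec hk G ι R) (hR : ∀ g w, Good hk G g → (R g w ↔ R' g w)) :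
    Dec hk G ι R' :=
  WD.mono h (fun g w h1 hg => (hR g w hg).1 (h1 hg))
    (fun g w h1 hg h2 => h1 hg ((hR g w hg).2 h2))

lemma Dec.rename (h : Dec hk G ι R) (r : ι → κ) :
    Dec hk G κ (fun g w => R g (fun i => w (r i))) := WD.rename h r

lemma Dec.not (h : Dec hk G ι R) : Dec hk G ι (fun g w => ¬ R g w) :=
  (WD.not h).mono (fun _ _ h => h) (fun _ _ h hg hn => hn (h hg))

lemma Dec.and (h : Dec hk G ι R) (h' : Dec hk G ι R') : Dec hk G ι (fun g w => R g w ∧ R' g w) :=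
  (WD.and h h').mono (fun _ _ h hg => ⟨h.1 hg, h.2 hg⟩)
    (fun _ _ h hg hn => h.elim (fun h => h hg hn.1) (fun h => h hg hn.2))

lemma Dec.or (h : Dec hk G ι R) (h' : Dec hk G ι R') : Dec hk G ι (fun g w => R g w ∨ R' g w) :=
  (h.not.and h'.not).not.congr (fun g w _ => by tauto)

lemma Dec.imp (h : Dec hk G ι R) (h' : Dec hk G ι R') : Dec hk G ι (fun g w => R g w → R' g w) :=
  (h.not.or h').congr (fun g w _ => by tauto)

lemma Dec.true : Dec hk G ι (fun _ _ => True) :=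
  WD.true.mono (fun _ _ _ _ => trivial) (fun _ _ h => h.elim)

lemma Dec.const (P : Prop) : Dec hk G ι (fun _ _ => P) := by
  by_cases h : P
  · exact Dec.true.congr (by simp [h])
  · exact Dec.true.not.congr (by simp [h])

lemma Dec.ofIff {P : ∀ g : LGraph Sig, (ι → g.V) → Prop}
    (h : RzH Sig k ι Bool (fun _ _ => True) (fun g w o _ => (o = Bool.true ↔ P g w))) :
    Dec hk G ι P := (WD.ofIff h).mono (fun _ _ h _ => h) (fun _ _ h _ => h)

lemma Dec.allFin {n : ℕ} {P : Fin n → ∀ g : LGraph Sig, (ι → g.V) → Prop}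
    (h : ∀ a, Dec hk G ι (P a)) : Dec hk G ι (fun g w => ∀ a, P a g w) := by
  refine (WD.listAnd (List.finRange n) h).mono ?_ ?_
  · intro g w h hg a
    exact h a (by simp) hg
  · rintro g w ⟨a, _, h⟩ hg h1
    exact h hg (h1 a)

lemma Dec.exFin {n : ℕ} {P : Fin n → ∀ g : LGraph Sig, (ι → g.V) → Prop}
    (h : ∀ a, Dec hk G ι (P a)) : Dec hk G ι (fun g w => ∃ a, P a g w) :=
  (Dec.allFin (fun a => (h a).not)).not.congr (fun g w _ => by simp)

lemma Dec.ex (hG : GDeterministic G) (hnj : NoJump G) (b : ι)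
    {Q : ∀ g : LGraph Sig, (Option ι → g.V) → Prop} (h : Dec hk G (Option ι) Q) :
    Dec hk G ι (fun g w => ∃ x, Q g (fun o => o.elim x w)) := by
  refine (WD.find hG hnj b h).mono ?_ ?_
  · rintro g w ⟨x, _, h⟩ hg
    exact ⟨x, h hg⟩
  · rintro g w ⟨_, h⟩ hg ⟨x, h1⟩
    exact h x ((hg _).2 x) hg h1

/-- Time of the first visit. -/
noncomputable def ord (hk : 0 < k) (G : GWA Sig k) (g : LGraph Sig) (b x : g.V) : ℕ :=
  sInf {n | VstAt hk G g b n x}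

lemma ord_spec {g : LGraph Sig} (hg : Good hk G g) (b x : g.V) :
    VstAt hk G g b (ord hk G g b x) x :=
  Nat.sInf_mem (s := {n | VstAt hk G g b n x}) ((hg b).2 x)

lemma ord_inj (hG : GDeterministic G) {g : LGraph Sig} (hg : Good hk G g) (b : g.V) :
    Function.Injective (ord hk G g b) := by
  intro x y h
  have h1 := ord_spec hg b x
  rw [h] at h1
  exact h1.functional hG (ord_spec hg b y)

lemma RzH.findMin (hG : GDeterministic G) (hnj : NoJump G) (b : ι)
    {Q : ∀ g : LGraph Sig, (Option ι → g.V) → Prop} (h : Dec hk G (Option ι) Q) :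
    RzH Sig k ι Bool (fun g _ => Good hk G g) (fun g w o hs => Good hk G g →
      (o = Bool.true → Q g (fun o => o.elim (hs ⟨0, hk⟩) w) ∧
        ∀ y, Q g (fun o => o.elim y w) →
          ord hk G g (w b) (hs ⟨0, hk⟩) ≤ ord hk G g (w b) y) ∧
      (o = Bool.false → ∀ y, ¬ Q g (fun o => o.elim y w))) := by
  refine (RzH.findG hk hG hnj b (Sq := fun g w o =>
    (o = Bool.true → Good hk G g → Q g w) ∧ (o = Bool.false → Good hk G g → ¬ Q g w)) h).mono ?_ ?_
  · exact fun g w h => ⟨(h _).1, fun _ _ => h⟩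
  · rintro g w o hs ⟨h1, h2⟩ hg
    refine ⟨fun e => ?_, fun e => ?_⟩
    · obtain ⟨n, x, h3, h6, h4, h5⟩ := h1 e
      rw [h6]
      refine ⟨h4.1 rfl hg, fun y hy => ?_⟩
      refine (Nat.sInf_le h3).trans ?_
      by_contra! hlt
      exact (h5 _ hlt y (ord_spec hg (w b) y)).2 rfl hg hy
    · obtain ⟨h3, h4⟩ := h2 e
      exact fun y => (h4 y ((hg _).2 y)).2 rfl hg

lemma Dec.eq (x y : ι) : Dec hk G ι (fun _ w => w x = w y) := Dec.ofIff (RzH.eq hk x y)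

lemma Dec.lt (hG : GDeterministic G) (hnj : NoJump G) (b x y : ι) :
    Dec hk G ι (fun g w => ord hk G g (w b) (w x) < ord hk G g (w b) (w y)) := by
  have h1 : Dec hk G (Option ι) (fun _ w => w none = w (some x) ∨ w none = w (some y)) :=
    (Dec.eq none (some x)).or (Dec.eq none (some y))
  have h2 : Dec hk G (ι ⊕ Fin k) (fun _ w => w (.inr ⟨0, hk⟩) = w (.inl x) ∧
    ¬ w (.inl x) = w (.inl y)) := (Dec.eq _ _).and (Dec.eq _ _).not
  unfold Dec WD at h2 ⊢
  refine (RzH.bindH (RzH.findMin hG hnj b h1) (fun _ => h2)).mono ?_ ?_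
  · exact fun g w h => ⟨h, fun _ _ _ => h⟩
  · rintro g w o hs ⟨a, h, h3, h4, h5⟩
    simp only [Option.elim, Sum.elim_inr, Sum.elim_inl] at h3 h4 h5
    have key : Good hk G g → ((h ⟨0, hk⟩ = w x ∧ ¬ w x = w y) ↔
        ord hk G g (w b) (w x) < ord hk G g (w b) (w y)) := by
      intro hg
      obtain ⟨h6, h7⟩ := h3 hg
      cases a with
      | false => exact (h7 rfl _ (.inl rfl)).elim
      | true =>
        obtain ⟨h8, h9⟩ := h6 rfl
        constructor
        · rintro ⟨h10, h11⟩
          rw [h10] at h9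
          exact lt_of_le_of_ne (h9 _ (.inr rfl)) (fun h12 => h11 (ord_inj hG hg _ h12))
        · intro h10
          rcases h8 with h8 | h8
          · refine ⟨h8, fun h11 => ?_⟩
            rw [h11] at h10
            exact lt_irrefl _ h10
          · have := h9 _ (.inl rfl)
            rw [h8] at this
            lia
    exact ⟨fun e hg => (key hg).1 (h4 e hg), fun e hg h6 => h5 e hg ((key hg).2 h6)⟩

end Verify
end NestedPebblesGraphs

open Relation

namespace NestedPebblesGraphs
section DFS
variable {U : Type} (lt : U → U → Prop) (r : U → U → Prop) (v : U)

/-- Edges of the tree of nodes reaching `v`. -/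
def rv (a b : U) : Prop := a ≠ v ∧ r a b

/-- Steps of the depth-first traversal (`true` = entering, `false` = leaving). -/
def DStep : Bool × U → Bool × U → Prop
  | (true, b), (true, c) => rv r v c b ∧ ∀ c', rv r v c' b → ¬ lt c' c
  | (true, b), (false, c) => c = b ∧ ∀ c', ¬ rv r v c' b
  | (false, c), (true, c') => c ≠ v ∧ ∃ b, r c b ∧ rv r v c' b ∧ lt c c' ∧
      ∀ c'', rv r v c'' b → lt c c'' → ¬ lt c'' c'
  | (false, c), (false, b) => c ≠ v ∧ r c b ∧ ∀ c'', rv r v c'' b → ¬ lt c c''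

variable {lt r v}

lemma rv_of_r {t : U} (h : ReflTransGen r t v) : ReflTransGen (rv r v) t v := by
  induction h using ReflTransGen.head_induction_on with
  | refl => exact .refl
  | @head a b h _ ih =>
    by_cases ha : a = v
    · rw [ha]
    · exact .head ⟨ha, h⟩ ih

lemma r_of_rv {t : U} (h : ReflTransGen (rv r v) t v) : ReflTransGen r t v :=
  rtg_mono h (fun _ _ h => h.2)


lemma tree_irrefl (hf : ∀ a b b', r a b → r a b' → b = b')
    {t : U} (h : ReflTransGen (rv r v) t v) : ¬ TransGen (rv r v) t t := by
  induction h using ReflTransGen.head_induction_on with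
  | refl =>
    intro h
    obtain ⟨c, h1, _⟩ := TransGen.head'_iff.1 h
    exact h1.1 rfl
  | @head a b h _ ih =>
    intro h1
    obtain ⟨c, h2, h3⟩ := TransGen.head'_iff.1 h1
    obtain rfl := hf _ _ _ h.2 h2.2
    exact ih (TransGen.tail' h3 h)

lemma tree_wf (hf : ∀ a b b', r a b → r a b' → b = b')
    [Finite U] : WellFounded (fun c b => rv r v c b ∧ ReflTransGen (rv r v) b v) := by
  have h1 : WellFounded (TransGen (fun c b => rv r v c b ∧ ReflTransGen (rv r v) b v)) := by
    have : Std.Irrefl (TransGen (fun c b => rv r v c b ∧ ReflTransGen (rv r v) b v)) := by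
      constructor
      intro c h
      have h2 : ReflTransGen (rv r v) c v := by
        obtain ⟨d, h3, _⟩ := TransGen.head'_iff.1 h
        exact .head h3.1 h3.2
      exact tree_irrefl hf h2 (TransGen.mono (r := fun c b => rv r v c b ∧ ReflTransGen (rv r v) b v)
        (p := rv r v) (fun _ _ h => h.1) _ _ h)
    exact Finite.wellFounded_of_trans_of_irrefl _
  exact Subrelation.wf (r := TransGen (fun c b => rv r v c b ∧ ReflTransGen (rv r v) b v))
    (fun h => TransGen.single h) h1

lemma tree_parent (hf : ∀ a b b', r a b → r a b' → b = b')
    {c b : U} (h : ReflTransGen (rv r v) c v) (hc : c ≠ v) (hb : r c b) :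
    ReflTransGen (rv r v) b v := by
  rcases ReflTransGen.cases_head h with h | ⟨d, h1, h2⟩
  · exact (hc h).elim
  · rwa [hf _ _ _ hb h1.2]

lemma dstep_tree (hf : ∀ a b b', r a b → r a b' → b = b')
    {x y : Bool × U} (h : ReflTransGen (rv r v) x.2 v) (hs : DStep lt r v x y) :
    ReflTransGen (rv r v) y.2 v := by
  obtain ⟨_ | _, x⟩ := x <;> obtain ⟨_ | _, y⟩ := y
  · exact tree_parent hf h hs.1 hs.2.1
  · obtain ⟨h1, b, h2, h3, _⟩ := hs
    exact .head h3 (tree_parent hf h h1 h2)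
  · simp only at h
    rw [hs.1]
    exact h
  · exact .head hs.1 h

lemma dreach_tree (hf : ∀ a b b', r a b → r a b' → b = b')
    {y : Bool × U} (h : ReflTransGen (DStep lt r v) (true, v) y) :
    ReflTransGen (rv r v) y.2 v := by
  induction h with
  | refl => exact .refl
  | tail _ h1 ih => exact dstep_tree hf ih h1


lemma dstep_det (hf : ∀ a b b', r a b → r a b' → b = b') (htri : ∀ a b, lt a b ∨ a = b ∨ lt b a)
    {x y y' : Bool × U} (h : DStep lt r v x y) (h' : DStep lt r v x y') : y = y' := by
  obtain ⟨_ | _, x⟩ := x <;> obtain ⟨_ | _, y⟩ := y <;> obtain ⟨_ | _, y'⟩ := y'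
  · rw [hf _ _ _ h.2.1 h'.2.1]
  · obtain ⟨_, b, h1, h2, h3, _⟩ := h'
    obtain rfl := hf _ _ _ h.2.1 h1
    exact (h.2.2 _ h2 h3).elim
  · obtain ⟨_, b, h1, h2, h3, _⟩ := h
    obtain rfl := hf _ _ _ h'.2.1 h1
    exact (h'.2.2 _ h2 h3).elim
  · obtain ⟨_, b, h1, h2, h3, h4⟩ := h
    obtain ⟨_, b', h1', h2', h3', h4'⟩ := h'
    obtain rfl := hf _ _ _ h1 h1'
    rcases htri y y' with h5 | rfl | h5
    · exact (h4' _ h2 h3 h5).elim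
    · rfl
    · exact (h4 _ h2' h3' h5).elim
  · rw [h.1, h'.1]
  · exact (h.2 _ h'.1).elim
  · exact (h'.2 _ h.1).elim
  · rcases htri y y' with h5 | rfl | h5
    · exact (h'.2 _ h.1 h5).elim
    · rfl
    · exact (h.2 _ h'.1 h5).elim


lemma dfs_A [Finite U] (hf : ∀ a b b', r a b → r a b' → b = b')
    (hwf : WellFounded lt) (hwf' : WellFounded (fun a b => lt b a))
    {b : U} (hb : ReflTransGen (rv r v) b v) :
    ReflTransGen (DStep lt r v) (true, b) (false, b) := by
  induction b using (tree_wf hf (v := v)).induction with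
  | _ b ih =>
  have up : ∀ c, rv r v c b → ReflTransGen (DStep lt r v) (false, c) (false, b) := by
    intro c
    induction c using hwf'.induction with
    | _ c ihc =>
    intro hc
    by_cases hn : ∃ c', rv r v c' b ∧ lt c c'
    · obtain ⟨c', ⟨h1, h2⟩, h3⟩ := hwf.has_min {c' | rv r v c' b ∧ lt c c'} hn
      have hst : DStep lt r v (false, c) (true, c') :=
        ⟨hc.1, b, hc.2, h1, h2, fun c'' h4 h5 => h3 c'' ⟨h4, h5⟩⟩
      exact .head hst ((ih c' ⟨h1, hb⟩ (.head h1 hb)).trans (ihc c' h2 h1))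
    · push Not at hn
      exact .single (show DStep lt r v (false, c) (false, b) from ⟨hc.1, hc.2, hn⟩)
  by_cases hn : ∃ c, rv r v c b
  · obtain ⟨c, h1, h2⟩ := hwf.has_min {c | rv r v c b} hn
    have hst : DStep lt r v (true, b) (true, c) := ⟨h1, h2⟩
    exact .head hst ((ih c ⟨h1, hb⟩ (.head h1 hb)).trans (up c h1))
  · push Not at hn
    exact .single (show DStep lt r v (true, b) (false, b) from ⟨rfl, hn⟩)

lemma dfs_B [Finite U] (hf : ∀ a b b', r a b → r a b' → b = b')
    (hwf : WellFounded lt) (hwf' : WellFounded (fun a b => lt b a))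
    {x : U} (hx : ReflTransGen (rv r v) x v) :
    ReflTransGen (DStep lt r v) (true, v) (true, x) := by
  induction hx using ReflTransGen.head_induction_on with
  | refl => exact .refl
  | @head x b h hb ih =>
    refine ih.trans ?_
    clear ih
    induction x using hwf.induction with
    | _ x ihx =>
    by_cases hn : ∃ c', rv r v c' b ∧ lt c' x
    · obtain ⟨c, ⟨h1, h2⟩, h3⟩ := hwf'.has_min {c' | rv r v c' b ∧ lt c' x} hn
      have hst : DStep lt r v (false, c) (true, x) :=
        ⟨h1.1, b, h1.2, h, h2, fun c'' h4 h5 h6 => h3 c'' ⟨h4, h6⟩ h5⟩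
      exact ((ihx c h2 h1).trans (dfs_A hf hwf hwf' (.head h1 hb))).tail hst
    · push Not at hn
      exact .single (show DStep lt r v (true, b) (true, x) from ⟨h, hn⟩)

lemma dfs_term (y : Bool × U) : ¬ DStep lt r v (false, v) y := by
  obtain ⟨_ | _, y⟩ := y
  · exact fun h => h.1 rfl
  · exact fun h => h.1 rfl

lemma dfs_pass (hf : ∀ a b b', r a b → r a b' → b = b') (htri : ∀ a b, lt a b ∨ a = b ∨ lt b a)
    {u : U} {x s : Bool × U}
    (h : ReflTransGen (fun x y => x ≠ (true, u) ∧ DStep lt r v x y) s x)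
    (h' : ReflTransGen (DStep lt r v) s (true, u)) : ReflTransGen (DStep lt r v) x (true, u) := by
  induction h using ReflTransGen.head_induction_on with
  | refl => exact h'
  | @head a b h1 _ ih =>
    rcases ReflTransGen.cases_head h' with h2 | ⟨c, h2, h3⟩
    · exact (h1.1 h2).elim
    · rw [dstep_det hf htri h2 h1.2] at h3
      exact ih h3

lemma dfs_acc [Finite U] (hf : ∀ a b b', r a b → r a b' → b = b')
    (htri : ∀ a b, lt a b ∨ a = b ∨ lt b a)
    (hwf : WellFounded lt) (hwf' : WellFounded (fun a b => lt b a))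
    : Acc (fun y x => DStep lt r v x y) (true, v) := by
  have h := dfs_A hf hwf hwf' (.refl : ReflTransGen (rv r v) v v)
  generalize (true, v) = s at h ⊢
  induction h using ReflTransGen.head_induction_on with
  | refl => exact ⟨_, fun y hy => (dfs_term y hy).elim⟩
  | @head a b h1 _ ih =>
    refine ⟨_, fun y hy => ?_⟩
    rw [dstep_det hf htri hy h1]
    exact ih

end DFS
end NestedPebblesGraphs

open Relation

namespace NestedPebblesGraphs
section TC
variable {Sig : Type} {k : ℕ} {hk : 0 < k} {G : GWA Sig k} {ι κ : Type}

/-- Variables for the remaining components of a tuple. -/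
def shiftT {α : Type} (x : α) {n : ℕ} : ι ⊕ Fin (n + 1) → (ι ⊕ α) ⊕ Fin n
  | .inl i => .inl (.inl i)
  | .inr j => Fin.cases (.inl (.inr x)) (fun j => .inr j) j

lemma shiftT_elim {α V : Type} (x : α) {n : ℕ} (w : ι → V) (h : α → V) (y : Fin n → V) :
    (fun i => Sum.elim (Sum.elim w h) y (shiftT x i)) =
      Sum.elim w (Fin.cons (h x) y : Fin (n + 1) → V) := by
  funext i
  rcases i with i | j
  · rfl
  · refine Fin.cases ?_ (fun j => ?_) j <;> rfl

lemma ex_cons {V : Type} {n : ℕ} (P : (Fin (n + 1) → V) → Prop) :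
    (∃ y, P y) ↔ ∃ x, ∃ y, P (Fin.cons x y) :=
  ⟨fun ⟨y, h⟩ => ⟨y 0, fun i => y i.succ, by
    have : (Fin.cons (y 0) (fun i => y i.succ) : Fin (n + 1) → V) = y := Fin.cons_self_tail y
    rwa [this]⟩, fun ⟨x, y, h⟩ => ⟨_, h⟩⟩

lemma Dec.exT (hG : GDeterministic G) (hnj : NoJump G) (n : ℕ) : ∀ {ι : Type} (_ : ι) {R : ∀ g : LGraph Sig, (ι ⊕ Fin n → g.V) → Prop},
    Dec hk G (ι ⊕ Fin n) R → Dec hk G ι (fun g w => ∃ y, R g (Sum.elim w y)) := by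
  induction n with
  | zero =>
    intro ι b R h
    refine (h.rename (Sum.elim id (fun j => j.elim0))).congr (fun g w _ => ?_)
    have : ∀ y : Fin 0 → g.V, (fun i => w (Sum.elim id (fun j : Fin 0 => j.elim0) i)) =
        Sum.elim w y := by
      intro y
      funext i
      rcases i with i | j
      · rfl
      · exact j.elim0
    rw [this Fin.elim0]
    exact ⟨fun h => ⟨_, h⟩, fun ⟨y, h⟩ => by rwa [Subsingleton.elim Fin.elim0 y]⟩
  | succ n ih =>
    intro ι b R h
    have h1 := ih (.inl b) (h.rename (shiftT ()))
    have h2 := Dec.ex hG hnj b (h1.rename (κ := Option ι)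
      (Sum.elim some (fun _ => none)))
    refine h2.congr (fun g w _ => ?_)
    rw [ex_cons]
    refine exists_congr fun x => exists_congr fun y => ?_
    rw [← shiftT_elim () w (fun _ => x) y]
    have : (fun i : ι ⊕ Unit => Option.elim (Sum.elim some (fun _ => none) i) x w) =
        Sum.elim w (fun _ => x) := by
      funext i
      rcases i with i | i <;> rfl
    rw [this]

lemma Dec.allT (hG : GDeterministic G) (hnj : NoJump G) (n : ℕ) {ι : Type} (b : ι) {R : ∀ g : LGraph Sig, (ι ⊕ Fin n → g.V) → Prop}
    (h : Dec hk G (ι ⊕ Fin n) R) : Dec hk G ι (fun g w => ∀ y, R g (Sum.elim w y)) :=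
  (Dec.exT hG hnj n b h.not).not.congr (fun g w _ => by simp)

/-- Search a tuple with a given property, and continue. -/
lemma RzH.findT (hG : GDeterministic G) (hnj : NoJump G) {E : Type} [Finite E] (n : ℕ) :
    ∀ {ι : Type} (_ : ι) {R : ∀ g : LGraph Sig, (ι ⊕ Fin n → g.V) → Prop}
    {S : ∀ g : LGraph Sig, (ι ⊕ Fin n → g.V) → E → (Fin k → g.V) → Prop}
    {S' : ∀ g : LGraph Sig, (ι → g.V) → E → (Fin k → g.V) → Prop},
    Dec hk G (ι ⊕ Fin n) R → RzH Sig k (ι ⊕ Fin n) E (fun g _ => Good hk G g) S →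
    RzH Sig k ι E (fun g _ => Good hk G g) S' →
    RzH Sig k ι E (fun g _ => Good hk G g) (fun g w o hs => Good hk G g →
      (∃ y, R g (Sum.elim w y) ∧ S g (Sum.elim w y) o hs) ∨
      ((∀ y, ¬ R g (Sum.elim w y)) ∧ S' g w o hs)) := by
  induction n with
  | zero =>
    intro ι b R S S' h h1 h2
    have key : ∀ (g : LGraph Sig) (w : ι → g.V) (y : Fin 0 → g.V),
        (fun i => w (Sum.elim id (fun j : Fin 0 => j.elim0) i)) = Sum.elim w y := by
      intro g w y
      funext i
      rcases i with i | j
      · rfl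
      · exact j.elim0
    have h3 := h.rename (Sum.elim id (fun j => j.elim0))
    have h4 := h1.rename (Sum.elim id (fun j => j.elim0))
    unfold Dec WD at h3
    refine (RzH.bind (A := Bool) h3 (T := fun _ g _ => Good hk G g)
      (S := fun a g w o hs => (a = true → S g (Sum.elim w Fin.elim0) o hs) ∧
        (a = false → S' g w o hs)) ?_).mono ?_ ?_
    · rintro (_ | _)
      · exact h2.mono (fun _ _ h => h) (fun _ _ _ _ h => by simpa using h)
      · refine h4.mono (fun _ _ h => h) (fun g w o hs h => ?_)
        rw [key g w Fin.elim0] at h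
        simpa using h
    · exact fun g w h => ⟨h, fun _ _ _ => h⟩
    · rintro g w o hs ⟨a, _, h5, h6⟩ hg
      simp only [key g w Fin.elim0] at h5
      cases a with
      | true => exact .inl ⟨_, h5.1 rfl hg, h6.1 rfl⟩
      | false =>
        refine .inr ⟨fun y => ?_, h6.2 rfl⟩
        rw [Subsingleton.elim y Fin.elim0]
        exact h5.2 rfl hg
  | succ n ih =>
    intro ι b R S S' h h1 h2
    have h3 := Dec.exT hG hnj n (.inl b) (h.rename (shiftT ()))
    have h4 := RzH.findMin hG hnj b (h3.rename (κ := Option ι) (Sum.elim some (fun _ => none)))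
    have h5 := ih (ι := ι ⊕ Fin k) (.inl b) (h.rename (shiftT ⟨0, hk⟩))
      (h1.rename (shiftT ⟨0, hk⟩)) (h2.rename Sum.inl)
    refine (RzH.bindH (A := Bool) h4 (T := fun _ g _ => Good hk G g)
      (S := fun a g w o hs => (a = true → Good hk G g →
        (∃ y, R g (Sum.elim (fun i => w (.inl i)) (Fin.cons (w (.inr ⟨0, hk⟩)) y : Fin (n + 1) → g.V)) ∧
          S g (Sum.elim (fun i => w (.inl i)) (Fin.cons (w (.inr ⟨0, hk⟩)) y : Fin (n + 1) → g.V)) o hs) ∨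
        (∀ y, ¬ R g (Sum.elim (fun i => w (.inl i)) (Fin.cons (w (.inr ⟨0, hk⟩)) y : Fin (n + 1) → g.V)))) ∧
        (a = false → S' g (fun i => w (.inl i)) o hs)) ?_).mono ?_ ?_
    · rintro (_ | _)
      · exact (h2.rename Sum.inl).mono (fun _ _ h => h) (fun _ _ _ _ h => by simpa using h)
      · refine h5.mono (fun _ _ h => h) (fun g w o hs h => ?_)
        refine ⟨fun _ hg => ?_, fun h => by cases h⟩
        have hw : w = Sum.elim (fun i => w (.inl i)) (fun j => w (.inr j)) := by
          funext i
          rcases i with i | i <;> rfl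
        rw [hw] at h
        simp only [shiftT_elim] at h
        rcases h hg with h6 | h6
        · exact .inl h6
        · exact .inr h6.1
    · exact fun g w h => ⟨h, fun _ _ _ => h⟩
    · rintro g w o hs ⟨a, hd, h5, h6⟩ hg
      have key : ∀ x, (∃ y, R g (fun i => Sum.elim (fun j : ι ⊕ Unit => Option.elim (Sum.elim some (fun _ => none) j) x w) y (shiftT () i))) ↔
          ∃ y, R g (Sum.elim w (Fin.cons x y : Fin (n + 1) → g.V)) := by
        intro x
        refine exists_congr fun y => ?_
        rw [← shiftT_elim () w (fun _ => x) y]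
        have : (fun i : ι ⊕ Unit => Option.elim (Sum.elim some (fun _ => none) i) x w) =
            Sum.elim w (fun _ => x) := by
          funext i
          rcases i with i | i <;> rfl
        rw [this]
      obtain ⟨h7, h8⟩ := h5 hg
      cases a with
      | true =>
        obtain ⟨h9, _⟩ := h7 rfl
        rw [key] at h9
        obtain ⟨y, h9⟩ := h9
        rcases h6.1 rfl hg with ⟨y, h10, h11⟩ | h10
        · exact .inl ⟨_, h10, h11⟩
        · exact (h10 y h9).elim
      | false =>
        refine .inr ⟨?_, h6.2 rfl⟩
        rw [← not_exists, ex_cons]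
        rintro ⟨x, h9⟩
        exact h8 rfl x ((key x).2 h9)

end TC
end NestedPebblesGraphs

open Relation

namespace NestedPebblesGraphs
section TC
variable {Sig : Type} {k : ℕ} {hk : 0 < k} {G : GWA Sig k} {ι κ : Type}

/-- Lexicographic order on tuples. -/
def LT (hk : 0 < k) (G : GWA Sig k) (g : LGraph Sig) (b : g.V) (x y : Fin k → g.V) : Prop :=
  ∃ i, (∀ j, j < i → x j = y j) ∧ ord hk G g b (x i) < ord hk G g b (y i)

/-- The binary relation on tuples defined by `R`. -/
def RL (R : ∀ g : LGraph Sig, ((ι ⊕ Fin k) ⊕ Fin k → g.V) → Prop) (g : LGraph Sig)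
    (w : ι → g.V) (a b : Fin k → g.V) : Prop := R g (Sum.elim (Sum.elim w a) b)

lemma LT_iff (hG : GDeterministic G) {g : LGraph Sig} (hg : Good hk G g) (b : g.V)
    (x y : Fin k → g.V) : LT hk G g b x y ↔
      toLex (fun i => ord hk G g b (x i)) < toLex (fun i => ord hk G g b (y i)) := by
  unfold LT
  constructor
  · rintro ⟨i, h1, h2⟩
    exact ⟨i, fun j hj => by simp [h1 j hj], h2⟩
  · rintro ⟨i, h1, h2⟩
    exact ⟨i, fun j hj => ord_inj hG hg b (h1 j hj), h2⟩

lemma LT_tri (hG : GDeterministic G) {g : LGraph Sig} (hg : Good hk G g) (b : g.V)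
    (x y : Fin k → g.V) : LT hk G g b x y ∨ x = y ∨ LT hk G g b y x := by
  rw [LT_iff hG hg, LT_iff hG hg]
  rcases lt_trichotomy (toLex (fun i => ord hk G g b (x i)))
    (toLex (fun i => ord hk G g b (y i))) with h | h | h
  · exact .inl h
  · refine .inr (.inl ?_)
    funext i
    exact ord_inj hG hg b (congrFun (toLex.injective h) i)
  · exact .inr (.inr h)

lemma finTup (g : LGraph Sig) : Finite (Fin k → g.V) := by
  have := g.finV
  infer_instance

lemma LT_wf (hG : GDeterministic G) {g : LGraph Sig} (hg : Good hk G g) (b : g.V) :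
    WellFounded (LT hk G g b) := by
  have := finTup (k := k) g
  have i1 : IsTrans _ (LT hk G g b) := ⟨fun x y z h h' => by
    rw [LT_iff hG hg] at *
    exact h.trans h'⟩
  have i2 : Std.Irrefl (LT hk G g b) := ⟨fun x h => by
    rw [LT_iff hG hg] at h
    exact lt_irrefl _ h⟩
  exact Finite.wellFounded_of_trans_of_irrefl _

lemma LT_wf' (hG : GDeterministic G) {g : LGraph Sig} (hg : Good hk G g) (b : g.V) :
    WellFounded (fun x y => LT hk G g b y x) := by
  have := finTup (k := k) g
  have i1 : IsTrans _ (fun x y => LT hk G g b y x) := ⟨fun x y z h h' => by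
    simp only [LT_iff hG hg] at *
    exact h'.trans h⟩
  have i2 : Std.Irrefl (fun x y => LT hk G g b y x) := ⟨fun x h => by
    simp only [LT_iff hG hg] at h
    exact lt_irrefl _ h⟩
  exact Finite.wellFounded_of_trans_of_irrefl _

lemma Dec.ltT (hG : GDeterministic G) (hnj : NoJump G) (b : κ) (as bs : Fin k → κ) :
    Dec hk G κ (fun g w => LT hk G g (w b) (fun j => w (as j)) (fun j => w (bs j))) :=
  Dec.exFin fun i => Dec.and
    (Dec.allFin fun j => (Dec.const (j < i)).imp (Dec.eq (as j) (bs j)))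
    (Dec.lt hG hnj b (as i) (bs i))

lemma Dec.eqT (as bs : Fin k → κ) :
    Dec hk G κ (fun _ w => (fun j => w (as j)) = (fun j => w (bs j))) :=
  (Dec.allFin fun j => Dec.eq (as j) (bs j)).congr (fun g w _ => by rw [funext_iff])

variable {R : ∀ g : LGraph Sig, ((ι ⊕ Fin k) ⊕ Fin k → g.V) → Prop}

lemma Dec.rel (hR : Dec hk G ((ι ⊕ Fin k) ⊕ Fin k) R) (r : ι → κ) (as bs : Fin k → κ) :
    Dec hk G κ (fun g w => RL R g (fun i => w (r i)) (fun j => w (as j)) (fun j => w (bs j))) := by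
  refine (hR.rename (Sum.elim (Sum.elim r as) bs)).congr (fun g w _ => ?_)
  have : (fun i => w (Sum.elim (Sum.elim r as) bs i)) =
      Sum.elim (Sum.elim (fun i => w (r i)) (fun j => w (as j))) (fun j => w (bs j)) := by
    funext i
    rcases i with (i | i) | i <;> rfl
  rw [this]
  rfl

lemma Dec.rv (hR : Dec hk G ((ι ⊕ Fin k) ⊕ Fin k) R) (r : ι → κ) (vs as bs : Fin k → κ) :
    Dec hk G κ (fun g w => NestedPebblesGraphs.rv (RL R g (fun i => w (r i))) (fun j => w (vs j))
      (fun j => w (as j)) (fun j => w (bs j))) :=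
  (Dec.eqT as vs).not.and (hR.rel r as bs)

lemma Dec.dstep (hG : GDeterministic G) (hnj : NoJump G)
    (hR : Dec hk G ((ι ⊕ Fin k) ⊕ Fin k) R) (r : ι → κ) (b : κ) (vs as bs : Fin k → κ)
    (d d' : Bool) :
    Dec hk G κ (fun g w => DStep (LT hk G g (w b)) (RL R g (fun i => w (r i))) (fun j => w (vs j))
      (d, fun j => w (as j)) (d', fun j => w (bs j))) := by
  cases d <;> cases d'
  · have h := (Dec.eqT as vs).not.and ((hR.rel r as bs).and (Dec.allT hG hnj k b
      ((hR.rv (fun i => Sum.inl (r i)) (fun j => Sum.inl (vs j)) Sum.inr (fun j => Sum.inl (bs j))).imp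
        (Dec.ltT hG hnj (Sum.inl b) (fun j => Sum.inl (as j)) Sum.inr).not)))
    exact h
  · have h := (Dec.eqT as vs).not.and (Dec.exT hG hnj k b
      ((hR.rel (fun i => Sum.inl (r i)) (fun j => Sum.inl (as j)) Sum.inr).and
      ((hR.rv (fun i => Sum.inl (r i)) (fun j => Sum.inl (vs j)) (fun j => Sum.inl (bs j)) Sum.inr).and
      ((Dec.ltT hG hnj (Sum.inl b) (fun j => Sum.inl (as j)) (fun j => Sum.inl (bs j))).and
      (Dec.allT hG hnj k (Sum.inl b)
        ((hR.rv (fun i => Sum.inl (Sum.inl (r i))) (fun j => Sum.inl (Sum.inl (vs j))) Sum.inr (fun j => Sum.inl (Sum.inr j))).imp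
        ((Dec.ltT hG hnj (Sum.inl (Sum.inl b)) (fun j => Sum.inl (Sum.inl (as j))) Sum.inr).imp
        (Dec.ltT hG hnj (Sum.inl (Sum.inl b)) Sum.inr (fun j => Sum.inl (Sum.inl (bs j)))).not)))))))
    exact h
  · have h := (Dec.eqT bs as).and (Dec.allT hG hnj k b
      (hR.rv (fun i => Sum.inl (r i)) (fun j => Sum.inl (vs j)) Sum.inr (fun j => Sum.inl (as j))).not)
    exact h
  · have h := (hR.rv r vs bs as).and (Dec.allT hG hnj k b
      ((hR.rv (fun i => Sum.inl (r i)) (fun j => Sum.inl (vs j)) Sum.inr (fun j => Sum.inl (as j))).imp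
        (Dec.ltT hG hnj (Sum.inl b) Sum.inr (fun j => Sum.inl (bs j))).not))
    exact h

lemma RzH.ite {E : Type} [Finite E] {P : ∀ g : LGraph Sig, (κ → g.V) → Prop}
    {S1 S2 : ∀ g : LGraph Sig, (κ → g.V) → E → (Fin k → g.V) → Prop} (h : Dec hk G κ P)
    (h1 : RzH Sig k κ E (fun g _ => Good hk G g) S1)
    (h2 : RzH Sig k κ E (fun g _ => Good hk G g) S2) :
    RzH Sig k κ E (fun g _ => Good hk G g) (fun g w o hs => Good hk G g →
      (P g w ∧ S1 g w o hs) ∨ (¬ P g w ∧ S2 g w o hs)) := by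
  unfold Dec WD at h
  refine (RzH.bind (A := Bool) h (T := fun _ g _ => Good hk G g)
    (S := fun a g w o hs => (a = true → S1 g w o hs) ∧ (a = false → S2 g w o hs)) ?_).mono ?_ ?_
  · rintro (_ | _)
    · exact h2.mono (fun _ _ h => h) (fun _ _ _ _ h => by simpa using h)
    · exact h1.mono (fun _ _ h => h) (fun _ _ _ _ h => by simpa using h)
  · exact fun g w h => ⟨h, fun _ _ _ => h⟩
  · rintro g w o hs ⟨a, _, h3, h4⟩ hg
    cases a with
    | true => exact .inl ⟨h3.1 rfl hg, h4.1 rfl⟩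
    | false => exact .inr ⟨h3.2 rfl hg, h4.2 rfl⟩

/-- One step of the traversal. -/
lemma RzH.tcBody (hG : GDeterministic G) (hnj : NoJump G)
    (hR : Dec hk G ((ι ⊕ Fin k) ⊕ Fin k) R) (b : ι) (us vs : Fin k → ι) (d : Bool) :
    RzH Sig k (ι ⊕ Fin k) (Bool ⊕ Bool) (fun g _ => Good hk G g)
      (fun g w o hs => Good hk G g →
        let u : Fin k → g.V := fun j => w (.inl (us j))
        let x : Bool × (Fin k → g.V) := (d, fun j => w (.inr j))
        let D := DStep (LT hk G g (w (.inl b))) (RL R g (fun i => w (.inl i)))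
          (fun j => w (.inl (vs j)))
        (∀ d', o = .inl d' → x ≠ (true, u) ∧ D x (d', hs)) ∧
        (o = .inr true → x = (true, u)) ∧
        (o = .inr false → x ≠ (true, u) ∧ ∀ y, ¬ D x y)) := by
  have hhalt : Dec hk G (ι ⊕ Fin k) (fun g w => d = true ∧
      (fun j => w (.inr j)) = fun j => w (.inl (us j))) := (Dec.const _).and (Dec.eqT _ _)
  have hst : ∀ d', Dec hk G ((ι ⊕ Fin k) ⊕ Fin k) _ := fun d' =>
    Dec.dstep hG hnj hR (fun i => .inl (.inl i)) (.inl (.inl b)) (fun j => .inl (.inl (vs j)))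
      (fun j => .inl (.inr j)) .inr d d'
  have hj : ∀ d', RzH Sig k ((ι ⊕ Fin k) ⊕ Fin k) (Bool ⊕ Bool) (fun g _ => Good hk G g) 
      (fun g w o hs => o = .inl d' ∧ hs = fun j => w (.inr j)) := fun d' => by
    refine ((RzH.jump Sum.inr).map (fun _ => Sum.inl d')).mono (fun _ _ _ => trivial) ?_
    rintro g w o hs ⟨_, h1, h2⟩
    exact ⟨h1.symm, h2⟩
  have hr : RzH Sig k (ι ⊕ Fin k) (Bool ⊕ Bool) (fun g _ => Good hk G g) 
      (fun g w o hs => o = .inr false) := (RzH.ret _).mono (fun _ _ _ => trivial) (fun _ _ _ _ h => h)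
  have h2 := RzH.findT hG hnj k (.inl b) (hst true) (hj true)
    (RzH.findT hG hnj k (.inl b) (hst false) (hj false) hr)
  have h1 : RzH Sig k (ι ⊕ Fin k) (Bool ⊕ Bool) (fun g _ => Good hk G g)
      (fun g w o hs => o = .inr true) := (RzH.ret _).mono (fun _ _ _ => trivial) (fun _ _ _ _ h => h)
  refine (RzH.ite hhalt h1 h2).mono (fun _ _ h => h) ?_
  · intro g w o hs h4 hg
    rcases h4 hg with ⟨⟨rfl, h5⟩, rfl⟩ | ⟨h5, h4⟩
    · simp [h5]
    · have h6 : ((d, fun j => w (.inr j)) : Bool × (Fin k → g.V)) ≠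
        (true, fun j => w (.inl (us j))) := by
        intro h
        rw [Prod.mk.injEq] at h
        exact h5 h
      rcases h4 hg with ⟨y, h7, rfl, rfl⟩ | ⟨h7, h8⟩
      · refine ⟨?_, by simp, by simp⟩
        rintro _ ⟨⟩
        exact ⟨h6, h7⟩
      · rcases h8 hg with ⟨y, h9, rfl, rfl⟩ | ⟨h9, rfl⟩
        · refine ⟨?_, by simp, by simp⟩
          rintro _ ⟨⟩
          exact ⟨h6, h9⟩
        · refine ⟨by simp, by simp, fun _ => ⟨h6, ?_⟩⟩
          rintro ⟨_ | _, y⟩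
          · exact h9 y
          · exact h7 y

lemma Dec.tc (hG : GDeterministic G) (hnj : NoJump G)
    (hR : Dec hk G ((ι ⊕ Fin k) ⊕ Fin k) R) (b : ι) (us vs : Fin k → ι)
    (hf : ∀ g (w : ι → g.V) x y y', RL R g w x y → RL R g w x y' → y = y') :
    Dec hk G ι (fun g w => ReflTransGen (RL R g w) (fun j => w (us j)) (fun j => w (vs j))) := by
  unfold Dec WD
  refine (RzH.iterH ((RzH.jump vs).map (fun _ => Bool.true))
    (RzH.tcBody hG hnj hR b us vs)).mono ?_ ?_
  · intro g w hg
    have := finTup (k := k) g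
    refine ⟨trivial, ?_⟩
    rintro a h ⟨_, rfl, rfl⟩
    refine ⟨?_, fun _ _ => hg⟩
    have := dfs_acc (v := fun j => w (vs j)) (hf g w) (LT_tri hG hg (w b)) (LT_wf hG hg (w b)) (LT_wf' hG hg (w b))
    exact Subrelation.accessible (fun {x y} h => ((h hg).1 _ rfl).2) this
  · rintro g w o hs ⟨a, h, ⟨_, rfl, rfl⟩, x, h1, h2⟩
    have := finTup (k := k) g
    have key : Good hk G g → ReflTransGen (fun x y => x ≠ (Bool.true, fun j => w (us j)) ∧
      DStep (LT hk G g (w b)) (RL R g w) (fun j => w (vs j)) x y) (Bool.true, fun j => w (vs j)) x :=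
      fun hg => rtg_mono h1 (fun x y h => (h hg).1 _ rfl)
    refine ⟨fun e hg => ?_, fun e hg h3 => ?_⟩
    · subst e
      have h3 := (h2 hg).2.1 rfl
      have h4 := dreach_tree (hf g w) (rtg_mono (key hg) (fun _ _ h => h.2))
      have h5 : x = (Bool.true, fun j => w (us j)) := h3
      rw [h5] at h4
      exact r_of_rv h4
    · subst e
      obtain ⟨h4, h5⟩ := (h2 hg).2.2 rfl
      have h6 := dfs_B (hf g w) (LT_wf hG hg (w b)) (LT_wf' hG hg (w b)) (rv_of_r h3)
      have h7 := dfs_pass (hf g w) (LT_tri hG hg (w b)) (key hg) h6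
      rcases ReflTransGen.cases_head h7 with h8 | ⟨y, h8, _⟩
      · exact h4 h8
      · exact h5 y h8

end TC
end NestedPebblesGraphs

open Relation

namespace NestedPebblesGraphs
section Final
variable {Sig : Type} {k : ℕ} {hk : 0 < k} {G : GWA Sig k}

lemma gsat_coinc {g : LGraph Sig} (φ : GForm Sig k) : ∀ ν ν' : ℕ → g.V,
    (∀ n ∈ gfree φ, ν n = ν' n) → (GSat g φ ν ↔ GSat g φ ν') := by
  induction φ with
  | lab a x => intro ν ν' h; simp [GSat, h x (by simp [gfree])]
  | edg a x y => intro ν ν' h; simp [GSat, h x (by simp [gfree]), h y (by simp [gfree])]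
  | eq x y => intro ν ν' h; simp [GSat, h x (by simp [gfree]), h y (by simp [gfree])]
  | not φ ih => intro ν ν' h; exact not_congr (ih ν ν' h)
  | and φ ψ ih1 ih2 =>
    intro ν ν' h
    exact and_congr (ih1 ν ν' fun n hn => h n (.inl hn)) (ih2 ν ν' fun n hn => h n (.inr hn))
  | or φ ψ ih1 ih2 =>
    intro ν ν' h
    exact or_congr (ih1 ν ν' fun n hn => h n (.inl hn)) (ih2 ν ν' fun n hn => h n (.inr hn))
  | ex x φ ih =>
    intro ν ν' h
    refine exists_congr fun u => ih _ _ fun n hn => ?_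
    by_cases hx : n = x
    · simp [hx]
    · simpa [hx] using h n ⟨hn, hx⟩
  | all x φ ih =>
    intro ν ν' h
    refine forall_congr' fun u => ih _ _ fun n hn => ?_
    by_cases hx : n = x
    · simp [hx]
    · simpa [hx] using h n ⟨hn, hx⟩
  | tc xs ys φ us vs ih =>
    intro ν ν' h
    have h1 : (fun i => ν (us i)) = fun i => ν' (us i) := by
      funext i
      exact h _ (.inl (.inr ⟨i, rfl⟩))
    have h2 : (fun i => ν (vs i)) = fun i => ν' (vs i) := by
      funext i
      exact h _ (.inr ⟨i, rfl⟩)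
    have h3 : (fun a b : Fin k → g.V => GSat g φ (updVec (updVec ν xs a) ys b)) =
        fun a b => GSat g φ (updVec (updVec ν' xs a) ys b) := by
      funext a b
      refine propext (ih _ _ fun n hn => ?_)
      unfold updVec
      by_cases hy : ∃ i, ys i = n
      · simp only [hy, dif_pos]
      · by_cases hx : ∃ i, xs i = n
        · simp only [hy, hx, dif_pos, dif_neg, not_false_eq_true]
        · simp only [hy, hx, dif_neg, not_false_eq_true]
          refine h n (.inl (.inl ⟨hn, ?_⟩))
          rintro (h | h)
          · exact hx h
          · exact hy h
    simp only [GSat, h1, h2, h3]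

/-- Renaming for a quantifier. -/
def qren (x : ℕ) : Option ℕ → Option (Option ℕ)
  | none => some none
  | some n => if n = x then none else some (some n)

lemma qren_upd {V : Type} (x : ℕ) (w : Option ℕ → V) (u : V) :
    (fun n => Option.elim (qren x (some n)) u w) = Function.update (fun n => w (some n)) x u := by
  funext n
  by_cases h : n = x <;> simp [qren, h]

open Classical in
/-- Renaming for a transitive closure. -/
noncomputable def tren (xs ys : Fin k → ℕ) : Option ℕ → (Option ℕ ⊕ Fin k) ⊕ Fin k
  | none => .inl (.inl none)
  | some n => if h : ∃ i, ys i = n then .inr h.choose else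
      if h : ∃ i, xs i = n then .inl (.inr h.choose) else .inl (.inl (some n))

lemma tren_upd {V : Type} (xs ys : Fin k → ℕ) (w : Option ℕ → V) (a b : Fin k → V) :
    (fun n => Sum.elim (Sum.elim w a) b (tren xs ys (some n))) =
      updVec (updVec (fun n => w (some n)) xs a) ys b := by
  funext n
  unfold updVec tren
  by_cases hy : ∃ i, ys i = n
  · simp only [hy, dif_pos, Sum.elim_inr]
  · by_cases hx : ∃ i, xs i = n
    · simp only [hy, hx, dif_pos, dif_neg, not_false_eq_true, Sum.elim_inr, Sum.elim_inl]
    · simp only [hy, hx, dif_neg, not_false_eq_true, Sum.elim_inl]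

lemma Dec.form (hG : GDeterministic G) (hnj : NoJump G) (φ : GForm Sig k) (hφ : GDetTC φ) :
    Dec hk G (Option ℕ) (fun g w => GSat g φ (fun n => w (some n))) := by
  induction φ with
  | lab a x => exact Dec.ofIff (RzH.lab hk a (some x))
  | edg a x y => exact Dec.ofIff (RzH.edg hk a (some x) (some y))
  | eq x y => exact Dec.eq (some x) (some y)
  | not φ ih => exact (ih hφ).not
  | and φ ψ ih1 ih2 => exact (ih1 hφ.1).and (ih2 hφ.2)
  | or φ ψ ih1 ih2 => exact (ih1 hφ.1).or (ih2 hφ.2)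
  | ex x φ ih =>
    refine (Dec.ex hG hnj none ((ih hφ).rename (qren x))).congr (fun g w _ => ?_)
    refine exists_congr fun u => ?_
    rw [qren_upd]
  | all x φ ih =>
    refine (Dec.ex hG hnj none ((ih hφ).not.rename (qren x))).not.congr (fun g w _ => ?_)
    rw [not_exists]
    refine forall_congr' fun u => ?_
    rw [qren_upd, not_not]
  | tc xs ys φ us vs ih =>
    have key : ∀ (g : LGraph Sig) (w : Option ℕ → g.V), RL (k := k) (fun g w =>
        GSat g φ (fun n => w (tren xs ys (some n)))) g w =
        fun a b => GSat g φ (updVec (updVec (fun n => w (some n)) xs a) ys b) := by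
      intro g w
      funext a b
      unfold RL
      beta_reduce
      rw [tren_upd]
    refine (Dec.tc hG hnj ((ih hφ.2).rename (tren xs ys)) none (fun j => some (us j))
      (fun j => some (vs j)) ?_).congr (fun g w _ => ?_)
    · intro g w x y y' h h'
      rw [key] at h h'
      exact hφ.1 g _ x y y' h h'
    · rw [key]
      rfl

theorem FODTCg_subset [Fintype Sig] (F : Set (LGraph Sig)) (k : ℕ) (hF : kSearchable Sig F k)
    (hk : 1 ≤ k) : FODTCg Sig F k ⊆ DPTWAgJ Sig F k := by
  obtain ⟨G, hG, hnj, hs⟩ := hF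
  have hk0 : 0 < k := hk
  rintro L ⟨φ, _, h2, h3, rfl⟩
  have h4 := (WD.good (hk := hk0) (ι := Option ℕ) hG hnj none).and (Dec.form hG hnj φ h2)
  unfold WD at h4
  obtain ⟨d, h4⟩ := h4
  obtain ⟨p, hp⟩ := h4 (fun _ => 0)
  let M : Mach Sig k Bool := (Mach.act (.push ⟨0, hk0⟩)).bind fun _ => p.bind fun b =>
    (Mach.act .pop).map fun _ => b
  have hacc : ∀ (g : LGraph Sig) (u : g.V), AccFrom (toGWA hk0 (1 + d) M) g u ↔
      Good hk0 G g ∧ GSat g φ (fun _ => u) := by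
    intro g u
    have hpush : den (Mach.act (Sig := Sig) (k := k) (.push ⟨0, hk0⟩)) (1 + d) g (fun _ => u, []) ()
        (fun _ => u, [u]) := den_act.2 ⟨rfl, rfl, by simp⟩
    obtain ⟨h5, h6⟩ := hp (1 + d) g (fun _ => u) [u] (fun _ => u) (by simp) (by simp)
    rw [toGWA_accFrom]
    constructor
    · rintro ⟨hs', h7⟩
      rw [den_bind_of hpush, den_bind] at h7
      obtain ⟨b, t, h8, h9⟩ := h7
      obtain ⟨_, h10, h11⟩ := (den_map _ _).1 h9
      subst h11
      obtain ⟨h12, h13⟩ := (h5 _ _ h8).2.1 rfl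
      exact ⟨h12, h13 h12⟩
    · rintro ⟨h7, h8⟩
      obtain ⟨o, ⟨t1, t2⟩, h9⟩ := h6 h7
      obtain ⟨h10, h11, h12⟩ := h5 _ _ h9
      simp only at h10
      subst h10
      have h13 : o = true := by
        cases o with
        | true => rfl
        | false =>
          rcases h12 rfl with h | h
          · exact (h h7).elim
          · exact (h h7 h8).elim
      subst h13
      refine ⟨t1, ?_⟩
      rw [den_bind_of hpush, den_bind_of h9]
      exact den_map_of (a := ()) (fun _ => true) _ (den_act.2 ⟨rfl, u, rfl⟩)
  have hco : ∀ (g : LGraph Sig) (ν ν' : ℕ → g.V), GSat g φ ν ↔ GSat g φ ν' :=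
    fun g ν ν' => gsat_coinc φ ν ν' (by simp [h3])
  refine ⟨toGWA hk0 (1 + d) M, toGWA_det _ _ _, ?_, ?_⟩
  · intro g u₁ u₂ h
    rw [hacc] at h ⊢
    exact ⟨h.1, (hco g _ _).1 h.2⟩
  · ext g
    refine and_congr_right fun hg => ?_
    constructor
    · exact fun h u => (hacc g u).2 ⟨good_of_searches (hs g hg), h _⟩
    · intro h ν
      exact (hco g _ _).1 ((hacc g (ν 0)).1 (h _)).2

end Final
end NestedPebblesGraphs

namespace NestedPebblesGraphs

/-- For every `k`-searchable family of graphs and every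
`k ≥ 1`, deterministic `k`-head graph-walking automata with nested pebbles and
jump instructions accept exactly the graph languages of `FO+DTC^k`. -/
theorem DPTWAgJ_eq_FODTCg_of_kSearchable (Sig : Type) [Fintype Sig]
    (F : Set (LGraph Sig)) (k : ℕ) (hF : kSearchable Sig F k) (hk : 1 ≤ k) :
    DPTWAgJ Sig F k = FODTCg Sig F k := by
  exact Set.Subset.antisymm (DPTWAgJ_subset F k) (FODTCg_subset F k hF hk)

end NestedPebblesGraphs
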